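/- Consider an IDO chore instance with n ≥ 2 agents and additive positive cost functions v_1,…,v_n such that MMS^{⌊9n/11⌋}(v_i, M) = 1 for every agent i. If the HFFD algorithm is executed with thresholds τ_i ≥ 1 for every agent i, then HFFD allocates all chores. -/

import Mathlib

open Finset

variable {α : Type*} [DecidableEq α]

/-- The total cost of a bundle `S` of chores under the additive cost function `v`. -/
def bundleCost (v : α → ℚ) (S : Finset α) : ℚ := ∑ c ∈ S, v c

/-- `P` is a partition of `M` into `d` (possibly empty) bundles. -/
def IsPartitionInto (M : Finset α) (d : ℕ) (P : Fin d → Finset α) : Prop :=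
  (∀ j, P j ⊆ M) ∧ (∀ j k, j ≠ k → Disjoint (P j) (P k)) ∧ ∀ c ∈ M, ∃ j, c ∈ P j

/-- `μ` is the `d`-maximin share `MMS^d(v, M)`: the minimum, over all partitions of `M`
into `d` bundles, of the maximum bundle cost. -/
def IsMMS (v : α → ℚ) (M : Finset α) (d : ℕ) (μ : ℚ) : Prop :=
  (∃ P : Fin d → Finset α, IsPartitionInto M d P ∧ ∀ j, bundleCost v (P j) ≤ μ) ∧
    ∀ P : Fin d → Finset α, IsPartitionInto M d P → ∃ j, μ ≤ bundleCost v (P j)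

/-- Build one HFFD bundle: scan the remaining chores in order, adding a chore iff after
adding it the bundle's cost is at most `τ i` under `v i` for at least one remaining agent `i`. -/
def hffdBundle {n : ℕ} (v : Fin n → α → ℚ) (τ : Fin n → ℚ)
    (Ag : Finset (Fin n)) : List α → Finset α → Finset α
  | [], B => B
  | c :: R, B =>
      if ∃ i ∈ Ag, bundleCost (v i) (insert c B) ≤ τ i then
        hffdBundle v τ Ag R (insert c B)
      else hffdBundle v τ Ag R B

/-- The state of HFFD (remaining chores, remaining agents) after `k` bundles have been
built, where `σ j` is the agent to whom the `j`-th bundle is assigned. -/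
def hffdState {n : ℕ} (v : Fin n → α → ℚ) (τ : Fin n → ℚ)
    (L : List α) (σ : ℕ → Fin n) : ℕ → List α × Finset (Fin n)
  | 0 => (L, Finset.univ)
  | k + 1 =>
      let s := hffdState v τ L σ k
      let B := hffdBundle v τ s.2 s.1 ∅
      (s.1.filter fun c => c ∉ B, s.2.erase (σ k))

/-- The `k`-th bundle built by HFFD (0-indexed). -/
def hffdBundleAt {n : ℕ} (v : Fin n → α → ℚ) (τ : Fin n → ℚ)
    (L : List α) (σ : ℕ → Fin n) (k : ℕ) : Finset α :=
  hffdBundle v τ (hffdState v τ L σ k).2 (hffdState v τ L σ k).1 ∅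

/-- `σ` is a valid execution of HFFD: each bundle is assigned to a remaining agent
for whom its cost is at most that agent's threshold. -/
def ValidHFFDRun {n : ℕ} (v : Fin n → α → ℚ) (τ : Fin n → ℚ)
    (L : List α) (σ : ℕ → Fin n) : Prop :=
  ∀ k < n, σ k ∈ (hffdState v τ L σ k).2 ∧
    bundleCost (v (σ k)) (hffdBundleAt v τ L σ k) ≤ τ (σ k)

/-- `L` is a universal ordering witnessing that the instance is IDO: an enumeration of `M`
that is non-increasing w.r.t. every agent's cost function. -/
def IsUniversalOrder {n : ℕ} (v : Fin n → α → ℚ) (M : Finset α) (L : List α) : Prop :=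
  L.toFinset = M ∧ L.Nodup ∧ ∀ i, L.Pairwise fun c c' => v i c' ≤ v i c


namespace HF

/-- items of `S` carrying label `j` -/
def bin (S : Finset α) (kk : α → ℕ) (j : ℕ) : Finset α := S.filter (fun y => kk y = j)

/-- Abstract first-fit-decreasing configuration in which the item `z` could not be packed. -/
structure Core (S : Finset α) (z : α) (v : α → ℚ) (kk g : α → ℕ) (N D : Finset ℕ) : Prop where
  zS : z ∈ S
  zk : ∀ j ∈ N, j < kk z
  kN : ∀ x ∈ S, x ≠ z → kk x ∈ N
  ff : ∀ x ∈ S, ∀ j ∈ N, j < kk x → 1 < v x + ∑ y ∈ (bin S kk j).filter (fun y => v x ≤ v y), v y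
  pos : 0 < v z
  vmin : ∀ x ∈ S, v z ≤ v x
  gD : ∀ x ∈ S, g x ∈ D
  opt : ∀ p ∈ D, ∑ x ∈ bin S g p, v x ≤ 1
  card : 11 * #D ≤ 9 * #N

theorem mem_bin {S : Finset α} {kk : α → ℕ} {j : ℕ} {x : α} : x ∈ bin S kk j ↔ x ∈ S ∧ kk x = j := by
  simp [bin]

section
variable {S : Finset α} {z : α} {v : α → ℚ} {kk g : α → ℕ} {N D : Finset ℕ}

theorem Core.vpos (H : Core S z v kk g N D) {x : α} (hx : x ∈ S) : 0 < v x :=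
  lt_of_lt_of_le H.pos (H.vmin x hx)

theorem Core.le_one (H : Core S z v kk g N D) {x : α} (hx : x ∈ S) : v x ≤ 1 := by
  refine le_trans ?_ (H.opt (g x) (H.gD x hx))
  exact Finset.single_le_sum (f := v) (fun y hy => (H.vpos (mem_bin.1 hy).1).le) (mem_bin.2 ⟨hx, rfl⟩)

theorem Core.full (H : Core S z v kk g N D) {j : ℕ} (hj : j ∈ N) :
    1 < v z + ∑ y ∈ bin S kk j, v y := by
  have := H.ff z H.zS j hj (H.zk j hj)
  rwa [Finset.filter_true_of_mem] at this
  intro y hy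
  exact H.vmin y (mem_bin.1 hy).1

theorem Core.later (H : Core S z v kk g N D) {j : ℕ} (hj : j ∈ N) {x : α} (hx : x ∈ S)
    (h : j < kk x) : ∃ y ∈ bin S kk j, v x ≤ v y := by
  by_contra hc
  push Not at hc
  have := H.ff x hx j hj h
  rw [Finset.filter_false_of_mem (fun y hy => not_le.2 (hc y hy))] at this
  simp at this
  linarith [H.le_one hx]

theorem Core.kk_mem (H : Core S z v kk g N D) {x y : α} (hx : x ∈ S) (hy : y ∈ S)
    (h : kk x < kk y) : kk x ∈ N := by
  apply H.kN x hx
  rintro rfl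
  by_cases hyz : y = x
  · subst hyz; exact lt_irrefl _ h
  · exact lt_asymm h (H.zk _ (H.kN y hy hyz))

/-- removal of one bin and one optimal bin -/
theorem Core.remove (H : Core S z v kk g N D) {k : ℕ} (hk : k ∈ N) {p : ℕ} (hp : p ∈ D) (g' : α → ℕ)
    (h1 : ∀ x ∈ S, kk x ≠ k → g' x ∈ D.erase p)
    (h2 : ∀ q ∈ D.erase p, ∑ x ∈ bin (S.filter (fun x => kk x ≠ k)) g' q, v x ≤ 1) :
    Core (S.filter (fun x => kk x ≠ k)) z v kk g' (N.erase k) (D.erase p) := by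
  have hzk := (H.zk k hk).ne'
  refine ⟨by simp [H.zS, hzk], fun j hj => H.zk j (mem_of_mem_erase hj), ?_, ?_, H.pos, ?_, ?_, h2, ?_⟩
  · intro x hx hxz
    simp at hx ⊢
    exact ⟨hx.2, H.kN x hx.1 hxz⟩
  · intro x hx j hj hjx
    have hjk := ne_of_mem_erase hj
    have := H.ff x (mem_filter.1 hx).1 j (mem_of_mem_erase hj) hjx
    have e : bin (S.filter (fun x => kk x ≠ k)) kk j = bin S kk j := by
      ext y; simp only [mem_bin, mem_filter]
      constructor
      · rintro ⟨⟨a, b⟩, c⟩; exact ⟨a, c⟩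
      · rintro ⟨a, c⟩; exact ⟨⟨a, c ▸ hjk⟩, c⟩
    rwa [e]
  · intro x hx; exact H.vmin x (mem_filter.1 hx).1
  · intro x hx; exact h1 x (mem_filter.1 hx).1 (mem_filter.1 hx).2
  · have := H.card
    have a := card_pos.2 ⟨p, hp⟩
    rw [card_erase_of_mem hk, card_erase_of_mem hp]
    omega

theorem Core.caseA (H : Core S z v kk g N D) {k : ℕ} (hk : k ∈ N) {p : ℕ} (hp : p ∈ D)
    (h : ∀ x ∈ bin S g p, kk x = k) :
    ∃ S' g' D', Core S' z v kk g' (N.erase k) D' := by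
  refine ⟨_, _, _, H.remove hk hp g ?_ ?_⟩
  · intro x hx hxk
    refine mem_erase.2 ⟨?_, H.gD x hx⟩
    intro e; exact hxk (h x (mem_bin.2 ⟨hx, e⟩))
  · intro q hq
    refine le_trans ?_ (H.opt q (mem_of_mem_erase hq))
    apply Finset.sum_le_sum_of_subset_of_nonneg
    · intro x hx; simp only [mem_bin, mem_filter] at hx ⊢; exact ⟨hx.1.1, hx.2⟩
    · intro x hx _; exact (H.vpos (mem_bin.1 hx).1).le

theorem Core.caseB (H : Core S z v kk g N D) {k : ℕ} (hk : k ∈ N) {p : ℕ} (hp : p ∈ D)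
    {w y : α} (hw : w ∈ bin S g p) (hy : y ∈ bin S kk k) (hyp : g y ≠ p) (hwy : v w ≤ v y)
    (h : ∀ x ∈ bin S g p, x ≠ w → kk x = k) :
    ∃ S' g' D', Core S' z v kk g' (N.erase k) D' := by
  have hyS := (mem_bin.1 hy).1
  have hyk := (mem_bin.1 hy).2
  have hwS := (mem_bin.1 hw).1
  refine ⟨_, _, _, H.remove hk hp (Function.update g w (g y)) ?_ ?_⟩
  · intro x hx hxk
    by_cases hxw : x = w
    · subst hxw; simp [hyp, H.gD y hyS]
    · rw [Function.update_of_ne hxw]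
      refine mem_erase.2 ⟨?_, H.gD x hx⟩
      intro e; exact hxk (h x (mem_bin.2 ⟨hx, e⟩) hxw)
  · intro q hq
    by_cases hqy : q = g y
    · have hsub : bin (S.filter (fun x => kk x ≠ k)) (Function.update g w (g y)) q ⊆
          insert w ((bin S g q).erase y) := by
        intro x hx
        simp only [mem_bin, mem_filter] at hx
        by_cases hxw : x = w
        · simp [hxw]
        · rw [Function.update_of_ne hxw] at hx
          simp only [mem_insert, mem_erase, mem_bin]
          refine Or.inr ⟨?_, hx.1.1, hx.2⟩
          rintro rfl; exact hx.1.2 hyk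
      have hym : y ∈ bin S g q := mem_bin.2 ⟨hyS, hqy.symm⟩
      have hws : w ∉ (bin S g q).erase y := by
        intro hc
        have h1 := (mem_bin.1 (mem_of_mem_erase hc)).2
        have h2 := (mem_bin.1 hw).2
        exact ne_of_mem_erase hq (h1.symm.trans h2)
      have := H.opt q (mem_of_mem_erase hq)
      rw [← Finset.add_sum_erase _ _ hym] at this
      calc _ ≤ ∑ x ∈ insert w ((bin S g q).erase y), v x := by
            apply Finset.sum_le_sum_of_subset_of_nonneg hsub
            intro x hx _
            rcases mem_insert.1 hx with rfl | hx
            · exact (H.vpos hwS).le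
            · exact (H.vpos (mem_bin.1 (mem_of_mem_erase hx)).1).le
        _ = v w + ∑ x ∈ (bin S g q).erase y, v x := sum_insert hws
        _ ≤ 1 := by linarith
    · refine le_trans ?_ (H.opt q (mem_of_mem_erase hq))
      apply Finset.sum_le_sum_of_subset_of_nonneg
      · intro x hx; simp only [mem_bin, mem_filter] at hx ⊢
        by_cases hxw : x = w
        · subst hxw; simp at hx; exact absurd hx.2.symm hqy
        · rw [Function.update_of_ne hxw] at hx
          exact ⟨hx.1.1, hx.2⟩
      · intro x hx _; exact (H.vpos (mem_bin.1 hx).1).le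

theorem Core.two (H : Core S z v kk g N D) {p : ℕ} (hp : p ∈ D) {u w : α}
    (hP : bin S g p = {u, w}) (huw : u ≠ w) (hlt : kk u < kk w) :
    ∃ k ∈ N, ∃ S' g' D', Core S' z v kk g' (N.erase k) D' := by
  have hu : u ∈ bin S g p := by simp [hP]
  have hw : w ∈ bin S g p := by simp [hP]
  have huS := (mem_bin.1 hu).1
  have hwS := (mem_bin.1 hw).1
  have hk := H.kk_mem huS hwS hlt
  have hs := H.opt p hp
  rw [hP, sum_pair huw] at hs
  have : ∃ y ∈ bin S kk (kk u), y ≠ u ∧ v w ≤ v y := by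
    by_contra hc
    push Not at hc
    have hf := H.ff w hwS _ hk hlt
    have : ∑ y ∈ (bin S kk (kk u)).filter (fun y => v w ≤ v y), v y ≤ ∑ y ∈ {u}, v y := by
      apply Finset.sum_le_sum_of_subset_of_nonneg
      · intro y hy
        rw [mem_filter] at hy
        by_contra hne
        exact absurd hy.2 (not_le.2 (hc y hy.1 (by simpa using hne)))
      · intro y hy _; simp at hy; subst hy; exact (H.vpos huS).le
    simp at this
    linarith
  obtain ⟨y, hy, hyu, hyw⟩ := this
  refine ⟨_, hk, H.caseB hk hp hw hy ?_ hyw ?_⟩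
  · intro e
    have : y ∈ bin S g p := mem_bin.2 ⟨(mem_bin.1 hy).1, e⟩
    rw [hP] at this
    simp at this
    rcases this with h | h
    · exact hyu h
    · subst h; exact hlt.ne (mem_bin.1 hy).2.symm
  · intro x hx hxw
    rw [hP] at hx; simp at hx
    rcases hx with h | h
    · rw [h]
    · exact absurd h hxw

theorem Core.step (H : Core S z v kk g N D) {p : ℕ} (hp : p ∈ D) (hc : #(bin S g p) ≤ 2) :
    ∃ k ∈ N, ∃ S' g' D', Core S' z v kk g' (N.erase k) D' := by
  have hN : 0 < #N := by
    have := card_pos.2 ⟨p, hp⟩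
    have := H.card
    omega
  obtain ⟨k, hk⟩ := card_pos.1 hN
  have h3 : #(bin S g p) = 0 ∨ #(bin S g p) = 1 ∨ #(bin S g p) = 2 := by omega
  rcases h3 with h | h | h
  · rw [card_eq_zero] at h
    exact ⟨k, hk, H.caseA hk hp (by simp [h])⟩
  · obtain ⟨u, hu⟩ := card_eq_one.1 h
    have hum : u ∈ bin S g p := by simp [hu]
    by_cases huz : u = z
    · subst huz
      obtain ⟨y, hy, hyu⟩ := H.later hk H.zS (H.zk k hk)
      refine ⟨k, hk, H.caseB hk hp hum hy ?_ hyu ?_⟩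
      · intro e
        have : y ∈ bin S g p := mem_bin.2 ⟨(mem_bin.1 hy).1, e⟩
        rw [hu] at this; simp at this; subst this
        exact (H.zk k hk).ne' (mem_bin.1 hy).2
      · intro x hx hxu; rw [hu] at hx; simp at hx; exact absurd hx hxu
    · refine ⟨kk u, H.kN u (mem_bin.1 hum).1 huz, H.caseA (H.kN u (mem_bin.1 hum).1 huz) hp ?_⟩
      intro x hx; rw [hu] at hx; simp at hx; rw [hx]
  · obtain ⟨u, w, huw, hP⟩ := card_eq_two.1 h
    have hu : u ∈ bin S g p := by simp [hP]
    have hw : w ∈ bin S g p := by simp [hP]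
    rcases lt_trichotomy (kk u) (kk w) with hl | he | hl
    · exact H.two hp hP huw hl
    · have hkN : kk u ∈ N := by
        by_cases huz : u = z
        · rw [he]; exact H.kN w (mem_bin.1 hw).1 (by rintro rfl; exact huw huz)
        · exact H.kN u (mem_bin.1 hu).1 huz
      refine ⟨_, hkN, H.caseA hkN hp ?_⟩
      intro x hx; rw [hP] at hx; simp at hx
      rcases hx with h | h
      · rw [h]
      · rw [h, he]
    · exact H.two hp (by rw [hP, pair_comm]) huw.symm hl

theorem Core.reduce : ∀ (n : ℕ) {S : Finset α} {g : α → ℕ} {N D : Finset ℕ},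
    #N = n → Core S z v kk g N D →
    ∃ S' g' N' D', Core S' z v kk g' N' D' ∧ ∀ p ∈ D', 3 ≤ #(bin S' g' p) := by
  intro n
  induction n with
  | zero =>
    intro S g N D hn H
    exfalso
    have := card_pos.2 ⟨_, H.gD z H.zS⟩
    have := H.card
    omega
  | succ n ih =>
    intro S g N D hn H
    by_cases h : ∀ p ∈ D, 3 ≤ #(bin S g p)
    · exact ⟨S, g, N, D, H, h⟩
    · push Not at h
      obtain ⟨p, hp, hc⟩ := h
      obtain ⟨k, hk, S', g', D', H'⟩ := H.step hp (by omega)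
      exact ih (by rw [card_erase_of_mem hk]; omega) H'

end
end HF


namespace HF
section
variable {S : Finset α} {z : α} {v : α → ℚ} {kk g : α → ℕ} {N D : Finset ℕ}

theorem Core.top (H : Core S z v kk g N D) {j : ℕ} (hj : j ∈ N) :
    ∃ t ∈ bin S kk j, ∀ y ∈ bin S kk j, v y ≤ v t := by
  obtain ⟨y, hy, _⟩ := H.later hj H.zS (H.zk j hj)
  exact Finset.exists_max_image _ v ⟨y, hy⟩

/-- many items of size at least `v x` in an earlier bin -/
theorem Core.U (H : Core S z v kk g N D) {j : ℕ} (hj : j ∈ N) {x : α} (hx : x ∈ S)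
    (h : j < kk x) (T : ℚ) (hT : ∀ y ∈ bin S kk j, v y ≤ T) (m : ℕ) (hm : m * T + v x ≤ 1) :
    m < #((bin S kk j).filter (fun y => v x ≤ v y)) := by
  by_contra hc
  push Not at hc
  have hf := H.ff x hx j hj h
  have h1 : ∑ y ∈ (bin S kk j).filter (fun y => v x ≤ v y), v y ≤
      #((bin S kk j).filter (fun y => v x ≤ v y)) • T :=
    Finset.sum_le_card_nsmul _ _ _ (fun y hy => hT y (mem_filter.1 hy).1)
  rw [nsmul_eq_mul] at h1
  obtain ⟨t, ht, _⟩ := H.top hj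
  have hT0 : 0 ≤ T := (H.vpos (mem_bin.1 ht).1).le.trans (hT t ht)
  have h2 : (#((bin S kk j).filter (fun y => v x ≤ v y)) : ℚ) * T ≤ m * T :=
    mul_le_mul_of_nonneg_right (by exact_mod_cast hc) hT0
  linarith

theorem Core.cardge (H : Core S z v kk g N D) {j : ℕ} (hj : j ∈ N)
    (T : ℚ) (hT : ∀ y ∈ bin S kk j, v y ≤ T) (m : ℕ) (hm : m * T + v z ≤ 1) :
    m < #(bin S kk j) :=
  lt_of_lt_of_le (H.U hj H.zS (H.zk j hj) T hT m hm) (card_le_card (filter_subset _ _))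

/-- top of the bin has size above `θ`, at most `1/r`, but fewer than `r` items exceed `θ` -/
def Bad (S : Finset α) (v : α → ℚ) (kk : α → ℕ) (θ : ℚ) (r : ℕ) (j : ℕ) : Prop :=
  (∀ y ∈ bin S kk j, r * v y ≤ 1) ∧ (∃ t ∈ bin S kk j, θ < v t) ∧
    #((bin S kk j).filter (fun y => θ < v y)) < r

theorem Core.not_bad_lt (H : Core S z v kk g N D) {θ : ℚ} {r : ℕ} {j j' : ℕ} (hj : j ∈ N) (hlt : j < j')
    (h : Bad S v kk θ r j) {x : α} (hx : x ∈ bin S kk j') (hx1 : r * v x ≤ 1) : v x ≤ θ := by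
  by_contra hc
  push Not at hc
  obtain ⟨h1, h2, h3⟩ := h
  have hxS := (mem_bin.1 hx).1
  have hr : 0 < r := by omega
  have hr' : (0:ℚ) < r := by exact_mod_cast hr
  have := H.U hj hxS ((mem_bin.1 hx).2 ▸ hlt) (1 / r) (fun y hy => by
    rw [le_div_iff₀ hr']; linarith [h1 y hy]) (r - 1) (by
      have : ((r - 1 : ℕ) : ℚ) = r - 1 := by push_cast [hr]; ring
      rw [this]
      have h5 : v x ≤ 1 / r := by rw [le_div_iff₀ hr']; linarith
      have h6 : ((r:ℚ) - 1) * (1 / r) = 1 - 1 / r := by field_simp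
      linarith)
  have h4 : #((bin S kk j).filter (fun y => v x ≤ v y)) ≤ #((bin S kk j).filter (fun y => θ < v y)) := by
    apply card_le_card
    intro y hy
    rw [mem_filter] at hy ⊢
    exact ⟨hy.1, lt_of_lt_of_le hc hy.2⟩
  omega

theorem Core.bad_unique (H : Core S z v kk g N D) {θ : ℚ} {r : ℕ} {j j' : ℕ} (hj : j ∈ N) (hj' : j' ∈ N)
    (h : Bad S v kk θ r j) (h' : Bad S v kk θ r j') : j = j' := by
  rcases lt_trichotomy j j' with hl | he | hl
  · obtain ⟨t, ht, ht'⟩ := h'.2.1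
    exact absurd (H.not_bad_lt hj hl h ht (h'.1 t ht)) (not_le.2 ht')
  · exact he
  · obtain ⟨t, ht, ht'⟩ := h.2.1
    exact absurd (H.not_bad_lt hj' hl h' ht (h.1 t ht)) (not_le.2 ht')

/-- indicator penalty -/
noncomputable def pen (Q : ℕ → Prop) (δ : ℚ) (j : ℕ) : ℚ := by
  classical exact if Q j then δ else 0

theorem pen_nonneg {Q : ℕ → Prop} {δ : ℚ} (h : 0 ≤ δ) (j : ℕ) : 0 ≤ pen Q δ j := by
  unfold pen; split_ifs <;> simp [h]

theorem pen_of {Q : ℕ → Prop} {δ : ℚ} {j : ℕ} (h : Q j) : pen Q δ j = δ := by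
  unfold pen; simp [h]

theorem sum_pen (N : Finset ℕ) {Q : ℕ → Prop} {δ : ℚ} (h : 0 ≤ δ)
    (hu : ∀ j ∈ N, ∀ j' ∈ N, Q j → Q j' → j = j') : ∑ j ∈ N, pen Q δ j ≤ δ := by
  by_cases hex : ∃ j ∈ N, Q j
  · obtain ⟨j, hj, hQ⟩ := hex
    rw [Finset.sum_eq_single j]
    · rw [pen_of hQ]
    · intro b hb hne
      unfold pen
      rw [if_neg]
      intro hQb; exact hne (hu b hb j hj hQb hQ)
    · intro hc; exact absurd hj hc
  · push Not at hex
    rw [Finset.sum_eq_zero]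
    · exact h
    · intro j hj; unfold pen; rw [if_neg (hex j hj)]

theorem Core.sum_pen_bad (H : Core S z v kk g N D) (θ : ℚ) (r : ℕ) {δ : ℚ} (h : 0 ≤ δ) :
    ∑ j ∈ N, pen (Bad S v kk θ r) δ j ≤ δ :=
  sum_pen N h (fun _ hj _ hj' h h' => H.bad_unique hj hj' h h')

/-- weights: lower bound from counts -/
theorem wc {X : Finset α} {w v : α → ℚ} {θ a b : ℚ} {r k : ℕ}
    (hb : ∀ y ∈ X, b ≤ w y) (ha : ∀ y ∈ X, θ < v y → a ≤ w y)
    (hab : b ≤ a) (hb0 : 0 ≤ b) (hr : r ≤ #(X.filter (fun y => θ < v y))) (hk : k ≤ #X) (hrk : r ≤ k) :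
    r * a + (k - r) * b ≤ ∑ y ∈ X, w y := by
  have h1 : ∑ y ∈ X, w y = ∑ y ∈ X, (w y - b) + #X * b := by
    rw [Finset.sum_sub_distrib]; simp
  have h2 : ∑ y ∈ X.filter (fun y => θ < v y), (w y - b) ≤ ∑ y ∈ X, (w y - b) := by
    apply Finset.sum_le_sum_of_subset_of_nonneg (filter_subset _ _)
    intro y hy _; linarith [hb y hy]
  have h3 : #(X.filter (fun y => θ < v y)) • (a - b) ≤ ∑ y ∈ X.filter (fun y => θ < v y), (w y - b) := by
    apply Finset.card_nsmul_le_sum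
    intro y hy
    rw [mem_filter] at hy
    linarith [ha y hy.1 hy.2]
  rw [nsmul_eq_mul] at h3
  have h4 : (r:ℚ) * (a - b) ≤ #(X.filter (fun y => θ < v y)) * (a - b) :=
    mul_le_mul_of_nonneg_right (by exact_mod_cast hr) (by linarith)
  have h5 : (k:ℚ) * b ≤ #X * b := mul_le_mul_of_nonneg_right (by exact_mod_cast hk) hb0
  linarith

/-- bins whose top item lies in a class: either `r` large items or bad -/
theorem Core.cls (H : Core S z v kk g N D) {j : ℕ} (hj : j ∈ N) {t : α} (ht : t ∈ bin S kk j)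
    (htop : ∀ y ∈ bin S kk j, v y ≤ v t) (w : α → ℚ) (θ a b : ℚ) (r m : ℕ)
    (h1 : θ < v t) (h2 : r * v t ≤ 1) (h3 : m * v t + v z ≤ 1) (hb : ∀ y ∈ S, b ≤ w y)
    (ha : ∀ y ∈ S, θ < v y → a ≤ w y) (hab : b ≤ a) (hb0 : 0 ≤ b) (hrm : r ≤ m + 1) :
    r * a + (m + 1 - r) * b ≤ ∑ y ∈ bin S kk j, w y ∨
      (Bad S v kk θ r j ∧ a + m * b ≤ ∑ y ∈ bin S kk j, w y) := by
  have hb' : ∀ y ∈ bin S kk j, b ≤ w y := fun y hy => hb y (mem_bin.1 hy).1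
  have ha' : ∀ y ∈ bin S kk j, θ < v y → a ≤ w y := fun y hy => ha y (mem_bin.1 hy).1
  have hc := H.cardge hj (v t) htop m h3
  by_cases hr : r ≤ #((bin S kk j).filter (fun y => θ < v y))
  · left
    have := wc hb' ha' hab hb0 hr (show m + 1 ≤ _ from hc) hrm
    push_cast at this
    linarith
  · right
    refine ⟨⟨?_, ⟨t, ht, h1⟩, by omega⟩, ?_⟩
    · intro y hy
      have := mul_le_mul_of_nonneg_left (htop y hy) (Nat.cast_nonneg (α := ℚ) r)
      linarith
    · have h0 : 1 ≤ #((bin S kk j).filter (fun y => θ < v y)) :=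
        card_pos.2 ⟨t, mem_filter.2 ⟨ht, h1⟩⟩
      have := wc hb' ha' hab hb0 h0 (show m + 1 ≤ _ from hc) (by omega)
      push_cast at this
      linarith

theorem two_of {X : Finset α} (h : #X = 2) {t : α} (ht : t ∈ X) : ∃ y ∈ X, y ≠ t ∧ X = {t, y} := by
  obtain ⟨a, b, hab, rfl⟩ := card_eq_two.1 h
  simp at ht
  rcases ht with rfl | rfl
  · exact ⟨b, by simp, hab.symm, rfl⟩
  · exact ⟨a, by simp, hab, pair_comm _ _⟩

theorem three_of {X : Finset α} (v : α → ℚ) (h : #X = 3) {t : α} (ht : t ∈ X) :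
    ∃ x ∈ X, ∃ y ∈ X, x ≠ t ∧ y ≠ t ∧ x ≠ y ∧ v y ≤ v x ∧ X = {t, x, y} := by
  have h2 : #(X.erase t) = 2 := by rw [card_erase_of_mem ht, h]
  obtain ⟨a, b, hab, hX⟩ := card_eq_two.1 h2
  have hXe : X = {t, a, b} := by rw [← insert_erase ht, hX]
  have ha : a ∈ X.erase t := by simp [hX]
  have hb : b ∈ X.erase t := by simp [hX]
  rw [mem_erase] at ha hb
  rcases le_total (v b) (v a) with hl | hl
  · exact ⟨a, ha.2, b, hb.2, ha.1, hb.1, hab, hl, hXe⟩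
  · refine ⟨b, hb.2, a, ha.2, hb.1, ha.1, hab.symm, hl, ?_⟩
    rw [hXe, pair_comm a b]

theorem sum_two {t y : α} (h : y ≠ t) (f : α → ℚ) : ∑ x ∈ ({t, y} : Finset α), f x = f t + f y :=
  sum_pair h.symm

theorem sum_three {t x y : α} (h1 : x ≠ t) (h2 : y ≠ t) (h3 : x ≠ y) (f : α → ℚ) :
    ∑ u ∈ ({t, x, y} : Finset α), f u = f t + f x + f y := by
  rw [sum_insert (by simp [h1.symm, h2.symm]), sum_pair h3]; ring

/-- the three-case split for bins with at least two items -/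
theorem Core.count (H : Core S z v kk g N D) (w : α → ℚ) (K EE O : ℚ) (e o : ℕ → ℚ)
    (h1 : ∀ j ∈ N, 36 - e j ≤ ∑ y ∈ bin S kk j, w y) (h2 : ∑ j ∈ N, e j ≤ EE)
    (h3 : ∀ p ∈ D, ∑ y ∈ bin S g p, w y ≤ K + o p) (h4 : ∑ p ∈ D, o p ≤ O) :
    36 * (#N : ℚ) - EE + w z ≤ K * #D + O := by
  have ha : ∑ x ∈ S, w x = ∑ p ∈ D, ∑ y ∈ bin S g p, w y :=
    (Finset.sum_fiberwise_of_maps_to H.gD w).symm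
  have hb : ∑ x ∈ S, w x = w z + ∑ j ∈ N, ∑ y ∈ bin S kk j, w y := by
    rw [← Finset.add_sum_erase _ _ H.zS]
    congr 1
    rw [← Finset.sum_fiberwise_of_maps_to (s := S.erase z) (t := N) (g := kk) (f := w)
      (fun x hx => H.kN x (mem_of_mem_erase hx) (ne_of_mem_erase hx))]
    apply Finset.sum_congr rfl
    intro j hj
    apply Finset.sum_congr _ (fun _ _ => rfl)
    ext y
    simp only [mem_filter, mem_erase, mem_bin]
    constructor
    · rintro ⟨⟨_, a⟩, b⟩; exact ⟨a, b⟩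
    · rintro ⟨a, b⟩
      refine ⟨⟨?_, a⟩, b⟩
      rintro rfl
      exact (H.zk j hj).ne' b
  have hc : ∑ j ∈ N, (36 - e j) ≤ ∑ j ∈ N, ∑ y ∈ bin S kk j, w y := Finset.sum_le_sum h1
  have hd : ∑ p ∈ D, ∑ y ∈ bin S g p, w y ≤ ∑ p ∈ D, (K + o p) := Finset.sum_le_sum h3
  rw [Finset.sum_sub_distrib] at hc
  rw [Finset.sum_add_distrib] at hd
  simp only [Finset.sum_const, nsmul_eq_mul] at hc hd
  linarith

theorem Core.Dpos (H : Core S z v kk g N D) : 0 < #D := card_pos.2 ⟨_, H.gD z H.zS⟩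

/-- conclusion when optimal bins have weight at most 44 -/
theorem Core.count44 (H : Core S z v kk g N D) (w : α → ℚ) (EE O : ℚ) (e o : ℕ → ℚ)
    (h1 : ∀ j ∈ N, 36 - e j ≤ ∑ y ∈ bin S kk j, w y) (h2 : ∑ j ∈ N, e j ≤ EE)
    (h3 : ∀ p ∈ D, ∑ y ∈ bin S g p, w y ≤ 44 + o p) (h4 : ∑ p ∈ D, o p ≤ O) (h5 : EE + O < w z) : False := by
  have := H.count w 44 EE O e o h1 h2 h3 h4
  have hc : (11 * #D : ℚ) ≤ 9 * #N := by exact_mod_cast H.card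
  linarith

theorem Core.count44' (H : Core S z v kk g N D) (w : α → ℚ) (EE : ℚ) (e : ℕ → ℚ)
    (h1 : ∀ j ∈ N, 36 - e j ≤ ∑ y ∈ bin S kk j, w y) (h2 : ∑ j ∈ N, e j ≤ EE)
    (h3 : ∀ p ∈ D, ∑ y ∈ bin S g p, w y ≤ 44) (h5 : EE < w z) : False :=
  H.count44 w EE 0 e (fun _ => 0) h1 h2 (by simpa using h3) (by simp) (by linarith)

end

/-- exhaustive check of count vectors -/
def chk (ok : (ℕ → ℕ) → Bool) (A : ℕ → ℕ) : ℕ → ℕ → List ℕ → Bool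
  | 0, _, acc => ok (fun i => acc.getD i 0)
  | k + 1, cap, acc => (List.range 6).all fun n =>
      if n * A k ≤ cap then chk ok A k (cap - n * A k) (n :: acc) else true

theorem chk_sound (ok : (ℕ → ℕ) → Bool) (A n : ℕ → ℕ) : ∀ (k cap : ℕ) (acc : List ℕ),
    chk ok A k cap acc = true → (∀ i < k, n i ≤ 5) → ∑ i ∈ range k, n i * A i ≤ cap →
    ok (fun i => ((List.range k).map n ++ acc).getD i 0) = true
  | 0, cap, acc => by intro h _ _; simpa [chk] using h
  | k + 1, cap, acc => by
    intro h h1 h2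
    rw [Finset.sum_range_succ] at h2
    rw [chk, List.all_eq_true] at h
    have h3 := h (n k) (by simp; have := h1 k (by omega); omega)
    rw [if_pos (by omega)] at h3
    have := chk_sound ok A n k _ _ h3 (fun i hi => h1 i (by omega)) (by omega)
    rw [List.range_succ, List.map_append]
    simpa using this

theorem sum_class (P : Finset α) (c : α → ℕ) (k : ℕ) (hc : ∀ x ∈ P, c x < k) (W : ℕ → ℚ) :
    ∑ x ∈ P, W (c x) = ∑ i ∈ range k, (#(P.filter (fun x => c x = i)) : ℚ) * W i := by
  rw [← Finset.sum_fiberwise_of_maps_to (t := range k) (g := c) (fun x hx => mem_range.2 (hc x hx))]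
  apply Finset.sum_congr rfl
  intro i _
  rw [Finset.sum_congr rfl (g := fun _ => W i) (by intro x hx; rw [(mem_filter.1 hx).2])]
  simp

/-- number of items of class `i` -/
def cnt (P : Finset α) (c : α → ℕ) (i : ℕ) : ℕ := #(P.filter (fun x => c x = i))

/-- dot product -/
def dotn (W n : ℕ → ℕ) : ℕ → ℕ
  | 0 => 0
  | k + 1 => dotn W n k + n k * W k

theorem dotn_eq (W n : ℕ → ℕ) (k : ℕ) : dotn W n k = ∑ i ∈ range k, n i * W i := by
  induction k with
  | zero => rfl
  | succ k ih => rw [dotn, ih, Finset.sum_range_succ]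

theorem card_eq_dotn (P : Finset α) (c : α → ℕ) (k : ℕ) (hc : ∀ x ∈ P, c x < k) :
    #P = dotn (fun _ => 1) (cnt P c) k := by
  rw [dotn_eq]
  have := sum_class P c k hc (fun _ => 1)
  simp at this
  simp only [cnt, mul_one]
  exact_mod_cast this

theorem cnt_zero {P : Finset α} {c : α → ℕ} {i : ℕ} (h : ∀ x ∈ P, c x ≠ i) : cnt P c i = 0 := by
  rw [cnt, card_eq_zero, filter_eq_empty_iff]
  exact fun x hx => h x hx

theorem cnt_pos {P : Finset α} {c : α → ℕ} {i : ℕ} (h : 0 < cnt P c i) : ∃ x ∈ P, c x = i := by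
  obtain ⟨x, hx⟩ := card_pos.1 h
  exact ⟨x, (mem_filter.1 hx).1, (mem_filter.1 hx).2⟩

theorem optW (P : Finset α) (v : α → ℚ) (c : α → ℕ) (k : ℕ) (A B : ℕ → ℕ) (KA KB : ℕ)
    (lo hi s : ℚ) (W : ℕ → ℕ) (Kn : ℕ) (ex : (ℕ → ℕ) → Bool)
    (hA : chk (fun n => !(ex n) || decide (dotn W n k ≤ Kn)) A k KA [] = true)
    (hB : chk (fun n => !(ex n) || decide (dotn W n k ≤ Kn)) B k KB [] = true)
    (hc : ∀ x ∈ P, c x < k) (hP : ∑ x ∈ P, v x ≤ 1) (hcard : #P ≤ 5) (hlo : lo < s) (hhi : s ≤ hi)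
    (hlb : ∀ x ∈ P, (hi - s) * (A (c x) / (KA + 1)) + (s - lo) * (B (c x) / (KB + 1)) ≤ (hi - lo) * v x)
    (hst : ∀ x ∈ P, c x ≠ 0 →
      (hi - s) * (A (c x) / (KA + 1)) + (s - lo) * (B (c x) / (KB + 1)) < (hi - lo) * v x)
    (h0 : #P * W 0 ≤ Kn) (hex : ex (cnt P c) = true) :
    ∑ x ∈ P, (W (c x) : ℚ) ≤ Kn := by
  by_cases hall : ∀ x ∈ P, c x = 0
  · rw [Finset.sum_congr rfl (g := fun _ => (W 0 : ℚ)) (fun x hx => by rw [hall x hx])]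
    simp only [sum_const, nsmul_eq_mul]
    exact_mod_cast h0
  push Not at hall
  obtain ⟨x0, hx0, hx0'⟩ := hall
  have h1 := Finset.sum_lt_sum hlb ⟨x0, hx0, hst x0 hx0 hx0'⟩
  rw [← Finset.mul_sum, sum_add_distrib, ← Finset.mul_sum, ← Finset.mul_sum] at h1
  have h2 : (hi - lo) * ∑ x ∈ P, v x ≤ hi - lo := by nlinarith
  have hn : ∀ i < k, cnt P c i ≤ 5 := fun i _ => (card_le_card (filter_subset _ _)).trans hcard
  have conv : ∀ (A : ℕ → ℕ) (KA : ℕ), ∑ x ∈ P, (A (c x) : ℚ) / (KA + 1) < 1 →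
      ∑ i ∈ range k, cnt P c i * A i ≤ KA := by
    intro A KA h
    have e := sum_class P c k hc (fun i => (A i : ℚ))
    rw [← Finset.sum_div, div_lt_one (by positivity), e] at h
    have : ∑ i ∈ range k, cnt P c i * A i < KA + 1 := by unfold cnt; exact_mod_cast h
    omega
  have fin : ∀ (A : ℕ → ℕ) (KA : ℕ), ∑ x ∈ P, (A (c x) : ℚ) / (KA + 1) < 1 →
      chk (fun n => !(ex n) || decide (dotn W n k ≤ Kn)) A k KA [] = true →
      ∑ x ∈ P, (W (c x) : ℚ) ≤ Kn := by
    intro A KA h hA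
    have h5 := chk_sound _ A (cnt P c) k KA [] hA hn (conv A KA h)
    have h6 : (fun i => ((List.range k).map (cnt P c) ++ []).getD i 0) = cnt P c := by
      funext i
      by_cases hi : i < k
      · simp [hi]
      · have : cnt P c i = 0 := cnt_zero (fun x hx he => hi (he ▸ hc x hx))
        simp [this, hi]
    rw [h6, hex] at h5
    simp at h5
    rw [dotn_eq] at h5
    have e := sum_class P c k hc (fun i => (W i : ℚ))
    rw [e]
    unfold cnt at h5
    exact_mod_cast h5
  by_cases hlt : ∑ x ∈ P, (A (c x) : ℚ) / (KA + 1) < 1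
  · exact fin A KA hlt hA
  · have hlt2 : ∑ x ∈ P, (B (c x) : ℚ) / (KB + 1) < 1 := by
      by_contra h
      push Not at h hlt
      have a1 := mul_le_mul_of_nonneg_left hlt (show 0 ≤ hi - s by linarith)
      have a2 := mul_le_mul_of_nonneg_left h (show 0 ≤ s - lo by linarith)
      linarith
    exact fin B KB hlt2 hB

end HF


namespace HF
section
variable {S : Finset α} {z : α} {v : α → ℚ} {kk g : α → ℕ} {N D : Finset ℕ}

theorem Core.item_le (H : Core S z v kk g N D) (H3 : ∀ p ∈ D, 3 ≤ #(bin S g p)) {x : α} (hx : x ∈ S) :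
    v x ≤ 1 - 2 * v z := by
  have h1 := H.opt _ (H.gD x hx)
  have hm : x ∈ bin S g (g x) := mem_bin.2 ⟨hx, rfl⟩
  have h2 := H3 _ (H.gD x hx)
  rw [← Finset.add_sum_erase _ _ hm] at h1
  have h3 : #((bin S g (g x)).erase x) • v z ≤ ∑ y ∈ (bin S g (g x)).erase x, v y := by
    apply Finset.card_nsmul_le_sum
    intro y hy; exact H.vmin y (mem_bin.1 (mem_of_mem_erase hy)).1
  rw [card_erase_of_mem hm, nsmul_eq_mul] at h3
  have h4 : (2:ℚ) ≤ ((#(bin S g (g x)) - 1 : ℕ) : ℚ) := by exact_mod_cast (by omega)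
  nlinarith [H.pos]

theorem Core.s_le (H : Core S z v kk g N D) (H3 : ∀ p ∈ D, 3 ≤ #(bin S g p)) : v z ≤ 1 / 3 := by
  have := H.item_le H3 H.zS
  linarith

theorem Core.cardP (H : Core S z v kk g N D) {p : ℕ} (hp : p ∈ D) (m : ℕ) (hm : 1 < (m + 1) * v z) :
    #(bin S g p) ≤ m := by
  by_contra hc
  push Not at hc
  have h1 := H.opt p hp
  have h3 : #(bin S g p) • v z ≤ ∑ y ∈ bin S g p, v y := by
    apply Finset.card_nsmul_le_sum
    intro y hy; exact H.vmin y (mem_bin.1 hy).1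
  rw [nsmul_eq_mul] at h3
  have : ((m:ℚ) + 1) ≤ #(bin S g p) := by exact_mod_cast hc
  nlinarith [H.pos]

theorem Core.case1 (H : Core S z v kk g N D) (hs : v z ≤ 2 / 11) : False := by
  refine H.count44' (fun x => 44 * v x) 0 (fun _ => 0) ?_ (by simp) ?_ (by linarith [H.pos])
  · intro j hj
    have := H.full hj
    rw [← Finset.mul_sum]; linarith
  · intro p hp
    have := H.opt p hp
    rw [← Finset.mul_sum]; linarith

theorem Core.case2 (H : Core S z v kk g N D) (H3 : ∀ p ∈ D, 3 ≤ #(bin S g p)) (hs : 1 / 4 < v z) : False := by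
  have hs3 := H.s_le H3
  obtain ⟨c, hc⟩ : ∃ c : α → ℕ, ∀ x, c x = if (1 - v z) / 2 < v x then 1 else 0 := ⟨_, fun _ => rfl⟩
  obtain ⟨W, hW⟩ : ∃ W : ℕ → ℕ, W = fun i => [12, 18].getD i 0 := ⟨_, rfl⟩
  have wb : ∀ y ∈ S, (12:ℚ) ≤ W (c y) := by
    intro y _; rw [hc, hW]; split_ifs <;> norm_num
  have wX : ∀ y ∈ S, (1 - v z) / 2 < v y → (18:ℚ) ≤ W (c y) := by
    intro y _ h; rw [hc, hW, if_pos h]; norm_num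
  refine H.count44' (fun x => (W (c x) : ℚ)) 6 (pen (Bad S v kk ((1 - v z) / 2) 2) 6) ?_
    (H.sum_pen_bad _ _ (by norm_num)) ?_ ?_
  · intro j hj
    obtain ⟨t, ht, htop⟩ := H.top hj
    have hp := pen_nonneg (Q := Bad S v kk ((1 - v z) / 2) 2) (δ := 6) (by norm_num) j
    have htS := (mem_bin.1 ht).1
    have hti := H.item_le H3 htS
    by_cases h1 : (1 - v z) / 2 < v t
    · rcases H.cls hj ht htop (fun x => (W (c x) : ℚ)) ((1 - v z) / 2) 18 12 2 1 h1 (by push_cast; linarith)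
        (by push_cast; linarith) wb wX (by norm_num) (by norm_num) (by norm_num) with h | ⟨hb, h⟩
      · push_cast at h; linarith
      · rw [pen_of hb]; push_cast at h; linarith
    · rcases H.cls hj ht htop (fun x => (W (c x) : ℚ)) 0 12 12 1 2 (H.vpos htS) (by push_cast; linarith)
        (by push_cast; linarith) wb (fun y hy _ => wb y hy) (by norm_num) (by norm_num) (by norm_num) with h | ⟨hb, h⟩
      · push_cast at h; linarith
      · push_cast at h; linarith
  · intro p hp
    have hcard := H.cardP hp 3 (by push_cast; linarith)
    have hk : ∀ x ∈ bin S g p, c x < 2 := by intro x hx; rw [hc]; split_ifs <;> norm_num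
    have hcd := card_eq_dotn _ c 2 hk
    have := optW (bin S g p) v c 2 (fun i => [2, 3].getD i 0) (fun i => [1, 1].getD i 0) 7 2 (1/4) (1/3) (v z)
      W 44 (fun n => decide (n 0 + n 1 ≤ 3)) (by rw [hW]; decide +kernel) (by rw [hW]; decide +kernel)
      hk (H.opt p hp) (by omega) hs hs3
      (by intro x hx; rw [hc]; have := H.vmin x (mem_bin.1 hx).1
          split_ifs <;> norm_num <;> linarith)
      (by intro x hx; rw [hc]
          split_ifs <;> norm_num <;> linarith) (by rw [hW]; simp; omega) (by simp [dotn] at hcd ⊢; omega)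
    exact_mod_cast this
  · have := wb z H.zS
    linarith
end
end HF


namespace HF
section
variable {S : Finset α} {z : α} {v : α → ℚ} {kk g : α → ℕ} {N D : Finset ℕ}

/-- bin `j` consists of exactly two items `x`, `y`, with `y` the smaller -/
def Two (S : Finset α) (v : α → ℚ) (kk : α → ℕ) (j : ℕ) (x y : α) : Prop :=
  bin S kk j = {x, y} ∧ y ≠ x ∧ v y ≤ v x

theorem Two.card {j : ℕ} {x y : α} (h : Two S v kk j x y) : #(bin S kk j) = 2 := by
  rw [h.1, card_pair h.2.1.symm]

theorem Two.sum {j : ℕ} {x y : α} (h : Two S v kk j x y) (f : α → ℚ) :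
    ∑ u ∈ bin S kk j, f u = f x + f y := by
  rw [h.1, sum_two h.2.1]

theorem Two.memx {j : ℕ} {x y : α} (h : Two S v kk j x y) : x ∈ bin S kk j := by rw [h.1]; simp
theorem Two.memy {j : ℕ} {x y : α} (h : Two S v kk j x y) : y ∈ bin S kk j := by rw [h.1]; simp

theorem Core.split2 (H : Core S z v kk g N D) {j : ℕ} (hj : j ∈ N) {t : α} (ht : t ∈ bin S kk j)
    (htop : ∀ y ∈ bin S kk j, v y ≤ v t) (h1 : v t + v z ≤ 1) :
    (∃ y, Two S v kk j t y ∧ y ∈ S ∧ 1 < v z + v t + v y) ∨ 3 ≤ #(bin S kk j) := by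
  have := H.cardge hj (v t) htop 1 (by push_cast; linarith)
  by_cases h2 : #(bin S kk j) = 2
  · left
    obtain ⟨y, hy, hyt, hX⟩ := two_of h2 ht
    have hT : Two S v kk j t y := ⟨hX, hyt, htop y hy⟩
    refine ⟨y, hT, (mem_bin.1 hy).1, ?_⟩
    have := H.full hj
    rw [hT.sum] at this
    linarith
  · right; omega

theorem of_not_bad {j : ℕ} {t : α} (ht : t ∈ bin S kk j)
    (htop : ∀ y ∈ bin S kk j, v y ≤ v t) {θ : ℚ} {r : ℕ} (h1 : θ < v t) (h2 : r * v t ≤ 1)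
    (hb : ¬ Bad S v kk θ r j) : r ≤ #((bin S kk j).filter (fun y => θ < v y)) := by
  by_contra hc
  apply hb
  refine ⟨?_, ⟨t, ht, h1⟩, by omega⟩
  intro y hy
  have := mul_le_mul_of_nonneg_left (htop y hy) (Nat.cast_nonneg (α := ℚ) r)
  linarith

/-- weights: lower bound with the top item counted separately -/
theorem wct {X : Finset α} {w v : α → ℚ} {θ a b : ℚ} {r k : ℕ} {t : α} (ht : t ∈ X)
    (hb : ∀ y ∈ X, b ≤ w y) (ha : ∀ y ∈ X, θ < v y → a ≤ w y)
    (hab : b ≤ a) (hb0 : 0 ≤ b) (hr : r + 1 ≤ #(X.filter (fun y => θ < v y))) (hk : k + 1 ≤ #X) (hrk : r ≤ k) :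
    w t + r * a + (k - r) * b ≤ ∑ y ∈ X, w y := by
  rw [← Finset.add_sum_erase _ _ ht]
  have h1 : r ≤ #((X.erase t).filter (fun y => θ < v y)) := by
    rw [Finset.filter_erase]
    have := Finset.pred_card_le_card_erase (s := X.filter (fun y => θ < v y)) (a := t)
    omega
  have h2 : k ≤ #(X.erase t) := by rw [card_erase_of_mem ht]; omega
  have := wc (X := X.erase t) (w := w) (v := v) (θ := θ) (a := a) (b := b)
    (fun y hy => hb y (mem_of_mem_erase hy)) (fun y hy => ha y (mem_of_mem_erase hy)) hab hb0 h1 h2 hrk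
  linarith

/-- all bin items weigh at least `b` -/
theorem wcb {X : Finset α} {w : α → ℚ} {b : ℚ} {k : ℕ} {t : α} (ht : t ∈ X)
    (hb : ∀ y ∈ X, b ≤ w y) (hb0 : 0 ≤ b) (hk : k + 1 ≤ #X) :
    w t + k * b ≤ ∑ y ∈ X, w y := by
  rw [← Finset.add_sum_erase _ _ ht]
  have h1 : #(X.erase t) • b ≤ ∑ y ∈ X.erase t, w y := by
    apply Finset.card_nsmul_le_sum
    intro y hy; exact hb y (mem_of_mem_erase hy)
  rw [nsmul_eq_mul] at h1
  have h2 : k ≤ #(X.erase t) := by rw [card_erase_of_mem ht]; omega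
  have h3 : (k:ℚ) * b ≤ #(X.erase t) * b := mul_le_mul_of_nonneg_right (by exact_mod_cast h2) hb0
  linarith

/-- number of items at least `v u`, for `u` in a later bin -/
theorem Core.U' (H : Core S z v kk g N D) {j j' : ℕ} (hj : j ∈ N) {u : α} (hu : u ∈ bin S kk j')
    (h : j < j') {T : ℚ} (hT : ∀ y ∈ bin S kk j, v y ≤ T) (m : ℕ) (hm : m * T + v u ≤ 1) {θ : ℚ} (hθ : θ < v u) :
    m + 1 ≤ #((bin S kk j).filter (fun y => θ < v y)) := by
  have := H.U hj (mem_bin.1 hu).1 ((mem_bin.1 hu).2 ▸ h) T hT m hm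
  refine le_trans this (card_le_card ?_)
  intro y hy
  rw [mem_filter] at hy ⊢
  exact ⟨hy.1, lt_of_lt_of_le hθ hy.2⟩

/-- order of bins from tops -/
theorem Core.lt_of_top (H : Core S z v kk g N D) {j j' : ℕ} (hj' : j' ∈ N) {t : α} (ht : t ∈ bin S kk j)
    (h : ∀ y ∈ bin S kk j', v y < v t) : j < j' := by
  rcases lt_trichotomy j j' with hl | he | hl
  · exact hl
  · subst he; exact absurd (h t ht) (lt_irrefl _)
  · obtain ⟨y, hy, hty⟩ := H.later hj' (mem_bin.1 ht).1 ((mem_bin.1 ht).2 ▸ hl)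
    exact absurd (h y hy) (not_lt.2 hty)

theorem Core.caseA0 (H : Core S z v kk g N D) (H3 : ∀ p ∈ D, 3 ≤ #(bin S g p))
    (hs1 : 1 / 5 < v z) (hs2 : v z ≤ 1 / 4)
    (hI : ∀ j ∈ N, ∀ x y, Two S v kk j x y → 1 / 3 < v y) : False := by
  obtain ⟨c, hc⟩ : ∃ c : α → ℕ, ∀ x, c x =
      if 1 / 2 < v x then (if #(bin S kk (kk x)) = 2 then 5 else 4)
      else if (1 - v z) / 2 < v x then 3 else if 1 / 3 < v x then 2 else if (1 - v z) / 3 < v x then 1 else 0 :=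
    ⟨_, fun _ => rfl⟩
  obtain ⟨W, hW⟩ : ∃ W : ℕ → ℕ, W = fun i => [18, 24, 27, 36, 36, 45].getD i 0 := ⟨_, rfl⟩
  obtain ⟨w, hw⟩ : ∃ w : α → ℚ, ∀ x, w x = (W (c x) : ℚ) / 2 := ⟨_, fun _ => rfl⟩
  have wb : ∀ y ∈ S, 9 ≤ w y := by
    intro y _; rw [hw, hc, hW]; split_ifs <;> norm_num
  have wM : ∀ y ∈ S, (1 - v z) / 3 < v y → 12 ≤ w y := by
    intro y _ h; rw [hw, hc, hW]; split_ifs <;> norm_num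
  have wL : ∀ y ∈ S, 1 / 3 < v y → 27 / 2 ≤ w y := by
    intro y _ h; rw [hw, hc, hW]; split_ifs <;> norm_num
  have wB : ∀ y ∈ S, (1 - v z) / 2 < v y → 18 ≤ w y := by
    intro y _ h; rw [hw, hc, hW]; split_ifs <;> norm_num <;> linarith
  have wG : ∀ j x y, Two S v kk j x y → 1 / 2 < v x → 45 / 2 ≤ w x := by
    intro j x y h h2
    rw [hw, hc, hW, if_pos h2, (mem_bin.1 h.memx).2, if_pos h.card]; norm_num
  have hb' : ∀ {j}, ∀ y ∈ bin S kk j, 9 ≤ w y := fun y hy => wb y (mem_bin.1 hy).1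
  obtain ⟨dL, dM, hd0, hd0', hdE, hdM, hdL⟩ : ∃ dL dM : ℚ, 0 ≤ dL ∧ 0 ≤ dM ∧ dL + dM ≤ 15 / 2 ∧
      (∀ j ∈ N, Bad S v kk ((1 - v z) / 3) 3 j → 6 ≤ dM) ∧
      (9 / 2 ≤ dL ∨ (3 / 2 ≤ dL ∧ ∃ j ∈ N, Bad S v kk ((1 - v z) / 3) 3 j)) := by
    by_cases h : ∃ j ∈ N, Bad S v kk ((1 - v z) / 3) 3 j
    · exact ⟨3/2, 6, by norm_num, by norm_num, by norm_num, fun _ _ _ => le_rfl, Or.inr ⟨le_rfl, h⟩⟩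
    · exact ⟨9/2, 0, by norm_num, by norm_num, by norm_num, fun j hj hb => absurd ⟨j, hj, hb⟩ h, Or.inl le_rfl⟩
  have key := H.count w (87 / 2) 12 0 (fun j => pen (Bad S v kk ((1 - v z) / 2) 2) (9/2) j +
    pen (Bad S v kk (1 / 3) 2) dL j + pen (Bad S v kk ((1 - v z) / 3) 3) dM j) (fun _ => 0) ?_ ?_ ?_ (by simp)
  · have hz := wb z H.zS
    have hcard := H.card
    have hD := H.Dpos
    have h1 : (72 * #N + (#D:ℚ)) ≤ 6 + 88 * #D := by linarith
    have h2 : 72 * #N + #D ≤ 6 + 88 * #D := by exact_mod_cast h1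
    obtain ⟨k, hk⟩ := Nat.exists_eq_add_of_le hcard
    have hk0 : k = 0 := by omega
    subst hk0
    omega
  · intro j hj
    obtain ⟨t, ht, htop⟩ := H.top hj
    have htS := (mem_bin.1 ht).1
    have hti := H.item_le H3 htS
    have p1 := pen_nonneg (Q := Bad S v kk ((1 - v z) / 2) 2) (δ := 9/2) (by norm_num) j
    have p2 := pen_nonneg (Q := Bad S v kk (1 / 3) 2) hd0 j
    have p3 := pen_nonneg (Q := Bad S v kk ((1 - v z) / 3) 3) hd0' j
    by_cases hG : 1 / 2 < v t
    · rcases H.split2 hj ht htop (by linarith) with ⟨y, hT, hyS, _⟩ | h3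
      · rw [hT.sum]
        linarith [wG _ _ _ hT hG, wL y hyS (hI j hj _ _ hT)]
      · have := wcb (k := 2) ht hb' (by norm_num) h3
        have := wB t htS (by linarith)
        push_cast at *; linarith
    by_cases hB : (1 - v z) / 2 < v t
    · by_cases hbad : Bad S v kk ((1 - v z) / 2) 2 j
      · rw [pen_of hbad]
        rcases H.split2 hj ht htop (by linarith) with ⟨y, hT, hyS, _⟩ | h3
        · rw [hT.sum]
          linarith [wB t htS hB, wL y hyS (hI j hj _ _ hT)]
        · have := wcb (k := 2) ht hb' (by norm_num) h3
          have := wB t htS (by linarith)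
          push_cast at *; linarith
      · have h2 := of_not_bad ht htop hB (by push_cast; linarith) hbad
        have := wc (k := 2) hb' (fun y hy => wB y (mem_bin.1 hy).1) (by norm_num) (by norm_num) h2 (h2.trans (card_le_card (filter_subset _ _))) le_rfl
        push_cast at this; linarith
    by_cases hL : 1 / 3 < v t
    · rcases H.cls hj ht htop w (1/3) (27/2) 9 2 2 hL (by push_cast; linarith) (by push_cast; linarith)
        wb wL (by norm_num) (by norm_num) (by norm_num) with h | ⟨hbad, h⟩
      · push_cast at h; linarith
      · rw [pen_of hbad]
        rcases hdL with h4 | ⟨h4, j0, hj0, hb0⟩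
        · push_cast at h; linarith
        · obtain ⟨hb1, ⟨u, hu, hu2⟩, hb3⟩ := hb0
          have hlt : j < j0 := H.lt_of_top hj0 ht (fun y hy => by have := hb1 y hy; push_cast at this; linarith)
          have hu3 := hb1 u hu
          push_cast at hu3
          have h5 := H.U' hj hu hlt htop 1 (by push_cast; linarith) hu2
          have h6 := H.cardge hj (v t) htop 2 (by push_cast; linarith)
          have := wct (r := 1) (k := 2) ht hb' (fun y hy => wM y (mem_bin.1 hy).1) (by norm_num) (by norm_num) h5 h6 (by norm_num)
          have := wL t htS hL
          push_cast at *; linarith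
    by_cases hM : (1 - v z) / 3 < v t
    · rcases H.cls hj ht htop w ((1 - v z)/3) 12 9 3 2 hM (by push_cast; linarith) (by push_cast; linarith)
        wb wM (by norm_num) (by norm_num) (by norm_num) with h | ⟨hbad, h⟩
      · push_cast at h; linarith
      · rw [pen_of hbad]
        have := hdM j hj hbad
        push_cast at h; linarith
    · have h6 := H.cardge hj (v t) htop 3 (by push_cast; linarith)
      have := wcb (k := 3) ht hb' (by norm_num) h6
      have := wb t htS
      push_cast at *; linarith
  · rw [sum_add_distrib, sum_add_distrib]
    have := H.sum_pen_bad ((1 - v z) / 2) 2 (δ := 9/2) (by norm_num)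
    have := H.sum_pen_bad (1/3) 2 hd0
    have := H.sum_pen_bad ((1 - v z) / 3) 3 hd0'
    linarith
  · intro p hp
    have hcard := H.cardP hp 4 (by push_cast; linarith)
    have hk : ∀ x ∈ bin S g p, c x < 6 := by intro x hx; rw [hc]; split_ifs <;> norm_num
    have := optW (bin S g p) v c 6 (fun i => [12, 16, 20, 24, 30, 30].getD i 0) (fun i => [6, 6, 8, 9, 12, 12].getD i 0) 59 23 (1/5) (1/4) (v z)
      W 87 (fun n => true) (by rw [hW]; decide +kernel) (by rw [hW]; decide +kernel)
      hk (H.opt p hp) (by omega) hs1 hs2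
      (by intro x hx; rw [hc]; have := H.vmin x (mem_bin.1 hx).1
          split_ifs <;> norm_num <;> linarith)
      (by intro x hx; rw [hc]
          split_ifs <;> norm_num <;> linarith) (by rw [hW]; simp; omega) rfl
    simp only [hw]
    rw [← Finset.sum_div]
    push_cast at this
    linarith

end
end HF


namespace HF
section
variable {S : Finset α} {z : α} {v : α → ℚ} {kk g : α → ℕ} {N D : Finset ℕ}

/-- the last two-item bin `{xs, be}` whose smaller item is at most `1/3` -/
structure Ist (S : Finset α) (z : α) (v : α → ℚ) (kk : α → ℕ) (N : Finset ℕ) (i : ℕ) (xs be : α) : Prop where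
  iN : i ∈ N
  two : Two S v kk i xs be
  hbe : v be ≤ 1 / 3
  max : ∀ j ∈ N, i < j → ∀ x y, Two S v kk j x y → 1 / 3 < v y
  full : 1 < v z + v xs + v be

theorem Core.exists_ist (H : Core S z v kk g N D)
    (h : ¬ ∀ j ∈ N, ∀ x y, Two S v kk j x y → 1 / 3 < v y) :
    ∃ i xs be, Ist S z v kk N i xs be := by
  classical
  push Not at h
  let F := N.filter (fun j => ∃ x y, Two S v kk j x y ∧ v y ≤ 1 / 3)
  have hF : F.Nonempty := by
    obtain ⟨j, hj, x, y, h1, h2⟩ := h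
    exact ⟨j, mem_filter.2 ⟨hj, x, y, h1, h2⟩⟩
  obtain ⟨i, hi, hmax⟩ := F.exists_max_image id hF
  obtain ⟨hiN, x, y, h1, h2⟩ := mem_filter.1 hi
  refine ⟨i, x, y, hiN, h1, h2, ?_, ?_⟩
  · intro j hj hij a b hab
    by_contra hc
    have := hmax j (mem_filter.2 ⟨hj, a, b, hab, not_lt.1 hc⟩)
    simp at this; omega
  · have := H.full hiN
    rw [h1.sum] at this; linarith

section
variable {i : ℕ} {xs be : α}

theorem Ist.xsS (I : Ist S z v kk N i xs be) : xs ∈ S := (mem_bin.1 I.two.memx).1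
theorem Ist.beS (I : Ist S z v kk N i xs be) : be ∈ S := (mem_bin.1 I.two.memy).1

theorem Ist.top_ge (I : Ist S z v kk N i xs be) (H : Core S z v kk g N D) {j : ℕ} (hj : j ∈ N) (hji : j ≤ i)
    {t : α} (htop : ∀ y ∈ bin S kk j, v y ≤ v t) : v xs ≤ v t := by
  rcases hji.lt_or_eq with h | h
  · obtain ⟨y, hy, h1⟩ := H.later hj I.xsS ((mem_bin.1 I.two.memx).2.symm ▸ h)
    exact h1.trans (htop y hy)
  · subst h; exact htop _ I.two.memx

theorem Ist.opt_lt (I : Ist S z v kk N i xs be) (H : Core S z v kk g N D) (H3 : ∀ p ∈ D, 3 ≤ #(bin S g p))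
    {p : ℕ} (hp : p ∈ D) {x y : α} (hx : x ∈ bin S g p) (hy : y ∈ bin S g p) (hyx : y ≠ x)
    (hxs : v xs ≤ v x) : v y < v be := by
  have h3 := H3 p hp
  have hc : 0 < #(((bin S g p).erase x).erase y) := by
    rw [card_erase_of_mem (mem_erase.2 ⟨hyx, hy⟩), card_erase_of_mem hx]; omega
  obtain ⟨u, hu⟩ := card_pos.1 hc
  rw [mem_erase, mem_erase] at hu
  have h1 : v x + v y + v u ≤ 1 := by
    rw [← sum_three (t := x) (x := y) (y := u) hyx hu.2.1 hu.1.symm v]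
    refine le_trans (sum_le_sum_of_subset_of_nonneg ?_ ?_) (H.opt p hp)
    · intro a ha; simp at ha
      rcases ha with rfl | rfl | rfl
      · exact hx
      · exact hy
      · exact hu.2.2
    · intro a ha _; exact (H.vpos (mem_bin.1 ha).1).le
  have h2 := H.vmin u (mem_bin.1 hu.2.2).1
  linarith [I.full]

theorem Ist.after (I : Ist S z v kk N i xs be) (H : Core S z v kk g N D)
    {j : ℕ} (hj : i < j) {x : α} (hx : x ∈ bin S kk j) : v x ≤ v be ∨ (v be < v x ∧ 1 < v x + v xs) := by
  by_contra hc
  push Not at hc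
  have h1 := hc.2 hc.1
  obtain ⟨hxS, hk⟩ := mem_bin.1 hx
  have := H.ff x hxS i I.iN (hk.symm ▸ hj)
  have h2 : ∑ y ∈ (bin S kk i).filter (fun y => v x ≤ v y), v y ≤ v xs := by
    rw [I.two.1]
    have : ({xs, be} : Finset α).filter (fun y => v x ≤ v y) ⊆ {xs} := by
      intro a ha
      rw [mem_filter] at ha
      simp at ha ⊢
      rcases ha.1 with h | h
      · exact h
      · subst h; linarith [ha.2, hc.1]
    refine le_trans (sum_le_sum_of_subset_of_nonneg this ?_) (by simp)
    intro a ha _; simp at ha; subst ha; exact (H.vpos I.xsS).le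
  linarith

theorem Ist.two_ge (I : Ist S z v kk N i xs be) (H : Core S z v kk g N D) (H3 : ∀ p ∈ D, 3 ≤ #(bin S g p))
    (hs : 1 / 6 < v z) {j : ℕ} (hj : j ∈ N) (hji : j ≤ i) {x y : α} (hT : Two S v kk j x y) : v be ≤ v y := by
  rcases hji.lt_or_eq with h | h
  · by_contra hc
    push Not at hc
    have h1 := H.ff be I.beS j hj ((mem_bin.1 I.two.memy).2.symm ▸ h)
    have h2 : ∑ u ∈ (bin S kk j).filter (fun u => v be ≤ v u), v u ≤ v x := by
      rw [hT.1]
      have : ({x, y} : Finset α).filter (fun u => v be ≤ v u) ⊆ {x} := by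
        intro a ha
        rw [mem_filter] at ha
        simp at ha ⊢
        rcases ha.1 with h | h
        · exact h
        · subst h; linarith [ha.2]
      refine le_trans (sum_le_sum_of_subset_of_nonneg this ?_) (by simp)
      intro a ha _; simp at ha; subst ha; exact (H.vpos (mem_bin.1 hT.memx).1).le
    have := H.item_le H3 (mem_bin.1 hT.memx).1
    linarith [I.hbe]
  · subst h
    have := hT.memy
    rw [I.two.1] at this
    simp at this
    rcases this with h | h
    · subst h; exact I.two.2.2
    · subst h; exact le_rfl

/-- two-item bins with small second item are heavy -/
theorem Ist.two_small (I : Ist S z v kk N i xs be) (H : Core S z v kk g N D) (H3 : ∀ p ∈ D, 3 ≤ #(bin S g p))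
    (hs : 1 / 6 < v z) {j : ℕ} (hj : j ∈ N) {x y : α} (hT : Two S v kk j x y) (hy : v y ≤ 2 * v z) :
    j ≤ i ∧ v be ≤ v y ∧ v xs ≤ v x := by
  have h1 : j ≤ i := by
    by_contra hc
    push Not at hc
    have h2 := I.max j hj hc x y hT
    have h3 := H.item_le H3 I.xsS
    rcases I.after H hc hT.memy with h | h
    · linarith [I.hbe]
    · linarith
  refine ⟨h1, I.two_ge H H3 hs hj h1 hT, I.top_ge H hj h1 ?_⟩
  intro u hu
  rw [hT.1] at hu; simp at hu
  rcases hu with rfl | rfl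
  · exact le_rfl
  · exact hT.2.2

theorem Ist.after_of_top (I : Ist S z v kk N i xs be) (H : Core S z v kk g N D) {j : ℕ} (hj : j ∈ N)
    {t : α} (htop : ∀ y ∈ bin S kk j, v y ≤ v t) (h : v t < v xs) : i < j := by
  by_contra hc
  push Not at hc
  linarith [I.top_ge H hj hc htop]

end

/-- top item of a two-item bin whose other item is at most `2 v z` -/
def Hv (S : Finset α) (z : α) (v : α → ℚ) (kk : α → ℕ) (x : α) : Prop :=
  ∃ y, Two S v kk (kk x) x y ∧ v y ≤ 2 * v z

theorem Hv.of {j : ℕ} {x y : α} (h : Two S v kk j x y) (hy : v y ≤ 2 * v z) : Hv S z v kk x :=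
  ⟨y, by rw [(mem_bin.1 h.memx).2]; exact h, hy⟩

theorem Core.kkN (H : Core S z v kk g N D) {x y : α} (h : Two S v kk (kk x) x y) (hx : v z < v x) : kk x ∈ N := by
  apply H.kN x (mem_bin.1 h.memx).1
  rintro rfl; exact lt_irrefl _ hx

end

/-- class `h` occurs at most once, and then all other classes are below `b` -/
def hvb (h b k : ℕ) (n : ℕ → ℕ) : Bool :=
  n h == 0 || (n h == 1 && (List.range k).all fun i => decide (i < b) || i == h || n i == 0)

theorem hvb_of {P : Finset α} {c : α → ℕ} {h b : ℕ} (k : ℕ) (hbh : b ≤ h)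
    (hh : ∀ x ∈ P, c x = h → ∀ y ∈ P, y ≠ x → c y < b) : hvb h b k (cnt P c) = true := by
  unfold hvb
  by_cases h0 : cnt P c h = 0
  · simp [h0]
  · obtain ⟨x, hx, hcx⟩ := cnt_pos (Nat.pos_of_ne_zero h0)
    have h1 : cnt P c h = 1 := by
      rw [cnt, card_eq_one]
      refine ⟨x, ?_⟩
      ext y
      simp only [mem_filter, mem_singleton]
      constructor
      · rintro ⟨hy, hcy⟩
        by_contra hne
        have := hh x hx hcx y hy hne
        omega
      · rintro rfl; exact ⟨hx, hcx⟩
    simp only [h1, Bool.or_eq_true, Bool.and_eq_true, List.all_eq_true, decide_eq_true_eq, beq_iff_eq]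
    right
    refine ⟨trivial, ?_⟩
    intro i _
    by_cases hi : i < b
    · exact Or.inl (Or.inl hi)
    by_cases hih : i = h
    · exact Or.inl (Or.inr hih)
    right
    apply cnt_zero
    intro y hy hcy
    by_cases hyx : y = x
    · subst hyx; exact hih (hcy.symm.trans hcx)
    · have := hh x hx hcx y hy hyx
      omega
end HF


namespace HF
section
variable {S : Finset α} {z : α} {v : α → ℚ} {kk g : α → ℕ} {N D : Finset ℕ}
variable {i : ℕ} {xs be : α}

/-- all-items-above-θ two-count -/
theorem Core.two_B (H : Core S z v kk g N D) {j : ℕ} (hj : j ∈ N) {t : α} (ht : t ∈ bin S kk j)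
    (htop : ∀ y ∈ bin S kk j, v y ≤ v t) {w : α → ℚ} {θ a : ℚ} (hθ : θ < v t) (h2 : v t ≤ 1 / 2)
    (w0 : ∀ y ∈ S, 0 ≤ w y)
    (wB : ∀ y ∈ S, θ < v y → a ≤ w y) (ha : 0 ≤ a)
    (hnb : ¬ Bad S v kk θ 2 j) : 2 * a ≤ ∑ y ∈ bin S kk j, w y := by
  have h2 := of_not_bad ht htop hθ (by push_cast; linarith) hnb
  have := wc (k := 2) (fun y hy => w0 y (mem_bin.1 hy).1) (fun y hy => wB y (mem_bin.1 hy).1) ha (by norm_num) h2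
    (h2.trans (card_le_card (filter_subset _ _))) le_rfl
  push_cast at this; linarith

theorem Core.FAt (H : Core S z v kk g N D) (hs1 : 1 / 5 < v z) (hs2 : v z ≤ 1 / 4)
    {j : ℕ} (hj : j ∈ N) {t : α} (ht : t ∈ bin S kk j) (htop : ∀ y ∈ bin S kk j, v y ≤ v t) (w : α → ℚ)
    (wb : ∀ y ∈ S, 9 ≤ w y) (wM : (1 - v z) / 3 < v t → ∀ y ∈ S, (1 - v z) / 3 < v y → 12 ≤ w y) (ht3 : v t ≤ 1 / 3) :
    36 - pen (Bad S v kk ((1 - v z) / 3) 3) 6 j ≤ ∑ y ∈ bin S kk j, w y := by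
  have htS := (mem_bin.1 ht).1
  have hb' : ∀ {j}, ∀ y ∈ bin S kk j, 9 ≤ w y := fun y hy => wb y (mem_bin.1 hy).1
  have p3 := pen_nonneg (Q := Bad S v kk ((1 - v z) / 3) 3) (δ := 6) (by norm_num) j
  by_cases hM : (1 - v z) / 3 < v t
  · rcases H.cls hj ht htop w ((1 - v z)/3) 12 9 3 2 hM (by push_cast; linarith) (by push_cast; linarith)
      wb (wM hM) (by norm_num) (by norm_num) (by norm_num) with h | ⟨hbad, h⟩
    · push_cast at h; linarith
    · rw [pen_of hbad]
      push_cast at h; linarith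
  · have h6 := H.cardge hj (v t) htop 3 (by push_cast; linarith)
    have := wcb (k := 3) ht hb' (by norm_num) h6
    have := wb t htS
    push_cast at *; linarith

theorem Core.FA (H : Core S z v kk g N D) (H3 : ∀ p ∈ D, 3 ≤ #(bin S g p))
    (hs1 : 1 / 5 < v z) (hs2 : v z ≤ 1 / 4) (I : Ist S z v kk N i xs be) (hx : 1 / 2 < v xs) (w : α → ℚ)
    (wb : ∀ y ∈ S, 9 ≤ w y) (wM : (1 - v z) / 3 < v be → ∀ y ∈ S, (1 - v z) / 3 < v y → 12 ≤ w y)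
    (wB : ∀ y ∈ S, (1 - v z) / 2 < v y → 18 ≤ w y)
    (wH : ∀ j ∈ N, ∀ x y, Two S v kk j x y → v y ≤ 2 * v z → 36 ≤ w x + w y)
    {j : ℕ} (hj : j ∈ N) : 36 - pen (Bad S v kk ((1 - v z) / 3) 3) 6 j ≤ ∑ y ∈ bin S kk j, w y := by
  obtain ⟨t, ht, htop⟩ := H.top hj
  have htS := (mem_bin.1 ht).1
  have hti := H.item_le H3 htS
  have hb' : ∀ {j}, ∀ y ∈ bin S kk j, 9 ≤ w y := fun y hy => wb y (mem_bin.1 hy).1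
  have p3 := pen_nonneg (Q := Bad S v kk ((1 - v z) / 3) 3) (δ := 6) (by norm_num) j
  by_cases hB : (1 - v z) / 2 < v t
  · rcases H.split2 hj ht htop (by linarith) with ⟨y, hT, hyS, _⟩ | h3
    · rw [hT.sum]
      by_cases hy : v y ≤ 2 * v z
      · linarith [wH j hj _ _ hT hy]
      · linarith [wB t htS hB, wB y hyS (by linarith)]
    · have := wcb (k := 2) ht hb' (by norm_num) h3
      have := wB t htS (by linarith)
      push_cast at *; linarith
  have haf := I.after_of_top H hj htop (by linarith)
  have htb : v t ≤ v be := by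
    rcases I.after H haf ht with h | h
    · exact h
    · have := H.item_le H3 I.xsS
      linarith
  have := I.hbe
  exact H.FAt hs1 hs2 hj ht htop w wb (fun h => wM (by linarith)) (by linarith)

theorem Core.caseA1 (H : Core S z v kk g N D) (H3 : ∀ p ∈ D, 3 ≤ #(bin S g p))
    (hs1 : 1 / 5 < v z) (hs2 : v z ≤ 1 / 4) (I : Ist S z v kk N i xs be) (hbe : v be ≤ (1 - v z) / 3) : False := by
  classical
  have hfull := I.full
  have hx : 1 / 2 < v xs := by linarith
  have hbs : v z < v be := by linarith [H.item_le H3 I.xsS]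
  obtain ⟨c, hc⟩ : ∃ c : α → ℕ, ∀ x, c x =
      if 1 / 2 < v x then (if Hv S z v kk x then 4 else 3)
      else if (1 - v z) / 2 < v x then 2 else if v be ≤ v x then 1 else 0 :=
    ⟨_, fun _ => rfl⟩
  obtain ⟨W, hW⟩ : ∃ W : ℕ → ℕ, W = fun i => [9, 10, 18, 18, 26].getD i 0 := ⟨_, rfl⟩
  obtain ⟨w, hw⟩ : ∃ w : α → ℚ, ∀ x, w x = (W (c x) : ℚ) := ⟨_, fun _ => rfl⟩
  have wb : ∀ y ∈ S, 9 ≤ w y := by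
    intro y _; rw [hw, hc, hW]; split_ifs <;> norm_num
  have wP : ∀ y ∈ S, v be ≤ v y → 10 ≤ w y := by
    intro y _ h; rw [hw, hc, hW]; split_ifs <;> norm_num
  have wB : ∀ y ∈ S, (1 - v z) / 2 < v y → 18 ≤ w y := by
    intro y _ h; rw [hw, hc, hW]; split_ifs <;> norm_num <;> linarith
  have wG : ∀ j x y, Two S v kk j x y → 1 / 2 < v x → v y ≤ 2 * v z → 26 ≤ w x := by
    intro j x y h h2 h3
    rw [hw, hc, hW, if_pos h2, if_pos (Hv.of h h3)]; norm_num
  refine H.count44' w 6 _ (fun j hj => H.FA H3 hs1 hs2 I hx w wb (fun h => by linarith) wB ?_ hj)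
    (H.sum_pen_bad _ _ (by norm_num)) ?_ (by linarith [wb z H.zS])
  · intro j hj x y hT hy
    obtain ⟨h1, h2, h3⟩ := I.two_small H H3 (by linarith) hj hT hy
    linarith [wG _ _ _ hT (by linarith) hy, wP y (mem_bin.1 hT.memy).1 h2]
  · intro p hp
    have hcard := H.cardP hp 4 (by push_cast; linarith)
    have hk : ∀ x ∈ bin S g p, c x < 5 := by intro x hx; rw [hc]; split_ifs <;> norm_num
    have := optW (bin S g p) v c 5 (fun i => [2, 2, 4, 5, 5].getD i 0) (fun i => [2, 2, 3, 4, 4].getD i 0) 9 7 (1/5) (1/4) (v z)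
      W 44 (hvb 4 1 5) (by rw [hW]; decide +kernel) (by rw [hW]; decide +kernel)
      hk (H.opt p hp) (by omega) hs1 hs2
      (by intro x hx; rw [hc]; have := H.vmin x (mem_bin.1 hx).1
          split_ifs <;> norm_num <;> linarith)
      (by intro x hx; rw [hc]
          split_ifs <;> norm_num <;> linarith) (by rw [hW]; simp; omega) 
      (by
        apply hvb_of _ (by norm_num)
        intro x hx hcx y hy hyx
        have hH : 1 / 2 < v x ∧ Hv S z v kk x := by
          rw [hc] at hcx
          split_ifs at hcx with h1 h2 <;> first | exact ⟨h1, h2⟩ | omega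
        obtain ⟨hx2, y', hT, hy'⟩ := hH
        obtain ⟨h1, h2, h3⟩ := I.two_small H H3 (by linarith) (H.kkN hT (by linarith)) hT hy'
        have := I.opt_lt H H3 hp hx hy hyx h3
        rw [hc]; split_ifs <;> first | linarith | norm_num)
    simp only [hw]
    exact_mod_cast this

theorem Core.caseA2 (H : Core S z v kk g N D) (H3 : ∀ p ∈ D, 3 ≤ #(bin S g p))
    (hs1 : 1 / 5 < v z) (hs2 : v z ≤ 1 / 4) (I : Ist S z v kk N i xs be) (hbe : (1 - v z) / 3 < v be)
    (hx : 1 / 2 < v xs) : False := by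
  classical
  have hfull := I.full
  have hb3 := I.hbe
  have hbs : v z < v be := by linarith [H.item_le H3 I.xsS]
  obtain ⟨c, hc⟩ : ∃ c : α → ℕ, ∀ x, c x =
      if 1 / 2 < v x then (if Hv S z v kk x then 5 else 4)
      else if (1 - v z) / 2 < v x then 3 else if v be ≤ v x then 2 else if (1 - v z) / 3 < v x then 1 else 0 :=
    ⟨_, fun _ => rfl⟩
  obtain ⟨W, hW⟩ : ∃ W : ℕ → ℕ, W = fun i => [9, 12, 13, 18, 18, 23].getD i 0 := ⟨_, rfl⟩
  obtain ⟨w, hw⟩ : ∃ w : α → ℚ, ∀ x, w x = (W (c x) : ℚ) := ⟨_, fun _ => rfl⟩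
  have wb : ∀ y ∈ S, 9 ≤ w y := by
    intro y _; rw [hw, hc, hW]; split_ifs <;> norm_num
  have wP : ∀ y ∈ S, v be ≤ v y → 13 ≤ w y := by
    intro y _ h; rw [hw, hc, hW]; split_ifs <;> norm_num
  have wM : ∀ y ∈ S, (1 - v z) / 3 < v y → 12 ≤ w y := by
    intro y _ h; rw [hw, hc, hW]; split_ifs <;> norm_num
  have wB : ∀ y ∈ S, (1 - v z) / 2 < v y → 18 ≤ w y := by
    intro y _ h; rw [hw, hc, hW]; split_ifs <;> norm_num <;> linarith
  have wG : ∀ j x y, Two S v kk j x y → 1 / 2 < v x → v y ≤ 2 * v z → 23 ≤ w x := by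
    intro j x y h h2 h3
    rw [hw, hc, hW, if_pos h2, if_pos (Hv.of h h3)]; norm_num
  refine H.count44' w 6 _ (fun j hj => H.FA H3 hs1 hs2 I hx w wb (fun _ => wM) wB ?_ hj)
    (H.sum_pen_bad _ _ (by norm_num)) ?_ (by linarith [wb z H.zS])
  · intro j hj x y hT hy
    obtain ⟨h1, h2, h3⟩ := I.two_small H H3 (by linarith) hj hT hy
    linarith [wG _ _ _ hT (by linarith) hy, wP y (mem_bin.1 hT.memy).1 h2]
  · intro p hp
    have hcard := H.cardP hp 4 (by push_cast; linarith)
    have hk : ∀ x ∈ bin S g p, c x < 6 := by intro x hx; rw [hc]; split_ifs <;> norm_num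
    have := optW (bin S g p) v c 6 (fun i => [6, 8, 8, 12, 15, 15].getD i 0) (fun i => [2, 2, 2, 3, 4, 4].getD i 0) 29 7 (1/5) (1/4) (v z)
      W 44 (hvb 5 2 6) (by rw [hW]; decide +kernel) (by rw [hW]; decide +kernel)
      hk (H.opt p hp) (by omega) hs1 hs2
      (by intro x hx; rw [hc]; have := H.vmin x (mem_bin.1 hx).1
          split_ifs <;> norm_num <;> linarith)
      (by intro x hx; rw [hc]
          split_ifs <;> norm_num <;> linarith) (by rw [hW]; simp; omega) 
      (by
        apply hvb_of _ (by norm_num)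
        intro x hx hcx y hy hyx
        have hH : 1 / 2 < v x ∧ Hv S z v kk x := by
          rw [hc] at hcx
          split_ifs at hcx with h1 h2 <;> first | exact ⟨h1, h2⟩ | omega
        obtain ⟨hx2, y', hT, hy'⟩ := hH
        obtain ⟨h1, h2, h3⟩ := I.two_small H H3 (by linarith) (H.kkN hT (by linarith)) hT hy'
        have := I.opt_lt H H3 hp hx hy hyx h3
        rw [hc]; split_ifs <;> first | linarith | norm_num)
    simp only [hw]
    exact_mod_cast this


/-- weights from counts, non-strict threshold -/
theorem wcle {X : Finset α} {w v : α → ℚ} {θ a b : ℚ} {r k : ℕ}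
    (hb : ∀ y ∈ X, b ≤ w y) (ha : ∀ y ∈ X, θ ≤ v y → a ≤ w y)
    (hab : b ≤ a) (hb0 : 0 ≤ b) (hr : r ≤ #(X.filter (fun y => θ ≤ v y))) (hk : k ≤ #X) (hrk : r ≤ k) :
    r * a + (k - r) * b ≤ ∑ y ∈ X, w y := by
  have hi : ∀ y, (0:ℚ) < (if θ ≤ v y then 1 else 0) ↔ θ ≤ v y := by intro y; split_ifs with h <;> simp [h]
  refine wc (v := fun y => if θ ≤ v y then 1 else 0) (θ := 0) hb (fun y hy h => ha y hy ((hi y).1 h)) hab hb0 ?_ hk hrk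
  simp only [hi]; exact hr

theorem Core.caseA3 (H : Core S z v kk g N D) (H3 : ∀ p ∈ D, 3 ≤ #(bin S g p))
    (hs1 : 1 / 5 < v z) (hs2 : v z ≤ 1 / 4) (I : Ist S z v kk N i xs be) (hbe : (1 - v z) / 3 < v be)
    (hx : v xs ≤ 1 / 2) : False := by
  classical
  have hfull := I.full
  have hb3 := I.hbe
  obtain ⟨c, hc⟩ : ∃ c : α → ℕ, ∀ x, c x =
      if 1 / 2 < v x then 5 else if x = xs then 4
      else if v xs ≤ v x then 3 else if v be ≤ v x then 2 else if (1 - v z) / 3 < v x then 1 else 0 :=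
    ⟨_, fun _ => rfl⟩
  obtain ⟨W, hW⟩ : ∃ W : ℕ → ℕ, W = fun i => [9, 12, 14, 18, 22, 22].getD i 0 := ⟨_, rfl⟩
  obtain ⟨w, hw⟩ : ∃ w : α → ℚ, ∀ x, w x = (W (c x) : ℚ) := ⟨_, fun _ => rfl⟩
  have wb : ∀ y ∈ S, 9 ≤ w y := by
    intro y _; rw [hw, hc, hW]; split_ifs <;> norm_num
  have wM : ∀ y ∈ S, (1 - v z) / 3 < v y → 12 ≤ w y := by
    intro y _ h; rw [hw, hc, hW]; split_ifs <;> norm_num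
  have wP : ∀ y ∈ S, v be ≤ v y → 14 ≤ w y := by
    intro y _ h; rw [hw, hc, hW]; split_ifs <;> norm_num
  have wX : ∀ y ∈ S, v xs ≤ v y → 18 ≤ w y := by
    intro y _ h; rw [hw, hc, hW]; split_ifs <;> norm_num
  have wG : ∀ y ∈ S, 1 / 2 < v y → 22 ≤ w y := by
    intro y _ h; rw [hw, hc, hW]; split_ifs; norm_num
  have wx : 22 ≤ w xs := by
    rw [hw, hc, hW, if_neg (by linarith), if_pos rfl]; norm_num
  have hb' : ∀ {j}, ∀ y ∈ bin S kk j, 9 ≤ w y := fun y hy => wb y (mem_bin.1 hy).1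
  refine H.count44 w 6 2 _ (pen (fun p => p = g xs) 2) ?_
    (H.sum_pen_bad ((1 - v z) / 3) 3 (by norm_num)) ?_ (sum_pen _ (by norm_num) (fun _ _ _ _ h h' => h.trans h'.symm)) (by linarith [wb z H.zS])
  · intro j hj
    obtain ⟨t, ht, htop⟩ := H.top hj
    have htS := (mem_bin.1 ht).1
    have hti := H.item_le H3 htS
    have p3 := pen_nonneg (Q := Bad S v kk ((1 - v z) / 3) 3) (δ := 6) (by norm_num) j
    by_cases hG : 1 / 2 < v t
    · rcases H.split2 hj ht htop (by linarith) with ⟨y, hT, hyS, _⟩ | h3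
      · rw [hT.sum]
        have hy2 : v be ≤ v y := by
          by_cases hy : v y ≤ 2 * v z
          · exact (I.two_small H H3 (by linarith) hj hT hy).2.1
          · linarith
        linarith [wG t htS hG, wP y hyS hy2]
      · have := wcb (k := 2) ht hb' (by norm_num) h3
        have := wG t htS (by linarith)
        push_cast at *; linarith
    have hlate : i < j → v t ≤ v be := by
      intro h
      rcases I.after H h ht with h | h
      · exact h
      · linarith
    rcases lt_trichotomy j i with hl | he | hl
    · have h2 := H.U hj I.xsS ((mem_bin.1 I.two.memx).2.symm ▸ hl) (v t) htop 1 (by push_cast; linarith)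
      have := wcle (r := 2) (k := 2) hb' (fun y hy => wX y (mem_bin.1 hy).1) (by norm_num) (by norm_num) h2
        (le_trans h2 (card_le_card (filter_subset _ _))) le_rfl
      push_cast at this; linarith
    · rw [he, I.two.sum]; rw [he] at p3
      linarith [wP be I.beS le_rfl]
    · exact H.FAt hs1 hs2 hj ht htop w wb (fun _ => wM) (by linarith [hlate hl])
  · intro p hp
    have hcard := H.cardP hp 4 (by push_cast; linarith)
    have hk : ∀ x ∈ bin S g p, c x < 6 := by intro x hx; rw [hc]; split_ifs <;> norm_num
    have hP := pen_nonneg (Q := fun p => p = g xs) (δ := 2) (by norm_num) p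
    have hvv : ∀ x ∈ bin S g p, v xs ≤ v x → ∀ y ∈ bin S g p, y ≠ x → c y < 2 := by
      intro x hx h3 y hy hyx
      have := I.opt_lt H H3 hp hx hy hyx h3
      rw [hc]; split_ifs with a1 a2 a3 <;> first | linarith | (norm_num; done) | (subst a2; linarith)
    have hx3 : hvb 3 2 6 (cnt (bin S g p) c) = true := by
      apply hvb_of _ (by norm_num)
      intro x hx hcx
      refine hvv x hx ?_
      rw [hc] at hcx
      split_ifs at hcx with a1 a2 a3 <;> first | exact a3 | omega
    have hx4 : hvb 4 2 6 (cnt (bin S g p) c) = true := by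
      apply hvb_of _ (by norm_num)
      intro x hx hcx
      refine hvv x hx ?_
      rw [hc] at hcx
      split_ifs at hcx with a1 a2 a3 <;> first | exact a2 ▸ le_rfl | omega
    have hx5 : hvb 5 2 6 (cnt (bin S g p) c) = true := by
      apply hvb_of _ (by norm_num)
      intro x hx hcx
      refine hvv x hx ?_
      rw [hc] at hcx
      split_ifs at hcx with a1 a2 a3 <;> first | linarith | omega
    have opt := fun K ex hA hB => optW (bin S g p) v c 6 (fun i => [6, 8, 9, 14, 14, 15].getD i 0) (fun i => [3, 3, 3, 5, 5, 6].getD i 0) 29 11 (1/5) (1/4) (v z)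
      W K ex hA hB
      hk (H.opt p hp) (by omega) hs1 hs2
      (by intro x hx; rw [hc]; have := H.vmin x (mem_bin.1 hx).1
          split_ifs with a1 a2 <;> norm_num <;> first | linarith | (subst a2; linarith))
      (by intro x hx; rw [hc]
          split_ifs with a1 a2 <;> norm_num <;> first | linarith | (subst a2; linarith))
    by_cases hpx : p = g xs
    · rw [pen_of (Q := fun p => p = g xs) hpx]
      have := opt 46 (fun n => hvb 3 2 6 n && hvb 4 2 6 n && hvb 5 2 6 n)
        (by rw [hW]; decide +kernel) (by rw [hW]; decide +kernel) (by rw [hW]; simp; omega)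
        (by simp [hx3, hx4, hx5])
      simp only [hw]
      push_cast at this; linarith
    · have h0 : cnt (bin S g p) c 4 = 0 := by
        apply cnt_zero
        intro x hx hcx
        rw [hc] at hcx
        split_ifs at hcx with a1 a2 a3 a4 a5 <;> first | omega | exact hpx (a2 ▸ (mem_bin.1 hx).2).symm
      have := opt 44 (fun n => hvb 3 2 6 n && hvb 5 2 6 n && n 4 == 0)
        (by rw [hW]; decide +kernel) (by rw [hW]; decide +kernel) (by rw [hW]; simp; omega)
        (by simp [hx3, hx5, h0])
      simp only [hw]
      push_cast at this; linarith

end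
end HF


namespace HF
section
variable {S : Finset α} {z : α} {v : α → ℚ} {kk g : α → ℕ} {N D : Finset ℕ}

/-- a bin with at least three items has either at least four items or exactly three, listed with sum -/
theorem Core.split3 (H : Core S z v kk g N D) {j : ℕ} (hj : j ∈ N) {t : α} (ht : t ∈ bin S kk j)
    (htop : ∀ y ∈ bin S kk j, v y ≤ v t) (h3 : 3 ≤ #(bin S kk j)) :
    4 ≤ #(bin S kk j) ∨ ∃ x y, x ∈ bin S kk j ∧ y ∈ bin S kk j ∧ x ∈ S ∧ y ∈ S ∧ v y ≤ v x ∧ v x ≤ v t ∧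
      1 < v z + v t + v x + v y ∧
      bin S kk j = {t, x, y} ∧ ∀ f : α → ℚ, ∑ u ∈ bin S kk j, f u = f t + f x + f y := by
  by_cases h4 : 4 ≤ #(bin S kk j)
  · exact Or.inl h4
  right
  obtain ⟨x, hx, y, hy, h1, h2, h5, h6, h7⟩ := three_of v (show #(bin S kk j) = 3 by omega) ht
  have hsum : ∀ f : α → ℚ, ∑ u ∈ bin S kk j, f u = f t + f x + f y := by
    intro f; rw [h7, sum_three h1 h2 h5]
  refine ⟨x, y, hx, hy, (mem_bin.1 hx).1, (mem_bin.1 hy).1, h6, htop x hx, ?_, h7, hsum⟩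
  have := H.full hj
  rw [hsum] at this
  linarith

theorem Core.caseC0 (H : Core S z v kk g N D) (H3 : ∀ p ∈ D, 3 ≤ #(bin S g p))
    (hs1 : 2 / 11 < v z) (hs2 : v z ≤ 1 / 5)
    (hI : ∀ j ∈ N, ∀ x y, Two S v kk j x y → 1 / 3 < v y) : False := by
  obtain ⟨c, hc⟩ : ∃ c : α → ℕ, ∀ x, c x =
      if 1 / 2 < v x then (if #(bin S kk (kk x)) = 2 then 7 else 6)
      else if (1 - v z) / 2 < v x then 5 else if 1 / 3 < v x then 4 else if (1 - v z) / 3 < v x then 3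
      else if 1 / 4 < v x then 2 else if (1 - v z) / 4 < v x then 1 else 0 :=
    ⟨_, fun _ => rfl⟩
  obtain ⟨W, hW⟩ : ∃ W : ℕ → ℕ, W = fun i => [24, 27, 28, 36, 42, 54, 60, 66].getD i 0 := ⟨_, rfl⟩
  obtain ⟨w, hw⟩ : ∃ w : α → ℚ, ∀ x, w x = (W (c x) : ℚ) / 3 := ⟨_, fun _ => rfl⟩
  have wb : ∀ y ∈ S, 8 ≤ w y := by
    intro y _; rw [hw, hc, hW]; split_ifs <;> norm_num
  have wT : ∀ y ∈ S, (1 - v z) / 4 < v y → 9 ≤ w y := by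
    intro y _ h; rw [hw, hc, hW]; split_ifs <;> norm_num
  have wS : ∀ y ∈ S, 1 / 4 < v y → 28 / 3 ≤ w y := by
    intro y _ h; rw [hw, hc, hW]; split_ifs <;> norm_num
  have wM : ∀ y ∈ S, (1 - v z) / 3 < v y → 12 ≤ w y := by
    intro y _ h; rw [hw, hc, hW]; split_ifs <;> norm_num <;> linarith
  have wL : ∀ y ∈ S, 1 / 3 < v y → 14 ≤ w y := by
    intro y _ h; rw [hw, hc, hW]; split_ifs <;> norm_num <;> linarith
  have wB : ∀ y ∈ S, (1 - v z) / 2 < v y → 18 ≤ w y := by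
    intro y _ h; rw [hw, hc, hW]; split_ifs <;> norm_num <;> linarith
  have wG3 : ∀ y ∈ S, 1 / 2 < v y → 20 ≤ w y := by
    intro y _ h; rw [hw, hc, hW, if_pos h]; split_ifs <;> norm_num <;> linarith
  have wG : ∀ j x y, Two S v kk j x y → 1 / 2 < v x → 22 ≤ w x := by
    intro j x y h h2
    rw [hw, hc, hW, if_pos h2, (mem_bin.1 h.memx).2, if_pos h.card]; norm_num
  have hb' : ∀ {j}, ∀ y ∈ bin S kk j, 8 ≤ w y := fun y hy => wb y (mem_bin.1 hy).1
  have w0 : ∀ y ∈ S, 0 ≤ w y := fun y hy => by linarith [wb y hy]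
  obtain ⟨dL, dM, hd0, hd0', hdE, hdM, hdL⟩ : ∃ dL dM : ℚ, 0 ≤ dL ∧ 0 ≤ dM ∧ dL + dM ≤ 8 ∧
      (∀ j ∈ N, Bad S v kk ((1 - v z) / 3) 3 j → 6 ≤ dM) ∧
      (5 ≤ dL ∨ (2 ≤ dL ∧ ∃ j ∈ N, Bad S v kk ((1 - v z) / 3) 3 j)) := by
    by_cases h : ∃ j ∈ N, Bad S v kk ((1 - v z) / 3) 3 j
    · exact ⟨2, 6, by norm_num, by norm_num, by norm_num, fun _ _ _ => le_rfl, Or.inr ⟨le_rfl, h⟩⟩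
    · exact ⟨5, 0, by norm_num, by norm_num, by norm_num, fun j hj hb => absurd ⟨j, hj, hb⟩ h, Or.inl le_rfl⟩
  obtain ⟨dS, dT, he0, he0', heE, heT, heS⟩ : ∃ dS dT : ℚ, 0 ≤ dS ∧ 0 ≤ dT ∧ dS + dT ≤ 11 / 3 ∧
      (∀ j ∈ N, Bad S v kk ((1 - v z) / 4) 4 j → 3 ≤ dT) ∧
      (8 / 3 ≤ dS ∨ (2 / 3 ≤ dS ∧ ∃ j ∈ N, Bad S v kk ((1 - v z) / 4) 4 j)) := by
    by_cases h : ∃ j ∈ N, Bad S v kk ((1 - v z) / 4) 4 j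
    · exact ⟨2/3, 3, by norm_num, by norm_num, by norm_num, fun _ _ _ => le_rfl, Or.inr ⟨le_rfl, h⟩⟩
    · exact ⟨8/3, 0, by norm_num, by norm_num, by norm_num, fun j hj hb => absurd ⟨j, hj, hb⟩ h, Or.inl le_rfl⟩
  have key := H.count w 43 (47/3) 0 (fun j => pen (Bad S v kk ((1 - v z) / 2) 2) 4 j +
    pen (Bad S v kk (1 / 3) 2) dL j + pen (Bad S v kk ((1 - v z) / 3) 3) dM j +
    pen (Bad S v kk (1 / 4) 3) dS j + pen (Bad S v kk ((1 - v z) / 4) 4) dT j) (fun _ => 0) ?_ ?_ ?_ (by simp)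
  · have hz := wb z H.zS
    have hcard := H.card
    have hD := H.Dpos
    have h1 : (108 * #N : ℚ) ≤ 23 + 129 * #D := by linarith
    have h2 : 108 * #N ≤ 23 + 129 * #D := by exact_mod_cast h1
    obtain ⟨k, hk⟩ := Nat.exists_eq_add_of_le hcard
    have hk0 : k = 0 ∨ k = 1 := by omega
    rcases hk0 with rfl | rfl
    · omega
    · omega
  · intro j hj
    obtain ⟨t, ht, htop⟩ := H.top hj
    have htS := (mem_bin.1 ht).1
    have hti := H.item_le H3 htS
    have p1 := pen_nonneg (Q := Bad S v kk ((1 - v z) / 2) 2) (δ := 4) (by norm_num) j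
    have p2 := pen_nonneg (Q := Bad S v kk (1 / 3) 2) hd0 j
    have p3 := pen_nonneg (Q := Bad S v kk ((1 - v z) / 3) 3) hd0' j
    have p4 := pen_nonneg (Q := Bad S v kk (1 / 4) 3) he0 j
    have p5 := pen_nonneg (Q := Bad S v kk ((1 - v z) / 4) 4) he0' j
    by_cases hG : 1 / 2 < v t
    · rcases H.split2 hj ht htop (by linarith) with ⟨y, hT, hyS, _⟩ | h3
      · rw [hT.sum]
        linarith [wG _ _ _ hT hG, wL y hyS (hI j hj _ _ hT)]
      · have := wcb (k := 2) ht hb' (by norm_num) h3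
        have := wG3 t htS (by linarith)
        push_cast at *; linarith
    by_cases hB : (1 - v z) / 2 < v t
    · by_cases hbad : Bad S v kk ((1 - v z) / 2) 2 j
      · rw [pen_of hbad]
        rcases H.split2 hj ht htop (by linarith) with ⟨y, hT, hyS, _⟩ | h3
        · rw [hT.sum]
          linarith [wB t htS hB, wL y hyS (hI j hj _ _ hT)]
        · have := wcb (k := 2) ht hb' (by norm_num) h3
          have := wB t htS (by linarith)
          push_cast at *; linarith
      · have := H.two_B hj ht htop hB (by linarith) w0 wB (by norm_num) hbad
        linarith
    by_cases hL : 1 / 3 < v t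
    · have h6 := H.cardge hj (v t) htop 2 (by push_cast; linarith)
      by_cases hbad : Bad S v kk (1 / 3) 2 j
      · rw [pen_of hbad]
        have hwt := wL t htS hL
        rcases hdL with h4 | ⟨h4, j0, hj0, hb0⟩
        · rcases H.split3 hj ht htop h6 with h | ⟨x, y, -, -, hxS, hyS, hyx, hxt, hf, -, hsum⟩
          · have := wcb (k := 3) ht hb' (by norm_num) h
            push_cast at *; linarith
          · rw [hsum]
            linarith [wT x hxS (by linarith), wb y hyS]
        · obtain ⟨hb1, ⟨u, hu, hu2⟩, hb3⟩ := hb0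
          have hlt : j < j0 := H.lt_of_top hj0 ht (fun y hy => by have := hb1 y hy; push_cast at this; linarith)
          have hu3 := hb1 u hu
          push_cast at hu3
          have h5 := H.U' hj hu hlt htop 1 (by push_cast; linarith) hu2
          have := wct (r := 1) (k := 2) ht hb' (fun y hy => wM y (mem_bin.1 hy).1) (by norm_num) (by norm_num) h5 h6 (by norm_num)
          push_cast at *; linarith
      · have h2 := of_not_bad ht htop hL (by push_cast; linarith) hbad
        have := wc (k := 3) hb' (fun y hy => wL y (mem_bin.1 hy).1) (by norm_num) (by norm_num) h2 h6 (by norm_num)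
        push_cast at this; linarith
    by_cases hM : (1 - v z) / 3 < v t
    · have h6 := H.cardge hj (v t) htop 2 (by push_cast; linarith)
      have hwt := wM t htS hM
      by_cases hbad : Bad S v kk ((1 - v z) / 3) 3 j
      · rw [pen_of hbad]
        have h4 := hdM j hj hbad
        rcases H.split3 hj ht htop h6 with h | ⟨x, y, -, -, hxS, hyS, hyx, hxt, hf, -, hsum⟩
        · have := wcb (k := 3) ht hb' (by norm_num) h
          push_cast at *; linarith
        · rw [hsum]
          by_cases hyV : (1 - v z) / 4 < v y
          · linarith [wT x hxS (by linarith), wT y hyS hyV]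
          · linarith [wM x hxS (by linarith), wb y hyS]
      · have h2 := of_not_bad ht htop hM (by push_cast; linarith) hbad
        have := wc (k := 3) hb' (fun y hy => wM y (mem_bin.1 hy).1) (by norm_num) (by norm_num) h2 h6 (by norm_num)
        push_cast at this; linarith
    by_cases hS : 1 / 4 < v t
    · rcases H.cls hj ht htop w (1 / 4) (28 / 3) 8 3 3 hS (by push_cast; linarith) (by push_cast; linarith)
        wb wS (by norm_num) (by norm_num) (by norm_num) with h | ⟨hbad, h⟩
      · push_cast at h; linarith
      · rw [pen_of hbad]
        have hwt := wS t htS hS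
        rcases heS with h4 | ⟨h4, j0, hj0, hb0⟩
        · push_cast at h; linarith
        · obtain ⟨hb1, ⟨u, hu, hu2⟩, hb3⟩ := hb0
          have hlt : j < j0 := H.lt_of_top hj0 ht (fun y hy => by have := hb1 y hy; push_cast at this; linarith)
          have hu3 := hb1 u hu
          push_cast at hu3
          have h5 := H.U' hj hu hlt htop 2 (by push_cast; linarith) hu2
          have h6 := H.cardge hj (v t) htop 3 (by push_cast; linarith)
          have := wct (r := 2) (k := 3) ht hb' (fun y hy => wT y (mem_bin.1 hy).1) (by norm_num) (by norm_num) h5 h6 (by norm_num)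
          push_cast at *; linarith
    by_cases hT : (1 - v z) / 4 < v t
    · rcases H.cls hj ht htop w ((1 - v z) / 4) 9 8 4 3 hT (by push_cast; linarith) (by push_cast; linarith)
        wb wT (by norm_num) (by norm_num) (by norm_num) with h | ⟨hbad, h⟩
      · push_cast at h; linarith
      · rw [pen_of hbad]
        have := heT j hj hbad
        push_cast at h; linarith
    · have h6 := H.cardge hj (v t) htop 4 (by push_cast; linarith)
      have := wcb (k := 4) ht hb' (by norm_num) h6
      have := wb t htS
      push_cast at *; linarith
  · simp only [sum_add_distrib]
    have := H.sum_pen_bad ((1 - v z) / 2) 2 (δ := 4) (by norm_num)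
    have := H.sum_pen_bad (1/3) 2 hd0
    have := H.sum_pen_bad ((1 - v z) / 3) 3 hd0'
    have := H.sum_pen_bad (1/4) 3 he0
    have := H.sum_pen_bad ((1 - v z) / 4) 4 he0'
    linarith
  · intro p hp
    have hcard := H.cardP hp 5 (by push_cast; linarith)
    have hk : ∀ x ∈ bin S g p, c x < 8 := by intro x hx; rw [hc]; split_ifs <;> norm_num
    have := optW (bin S g p) v c 8 (fun i => [24, 27, 33, 36, 44, 54, 66, 66].getD i 0)
      (fun i => [12, 12, 15, 16, 20, 24, 30, 30].getD i 0) 131 59 (2/11) (1/5) (v z)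
      W 129 (fun n => true) (by rw [hW]; decide +kernel) (by rw [hW]; decide +kernel)
      hk (H.opt p hp) (by omega) hs1 hs2
      (by intro x hx; rw [hc]; have := H.vmin x (mem_bin.1 hx).1
          split_ifs <;> norm_num <;> linarith)
      (by intro x hx; rw [hc]
          split_ifs <;> norm_num <;> linarith) (by rw [hW]; simp; omega) rfl
    simp only [hw]
    rw [← Finset.sum_div]
    push_cast at this
    linarith

end
end HF


namespace HF
section
variable {S : Finset α} {z : α} {v : α → ℚ} {kk g : α → ℕ} {N D : Finset ℕ}
variable {i : ℕ} {xs be : α}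

theorem Core.others (H : Core S z v kk g N D) (H3 : ∀ p ∈ D, 3 ≤ #(bin S g p))
    {p : ℕ} (hp : p ∈ D) {x : α} (hx : x ∈ bin S g p) :
    ∃ y ∈ bin S g p, ∃ u ∈ bin S g p, y ≠ x ∧ u ≠ x ∧ v x + v y + v u ≤ 1 := by
  have h3 := H3 p hp
  have hc : 1 < #((bin S g p).erase x) := by
    rw [card_erase_of_mem hx]; omega
  obtain ⟨y, hy, u, hu, hne⟩ := one_lt_card.1 hc
  rw [mem_erase] at hy hu
  refine ⟨y, hy.2, u, hu.2, hy.1, hu.1, ?_⟩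
  rw [← sum_three (t := x) (x := y) (y := u) hy.1 hu.1 hne v]
  refine le_trans (sum_le_sum_of_subset_of_nonneg ?_ ?_) (H.opt p hp)
  · intro a ha; simp at ha
    rcases ha with rfl | rfl | rfl
    · exact hx
    · exact hy.2
    · exact hu.2
  · intro a ha _; exact (H.vpos (mem_bin.1 ha).1).le

/-- bins with top item at most `1/4` -/
theorem Core.FCt (H : Core S z v kk g N D) (hs1 : 2 / 11 < v z) (hs2 : v z ≤ 1 / 5)
    {j : ℕ} (hj : j ∈ N) {t : α} (ht : t ∈ bin S kk j) (htop : ∀ y ∈ bin S kk j, v y ≤ v t) (w : α → ℚ) {a b d : ℚ}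
    (hb : 8 ≤ b) (hab : b ≤ a) (hd : 36 - d ≤ a + 3 * b) (ha : 9 ≤ a) (hd0 : 0 ≤ d)
    (wb : ∀ y ∈ S, b ≤ w y) (wT : ∀ y ∈ S, (1 - v z) / 4 < v y → a ≤ w y) (ht4 : v t ≤ 1 / 4) :
    36 - pen (Bad S v kk ((1 - v z) / 4) 4) d j ≤ ∑ y ∈ bin S kk j, w y := by
  have htS := (mem_bin.1 ht).1
  have p5 := pen_nonneg (Q := Bad S v kk ((1 - v z) / 4) 4) hd0 j
  by_cases hT : (1 - v z) / 4 < v t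
  · rcases H.cls hj ht htop w ((1 - v z) / 4) a b 4 3 hT (by push_cast; linarith) (by push_cast; linarith)
      wb wT hab (by linarith) (by norm_num) with h | ⟨hbad, h⟩
    · push_cast at h; linarith
    · rw [pen_of hbad]
      push_cast at h; linarith
  · have h6 := H.cardge hj (v t) htop 4 (by push_cast; linarith)
    have := wcb (k := 4) ht (fun y hy => wb y (mem_bin.1 hy).1) (by linarith) h6
    have := wb t htS
    push_cast at *; linarith

/-- bins with top item above `2 v z`, when `1/2 < v xs` -/
theorem Core.FCh (H : Core S z v kk g N D) (H3 : ∀ p ∈ D, 3 ≤ #(bin S g p))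
    (hs1 : 2 / 11 < v z) (hs2 : v z ≤ 1 / 5) (I : Ist S z v kk N i xs be) (hx : 1 / 2 < v xs) (w : α → ℚ)
    {V T L G dB dL : ℚ} (hV0 : 0 ≤ V) (hVT : V ≤ T) (hTL : V ≤ L) (hL2 : 36 ≤ 2 * L + V)
    (hG2 : 36 ≤ G + 2 * V) (hGL : 36 ≤ G + L) (hB1 : 36 - dB ≤ 18 + L) (hB2 : 36 - dB ≤ 18 + 2 * V) (hdB : 0 ≤ dB)
    (hL3 : 36 - dL ≤ L + T + V) (hL4 : 36 ≤ L + 3 * V) (hdL : 0 ≤ dL)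
    (wb : ∀ y ∈ S, V ≤ w y) (wT : ∀ y ∈ S, (1 - v z) / 4 < v y → T ≤ w y)
    (wL : ∀ y ∈ S, 2 * v z < v y → L ≤ w y)
    (wB : ∀ y ∈ S, (1 - v z) / 2 < v y → 18 ≤ w y)
    (wG : ∀ y ∈ S, 1 / 2 < v y → G ≤ w y)
    (wH : ∀ j ∈ N, ∀ x y, Two S v kk j x y → v y ≤ 2 * v z → 36 ≤ w x + w y)
    {j : ℕ} (hj : j ∈ N) {t : α} (ht : t ∈ bin S kk j) (htop : ∀ y ∈ bin S kk j, v y ≤ v t) (htL : 2 * v z < v t) :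
    36 - (pen (Bad S v kk ((1 - v z) / 2) 2) dB j + pen (Bad S v kk (2 * v z) 2) dL j) ≤ ∑ y ∈ bin S kk j, w y := by
  have htS := (mem_bin.1 ht).1
  have hti := H.item_le H3 htS
  have hb' : ∀ {j}, ∀ y ∈ bin S kk j, V ≤ w y := fun y hy => wb y (mem_bin.1 hy).1
  have w0 : ∀ y ∈ S, 0 ≤ w y := fun y hy => by linarith [wb y hy]
  have p1 := pen_nonneg (Q := Bad S v kk ((1 - v z) / 2) 2) hdB j
  have p2 := pen_nonneg (Q := Bad S v kk (2 * v z) 2) hdL j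
  by_cases hG : 1 / 2 < v t
  · rcases H.split2 hj ht htop (by linarith) with ⟨y, hT, hyS, _⟩ | h3
    · rw [hT.sum]
      by_cases hy : v y ≤ 2 * v z
      · linarith [wH j hj _ _ hT hy]
      · linarith [wG t htS hG, wL y hyS (by linarith)]
    · have := wcb (k := 2) ht hb' hV0 h3
      have := wG t htS (by linarith)
      push_cast at *; linarith
  by_cases hB : (1 - v z) / 2 < v t
  · by_cases hbad : Bad S v kk ((1 - v z) / 2) 2 j
    · rw [pen_of hbad]
      rcases H.split2 hj ht htop (by linarith) with ⟨y, hT, hyS, _⟩ | h3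
      · rw [hT.sum]
        by_cases hy : v y ≤ 2 * v z
        · have := (I.two_small H H3 (by linarith) hj hT hy).2.2
          linarith
        · linarith [wB t htS hB, wL y hyS (by linarith)]
      · have := wcb (k := 2) ht hb' hV0 h3
        have := wB t htS (by linarith)
        push_cast at *; linarith
    · have := H.two_B hj ht htop hB (by linarith) w0 wB (by norm_num) hbad
      linarith
  have h6 := H.cardge hj (v t) htop 2 (by push_cast; linarith)
  by_cases hbad : Bad S v kk (2 * v z) 2 j
  · rw [pen_of hbad]
    have hwt := wL t htS htL
    rcases H.split3 hj ht htop h6 with h | ⟨x, y, -, -, hxS, hyS, hyx, hxt, hf, -, hsum⟩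
    · have := wcb (k := 3) ht hb' hV0 h
      push_cast at *; linarith
    · rw [hsum]
      linarith [wT x hxS (by linarith), wb y hyS]
  · have h2 := of_not_bad ht htop htL (by push_cast; linarith) hbad
    have := wc (k := 3) hb' (fun y hy => wL y (mem_bin.1 hy).1) hTL hV0 h2 h6 (by norm_num)
    push_cast at this; linarith

theorem Ist.small_top (I : Ist S z v kk N i xs be) (H : Core S z v kk g N D) (H3 : ∀ p ∈ D, 3 ≤ #(bin S g p))
    {j : ℕ} (hj : j ∈ N) {t : α} (ht : t ∈ bin S kk j) (htop : ∀ y ∈ bin S kk j, v y ≤ v t) (htx : v t < v xs)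
    (ht2 : v t ≤ 2 * v z) : v t ≤ v be := by
  rcases I.after H (I.after_of_top H hj htop htx) ht with h | h
  · exact h
  · have := H.item_le H3 I.xsS
    linarith

theorem Core.FC1 (H : Core S z v kk g N D) (H3 : ∀ p ∈ D, 3 ≤ #(bin S g p))
    (hs1 : 2 / 11 < v z) (hs2 : v z ≤ 1 / 5) (I : Ist S z v kk N i xs be) (hbe : v be ≤ 1 / 4) (w : α → ℚ)
    (wb : ∀ y ∈ S, 8 ≤ w y) (wT : ∀ y ∈ S, (1 - v z) / 4 < v y → 9 ≤ w y)
    (wL : ∀ y ∈ S, 2 * v z < v y → 17 ≤ w y)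
    (wB : ∀ y ∈ S, (1 - v z) / 2 < v y → 18 ≤ w y)
    (wG : ∀ y ∈ S, 1 / 2 < v y → 20 ≤ w y)
    (wH : ∀ j ∈ N, ∀ x y, Two S v kk j x y → v y ≤ 2 * v z → v be ≤ v y → 1 / 2 < v x → 36 ≤ w x + w y)
    (ho : ∀ p ∈ D, ∑ y ∈ bin S g p, w y ≤ 44) : False := by
  have hfull := I.full
  have hx : 1 / 2 < v xs := by linarith
  refine H.count44' w 7 (fun j => pen (Bad S v kk ((1 - v z) / 2) 2) 2 j + pen (Bad S v kk (2 * v z) 2) 2 j +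
    pen (Bad S v kk ((1 - v z) / 4) 4) 3 j) ?_ ?_ ho (by linarith [wb z H.zS])
  · intro j hj
    obtain ⟨t, ht, htop⟩ := H.top hj
    have p1 := pen_nonneg (Q := Bad S v kk ((1 - v z) / 2) 2) (δ := 2) (by norm_num) j
    have p2 := pen_nonneg (Q := Bad S v kk (2 * v z) 2) (δ := 2) (by norm_num) j
    have p3 := pen_nonneg (Q := Bad S v kk ((1 - v z) / 4) 4) (δ := 3) (by norm_num) j
    by_cases htL : 2 * v z < v t
    · have := H.FCh H3 hs1 hs2 I hx w (V := 8) (T := 9) (L := 17) (G := 20) (dB := 2) (dL := 2) (by norm_num)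
        (by norm_num) (by norm_num) (by norm_num) (by norm_num) (by norm_num) (by norm_num) (by norm_num) (by norm_num)
        (by norm_num) (by norm_num) (by norm_num) wb wT wL wB wG
        (fun j hj x y hT hy => by
          obtain ⟨h1, h2, h3⟩ := I.two_small H H3 (by linarith) hj hT hy
          exact wH j hj x y hT hy h2 (by linarith)) hj ht htop htL
      linarith
    · have := I.small_top H H3 hj ht htop (by linarith) (by linarith)
      have := H.FCt hs1 hs2 hj ht htop w (b := 8) (a := 9) (d := 3) (by norm_num)
        (by norm_num) (by norm_num) (by norm_num) (by norm_num) wb wT (by linarith)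
      linarith
  · simp only [sum_add_distrib]
    have := H.sum_pen_bad ((1 - v z) / 2) 2 (δ := 2) (by norm_num)
    have := H.sum_pen_bad (2 * v z) 2 (δ := 2) (by norm_num)
    have := H.sum_pen_bad ((1 - v z) / 4) 4 (δ := 3) (by norm_num)
    linarith

theorem Ist.Hv_xs (I : Ist S z v kk N i xs be) (H : Core S z v kk g N D) (H3 : ∀ p ∈ D, 3 ≤ #(bin S g p))
    (hs : 1 / 6 < v z) {x : α} (hx : v z < v x) (h : Hv S z v kk x) : v xs ≤ v x := by
  obtain ⟨y', hT, hy'⟩ := h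
  exact (I.two_small H H3 hs (H.kkN hT hx) hT hy').2.2

theorem Core.caseC1 (H : Core S z v kk g N D) (H3 : ∀ p ∈ D, 3 ≤ #(bin S g p))
    (hs1 : 2 / 11 < v z) (hs2 : v z ≤ 1 / 5) (I : Ist S z v kk N i xs be) (hbe : v be ≤ 1 / 4)
    (hbe2 : (1 - 3 * v z) / 2 < v be) : False := by
  classical
  have hfull := I.full
  obtain ⟨c, hc⟩ : ∃ c : α → ℕ, ∀ x, c x =
      if 1 / 2 < v x then (if Hv S z v kk x then 6 else 5)
      else if (1 - v z) / 2 < v x then 4 else if 2 * v z < v x then 3 else if v be ≤ v x then 2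
      else if (1 - v z) / 4 < v x then 1 else 0 :=
    ⟨_, fun _ => rfl⟩
  obtain ⟨W, hW⟩ : ∃ W : ℕ → ℕ, W = fun i => [8, 9, 10, 17, 18, 20, 26].getD i 0 := ⟨_, rfl⟩
  obtain ⟨w, hw⟩ : ∃ w : α → ℚ, ∀ x, w x = (W (c x) : ℚ) := ⟨_, fun _ => rfl⟩
  refine H.FC1 H3 hs1 hs2 I hbe w ?_ ?_ ?_ ?_ ?_ ?_ ?_
  · intro y _; rw [hw, hc, hW]; split_ifs <;> norm_num
  · intro y _ h; rw [hw, hc, hW]; split_ifs <;> norm_num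
  · intro y _ h; rw [hw, hc, hW]; split_ifs <;> norm_num
  · intro y _ h; rw [hw, hc, hW]; split_ifs <;> norm_num
  · intro y _ h; rw [hw, hc, hW, if_pos h]; split_ifs <;> norm_num
  · intro j hj x y hT hy hby hx
    have h1 : 26 ≤ w x := by rw [hw, hc, hW, if_pos hx, if_pos (Hv.of hT hy)]; norm_num
    have h2 : 10 ≤ w y := by rw [hw, hc, hW]; split_ifs <;> norm_num
    linarith
  · intro p hp
    have hcard := H.cardP hp 5 (by push_cast; linarith)
    have hk : ∀ x ∈ bin S g p, c x < 7 := by intro x hx; rw [hc]; split_ifs <;> norm_num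
    have := optW (bin S g p) v c 7 (fun i => [8, 9, 10, 16, 18, 22, 22].getD i 0)
      (fun i => [2, 2, 2, 4, 4, 5, 5].getD i 0) 43 9 (2/11) (1/5) (v z)
      W 44 (hvb 6 2 7) (by rw [hW]; decide +kernel) (by rw [hW]; decide +kernel)
      hk (H.opt p hp) (by omega) hs1 hs2
      (by intro x hx; rw [hc]; have := H.vmin x (mem_bin.1 hx).1
          split_ifs <;> norm_num <;> linarith)
      (by intro x hx; rw [hc]
          split_ifs <;> norm_num <;> linarith) (by rw [hW]; simp; omega)
      (by
        apply hvb_of _ (by norm_num)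
        intro x hx hcx y hy hyx
        have hH : 1 / 2 < v x ∧ Hv S z v kk x := by
          rw [hc] at hcx
          split_ifs at hcx with h1 h2 <;> first | exact ⟨h1, h2⟩ | omega
        have := I.opt_lt H H3 hp hx hy hyx (I.Hv_xs H H3 (by linarith) (by linarith [hH.1]) hH.2)
        rw [hc]; split_ifs <;> first | linarith | norm_num)
    simp only [hw]
    exact_mod_cast this

theorem Core.caseC1' (H : Core S z v kk g N D) (H3 : ∀ p ∈ D, 3 ≤ #(bin S g p))
    (hs1 : 2 / 11 < v z) (hs2 : v z ≤ 1 / 5) (I : Ist S z v kk N i xs be) (hbe : v be ≤ 1 / 4)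
    (hbe2 : v be ≤ (1 - 3 * v z) / 2) : False := by
  classical
  have hfull := I.full
  obtain ⟨c, hc⟩ : ∃ c : α → ℕ, ∀ x, c x =
      if 1 / 2 < v x then (if Hv S z v kk x then
        (if ∃ y, Two S v kk (kk x) x y ∧ v y ≤ (1 - v z) / 4 then 6 else 5) else 4)
      else if (1 - v z) / 2 < v x then 3 else if 2 * v z < v x then 2
      else if (1 - v z) / 4 < v x then 1 else 0 :=
    ⟨_, fun _ => rfl⟩
  obtain ⟨W, hW⟩ : ∃ W : ℕ → ℕ, W = fun i => [8, 9, 17, 18, 20, 27, 28].getD i 0 := ⟨_, rfl⟩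
  obtain ⟨w, hw⟩ : ∃ w : α → ℚ, ∀ x, w x = (W (c x) : ℚ) := ⟨_, fun _ => rfl⟩
  refine H.FC1 H3 hs1 hs2 I hbe w ?_ ?_ ?_ ?_ ?_ ?_ ?_
  · intro y _; rw [hw, hc, hW]; split_ifs <;> norm_num
  · intro y _ h; rw [hw, hc, hW]; split_ifs <;> norm_num
  · intro y _ h; rw [hw, hc, hW]; split_ifs <;> norm_num
  · intro y _ h; rw [hw, hc, hW]; split_ifs <;> norm_num
  · intro y _ h; rw [hw, hc, hW, if_pos h]; split_ifs <;> norm_num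
  · intro j hj x y hT hy hby hx
    by_cases hyV : v y ≤ (1 - v z) / 4
    · have h1 : 28 ≤ w x := by
        rw [hw, hc, hW, if_pos hx, if_pos (Hv.of hT hy), if_pos]
        · norm_num
        · exact ⟨y, by rw [(mem_bin.1 hT.memx).2]; exact hT, hyV⟩
      have h2 : 8 ≤ w y := by rw [hw, hc, hW]; split_ifs <;> norm_num
      linarith
    · have h1 : 27 ≤ w x := by
        rw [hw, hc, hW, if_pos hx, if_pos (Hv.of hT hy)]
        split_ifs <;> norm_num
      have h2 : 9 ≤ w y := by rw [hw, hc, hW]; split_ifs <;> norm_num <;> linarith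
      linarith
  · intro p hp
    have hcard := H.cardP hp 5 (by push_cast; linarith)
    have hk : ∀ x ∈ bin S g p, c x < 7 := by intro x hx; rw [hc]; split_ifs <;> norm_num
    have hx5 : ∀ x ∈ bin S g p, c x = 5 → v xs ≤ v x := by
      intro x hx hcx
      have hH : 1 / 2 < v x ∧ Hv S z v kk x := by
        rw [hc] at hcx
        split_ifs at hcx with h1 h2 <;> first | exact ⟨h1, h2⟩ | omega
      exact I.Hv_xs H H3 (by linarith) (by linarith [hH.1]) hH.2
    have := optW (bin S g p) v c 7 (fun i => [8, 9, 16, 18, 22, 22, 22].getD i 0)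
      (fun i => [2, 2, 4, 4, 5, 5, 5].getD i 0) 43 9 (2/11) (1/5) (v z)
      W 44 (fun n => hvb 6 1 7 n && hvb 5 2 7 n && (n 5 == 0 || decide (0 < n 0)))
      (by rw [hW]; decide +kernel) (by rw [hW]; decide +kernel)
      hk (H.opt p hp) (by omega) hs1 hs2
      (by intro x hx; rw [hc]; have := H.vmin x (mem_bin.1 hx).1
          split_ifs <;> norm_num <;> linarith)
      (by intro x hx; rw [hc]
          split_ifs <;> norm_num <;> linarith) (by rw [hW]; simp; omega)
      (by
        rw [Bool.and_eq_true, Bool.and_eq_true]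
        refine ⟨⟨?_, ?_⟩, ?_⟩
        · apply hvb_of _ (by norm_num)
          intro x hx hcx y hy hyx
          have hH : 1 / 2 < v x ∧ ∃ y, Two S v kk (kk x) x y ∧ v y ≤ (1 - v z) / 4 := by
            rw [hc] at hcx
            split_ifs at hcx with h1 h2 h3 <;> first | exact ⟨h1, h3⟩ | omega
          obtain ⟨hx2, u, hT, hu⟩ := hH
          obtain ⟨-, h2, h3⟩ := I.two_small H H3 (by linarith) (H.kkN hT (by linarith)) hT (by linarith)
          have := I.opt_lt H H3 hp hx hy hyx h3
          rw [hc]; split_ifs <;> first | linarith | norm_num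
        · apply hvb_of _ (by norm_num)
          intro x hx hcx y hy hyx
          have := I.opt_lt H H3 hp hx hy hyx (hx5 x hx hcx)
          rw [hc]; split_ifs <;> first | linarith | norm_num
        · rw [Bool.or_eq_true, decide_eq_true_eq, beq_iff_eq]
          by_contra hcon
          push Not at hcon
          obtain ⟨x, hx, hcx⟩ := cnt_pos (Nat.pos_of_ne_zero hcon.1)
          obtain ⟨y, hy, u, hu, hyx, hux, hsum⟩ := H.others H3 hp hx
          have hV : ∀ y ∈ bin S g p, y ≠ x → (1 - v z) / 4 < v y := by
            intro y hy hyx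
            by_contra hyV
            have h0 : c y = 0 := by
              rw [hc, if_neg (by linarith), if_neg (by linarith), if_neg (by linarith), if_neg hyV]
            have : 0 < cnt (bin S g p) c 0 := card_pos.2 ⟨y, mem_filter.2 ⟨hy, h0⟩⟩
            omega
          linarith [hV y hy hyx, hV u hu hux, hx5 x hx hcx])
    simp only [hw]
    exact_mod_cast this

end
end HF


namespace HF
section
variable {S : Finset α} {z : α} {v : α → ℚ} {kk g : α → ℕ} {N D : Finset ℕ}
variable {i : ℕ} {xs be : α}

theorem Core.caseC2 (H : Core S z v kk g N D) (H3 : ∀ p ∈ D, 3 ≤ #(bin S g p))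
    (hs1 : 2 / 11 < v z) (hs2 : v z ≤ 1 / 5) (I : Ist S z v kk N i xs be) (hbe : 1 / 4 < v be)
    (hbe2 : v be ≤ (1 - v z) / 3) : False := by
  classical
  have hfull := I.full
  have hx : 1 / 2 < v xs := by linarith
  obtain ⟨c, hc⟩ : ∃ c : α → ℕ, ∀ x, c x =
      if 1 / 2 < v x then (if Hv S z v kk x then 7 else 6)
      else if (1 - v z) / 2 < v x then 5 else if 2 * v z < v x then 4 else if v be ≤ v x then 3
      else if 1 / 4 < v x then 2 else if (1 - v z) / 4 < v x then 1 else 0 :=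
    ⟨_, fun _ => rfl⟩
  obtain ⟨W, hW⟩ : ∃ W : ℕ → ℕ, W = fun i => [42, 45, 46, 51, 84, 90, 96, 129].getD i 0 := ⟨_, rfl⟩
  obtain ⟨w, hw⟩ : ∃ w : α → ℚ, ∀ x, w x = (W (c x) : ℚ) / 5 := ⟨_, fun _ => rfl⟩
  have wb : ∀ y ∈ S, 42 / 5 ≤ w y := by
    intro y _; rw [hw, hc, hW]; split_ifs <;> norm_num
  have wT : ∀ y ∈ S, (1 - v z) / 4 < v y → 9 ≤ w y := by
    intro y _ h; rw [hw, hc, hW]; split_ifs <;> norm_num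
  have wS : ∀ y ∈ S, 1 / 4 < v y → 46 / 5 ≤ w y := by
    intro y _ h; rw [hw, hc, hW]; split_ifs <;> norm_num
  have wP : ∀ y ∈ S, v be ≤ v y → 51 / 5 ≤ w y := by
    intro y _ h; rw [hw, hc, hW]; split_ifs <;> norm_num
  have wL : ∀ y ∈ S, 2 * v z < v y → 84 / 5 ≤ w y := by
    intro y _ h; rw [hw, hc, hW]; split_ifs <;> norm_num <;> linarith
  have wB : ∀ y ∈ S, (1 - v z) / 2 < v y → 18 ≤ w y := by
    intro y _ h; rw [hw, hc, hW]; split_ifs <;> norm_num <;> linarith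
  have wG : ∀ y ∈ S, 1 / 2 < v y → 96 / 5 ≤ w y := by
    intro y _ h; rw [hw, hc, hW, if_pos h]; split_ifs <;> norm_num <;> linarith
  have wH : ∀ j ∈ N, ∀ x y, Two S v kk j x y → v y ≤ 2 * v z → 36 ≤ w x + w y := by
    intro j hj x y hT hy
    obtain ⟨h1, h2, h3⟩ := I.two_small H H3 (by linarith) hj hT hy
    have h1 : 129 / 5 ≤ w x := by rw [hw, hc, hW, if_pos (by linarith), if_pos (Hv.of hT hy)]; norm_num
    linarith [wP y (mem_bin.1 hT.memy).1 h2]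
  refine H.count44' w (32/5) (fun j => pen (Bad S v kk ((1 - v z) / 2) 2) (6/5) j + pen (Bad S v kk (2 * v z) 2) (9/5) j +
    pen (Bad S v kk (1 / 4) 3) (8/5) j + pen (Bad S v kk ((1 - v z) / 4) 4) (9/5) j) ?_ ?_ ?_ (by linarith [wb z H.zS])
  · intro j hj
    obtain ⟨t, ht, htop⟩ := H.top hj
    have p1 := pen_nonneg (Q := Bad S v kk ((1 - v z) / 2) 2) (δ := 6/5) (by norm_num) j
    have p2 := pen_nonneg (Q := Bad S v kk (2 * v z) 2) (δ := 9/5) (by norm_num) j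
    have p4 := pen_nonneg (Q := Bad S v kk (1/4) 3) (δ := 8/5) (by norm_num) j
    have p3 := pen_nonneg (Q := Bad S v kk ((1 - v z) / 4) 4) (δ := 9/5) (by norm_num) j
    by_cases htL : 2 * v z < v t
    · have := H.FCh H3 hs1 hs2 I hx w (V := 42/5) (T := 9) (L := 84/5) (G := 96/5) (dB := 6/5) (dL := 9/5) (by norm_num)
        (by norm_num) (by norm_num) (by norm_num) (by norm_num) (by norm_num) (by norm_num) (by norm_num) (by norm_num)
        (by norm_num) (by norm_num) (by norm_num) wb wT wL wB wG wH hj ht htop htL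
      linarith
    have := I.small_top H H3 hj ht htop (by linarith) (by linarith)
    by_cases hS : 1 / 4 < v t
    · rcases H.cls hj ht htop w (1 / 4) (46 / 5) (42/5) 3 3 hS (by push_cast; linarith) (by push_cast; linarith)
        wb wS (by norm_num) (by norm_num) (by norm_num) with h | ⟨hbad, h⟩
      · push_cast at h; linarith
      · rw [pen_of hbad]
        push_cast at h; linarith
    · have := H.FCt hs1 hs2 hj ht htop w (b := 42/5) (a := 9) (d := 9/5) (by norm_num)
        (by norm_num) (by norm_num) (by norm_num) (by norm_num) wb wT (by linarith)
      linarith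
  · simp only [sum_add_distrib]
    have := H.sum_pen_bad ((1 - v z) / 2) 2 (δ := 6/5) (by norm_num)
    have := H.sum_pen_bad (2 * v z) 2 (δ := 9/5) (by norm_num)
    have := H.sum_pen_bad (1/4) 3 (δ := 8/5) (by norm_num)
    have := H.sum_pen_bad ((1 - v z) / 4) 4 (δ := 9/5) (by norm_num)
    linarith
  · intro p hp
    have hcard := H.cardP hp 5 (by push_cast; linarith)
    have hk : ∀ x ∈ bin S g p, c x < 8 := by intro x hx; rw [hc]; split_ifs <;> norm_num
    have := optW (bin S g p) v c 8 (fun i => [8, 9, 11, 11, 16, 18, 22, 22].getD i 0)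
      (fun i => [4, 4, 5, 5, 8, 8, 10, 10].getD i 0) 43 19 (2/11) (1/5) (v z)
      W 220 (hvb 7 3 8) (by rw [hW]; decide +kernel) (by rw [hW]; decide +kernel)
      hk (H.opt p hp) (by omega) hs1 hs2
      (by intro x hx; rw [hc]; have := H.vmin x (mem_bin.1 hx).1
          split_ifs <;> norm_num <;> linarith)
      (by intro x hx; rw [hc]
          split_ifs <;> norm_num <;> linarith) (by rw [hW]; simp; omega)
      (by
        apply hvb_of _ (by norm_num)
        intro x hx hcx y hy hyx
        have hH : 1 / 2 < v x ∧ Hv S z v kk x := by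
          rw [hc] at hcx
          split_ifs at hcx with h1 h2 <;> first | exact ⟨h1, h2⟩ | omega
        have := I.opt_lt H H3 hp hx hy hyx (I.Hv_xs H H3 (by linarith) (by linarith [hH.1]) hH.2)
        rw [hc]; split_ifs <;> first | linarith | norm_num)
    simp only [hw]
    rw [← Finset.sum_div]
    push_cast at this
    linarith

end
end HF


namespace HF
section
variable {S : Finset α} {z : α} {v : α → ℚ} {kk g : α → ℕ} {N D : Finset ℕ}
variable {i : ℕ} {xs be : α}

/-- bins with top item above `2 v z`, when `(1 - v z)/3 < v be` -/
theorem Core.FC3h (H : Core S z v kk g N D) (H3 : ∀ p ∈ D, 3 ≤ #(bin S g p))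
    (hs1 : 2 / 11 < v z) (hs2 : v z ≤ 1 / 5) (w : α → ℚ)
    {dL : ℚ} (hdL : 0 ≤ dL)
    (hL : 5 / 3 ≤ dL ∨ ∃ j0 ∈ N, ∃ u ∈ bin S kk j0, (∀ y ∈ bin S kk j0, 3 * v y ≤ 1) ∧ ∀ y ∈ S, v u ≤ v y → 12 ≤ w y)
    (wb : ∀ y ∈ S, 17 / 2 ≤ w y) (wT : ∀ y ∈ S, (1 - v z) / 4 < v y → 53 / 6 ≤ w y)
    (wL : ∀ y ∈ S, 2 * v z < v y → 17 ≤ w y)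
    (wB : ∀ y ∈ S, (1 - v z) / 2 < v y → 18 ≤ w y)
    (wG : ∀ y ∈ S, 1 / 2 < v y → 19 ≤ w y)
    (wH1 : ∀ j ∈ N, ∀ x y, Two S v kk j x y → v y ≤ 2 * v z → 35 ≤ w x + w y)
    (wH2 : ∀ j ∈ N, ∀ x y, Two S v kk j x y → v y ≤ 2 * v z → 1 / 2 < v x → 36 ≤ w x + w y)
    {j : ℕ} (hj : j ∈ N) {t : α} (ht : t ∈ bin S kk j) (htop : ∀ y ∈ bin S kk j, v y ≤ v t) (htL : 2 * v z < v t) :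
    36 - (pen (Bad S v kk ((1 - v z) / 2) 2) 1 j + pen (Bad S v kk (2 * v z) 2) dL j) ≤ ∑ y ∈ bin S kk j, w y := by
  have htS := (mem_bin.1 ht).1
  have hti := H.item_le H3 htS
  have hb' : ∀ {j}, ∀ y ∈ bin S kk j, 17 / 2 ≤ w y := fun y hy => wb y (mem_bin.1 hy).1
  have w0 : ∀ y ∈ S, 0 ≤ w y := fun y hy => by linarith [wb y hy]
  have p1 := pen_nonneg (Q := Bad S v kk ((1 - v z) / 2) 2) (δ := 1) (by norm_num) j
  have p2 := pen_nonneg (Q := Bad S v kk (2 * v z) 2) hdL j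
  by_cases hG : 1 / 2 < v t
  · rcases H.split2 hj ht htop (by linarith) with ⟨y, hT, hyS, _⟩ | h3
    · rw [hT.sum]
      by_cases hy : v y ≤ 2 * v z
      · linarith [wH2 j hj _ _ hT hy hG]
      · linarith [wG t htS hG, wL y hyS (by linarith)]
    · have := wcb (k := 2) ht hb' (by norm_num) h3
      have := wG t htS (by linarith)
      push_cast at *; linarith
  by_cases hB : (1 - v z) / 2 < v t
  · by_cases hbad : Bad S v kk ((1 - v z) / 2) 2 j
    · rw [pen_of hbad]
      rcases H.split2 hj ht htop (by linarith) with ⟨y, hT, hyS, _⟩ | h3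
      · rw [hT.sum]
        by_cases hy : v y ≤ 2 * v z
        · linarith [wH1 j hj _ _ hT hy]
        · linarith [wB t htS hB, wL y hyS (by linarith)]
      · have := wcb (k := 2) ht hb' (by norm_num) h3
        have := wB t htS (by linarith)
        push_cast at *; linarith
    · have := H.two_B hj ht htop hB (by linarith) w0 wB (by norm_num) hbad
      linarith
  have h6 := H.cardge hj (v t) htop 2 (by push_cast; linarith)
  by_cases hbad : Bad S v kk (2 * v z) 2 j
  · rw [pen_of hbad]
    have hwt := wL t htS htL
    rcases hL with hL | ⟨j0, hj0, u, hu, hu3, huw⟩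
    · rcases H.split3 hj ht htop h6 with h | ⟨x, y, -, -, hxS, hyS, hyx, hxt, hf, -, hsum⟩
      · have := wcb (k := 3) ht hb' (by norm_num) h
        push_cast at *; linarith
      · rw [hsum]
        linarith [wT x hxS (by linarith), wb y hyS]
    · have hlt : j < j0 := H.lt_of_top hj0 ht (fun y hy => by linarith [hu3 y hy])
      have h5 := H.U hj (mem_bin.1 hu).1 ((mem_bin.1 hu).2.symm ▸ hlt) (v t) htop 1 (by push_cast; linarith [hu3 u hu])
      have hc : #((bin S kk j).filter (fun y => v u ≤ v y)) ≤ #((bin S kk j).filter (fun y => (1/2 : ℚ) < if v u ≤ v y then 1 else 0)) := by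
        apply card_le_card
        intro y hy
        rw [mem_filter] at hy ⊢
        refine ⟨hy.1, ?_⟩
        rw [if_pos hy.2]; norm_num
      have := wct (v := fun y => if v u ≤ v y then 1 else 0) (θ := 1/2) (r := 1) (k := 2) (a := 12) ht hb' (fun y hy h => by
        apply huw y (mem_bin.1 hy).1
        by_contra hcon
        simp only [if_neg hcon] at h
        norm_num at h) (by norm_num) (by norm_num) (h5.trans_le hc) h6 (by norm_num)
      push_cast at *; linarith
  · have h2 := of_not_bad ht htop htL (by push_cast; linarith) hbad
    have := wc (k := 3) hb' (fun y hy => wL y (mem_bin.1 hy).1) (by norm_num) (by norm_num) h2 h6 (by norm_num)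
    push_cast at this; linarith

/-- the bin of `m` consists of exactly `m, x, y` and is not a multi-`M` bin -/
structure Mb (S : Finset α) (z : α) (v : α → ℚ) (kk : α → ℕ) (N : Finset ℕ) (jm : ℕ) (m x y : α) : Prop where
  jN : jm ∈ N
  hX : bin S kk jm = {m, x, y}
  sum : ∀ f : α → ℚ, ∑ u ∈ bin S kk jm, f u = f m + f x + f y
  mS : m ∈ S
  mkj : kk m = jm
  xS : x ∈ S
  yS : y ∈ S
  m3 : v m ≤ 1 / 3
  m1 : (1 - v z) / 3 < v m
  yx : v y ≤ v x
  x3 : v x ≤ (1 - v z) / 3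
  full : 1 < v z + v m + v x + v y

theorem Mb.before {jm : ℕ} {m x y : α} (B : Mb S z v kk N jm m x y) (H : Core S z v kk g N D)
    {j : ℕ} (hj : j ∈ N) {t : α} (htop : ∀ y ∈ bin S kk j, v y ≤ v t) (ht3 : v t ≤ 1 / 3) (h : j < jm)
    {w : α → ℚ} (w0 : ∀ y ∈ S, 0 ≤ w y) (wM : ∀ y ∈ S, v m ≤ v y → 12 ≤ w y) : 36 ≤ ∑ y ∈ bin S kk j, w y := by
  have h5 := H.U hj B.mS (B.mkj.symm ▸ h) (v t) htop 2 (by push_cast; linarith [B.m3])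
  have := wcle (r := 3) (k := 3) (fun y hy => w0 y (mem_bin.1 hy).1) (fun y hy => wM y (mem_bin.1 hy).1) (by norm_num) (by norm_num) h5
    (le_trans h5 (card_le_card (filter_subset _ _))) le_rfl
  push_cast at this; linarith

theorem Mb.le_be {jm : ℕ} {m x y : α} (B : Mb S z v kk N jm m x y) (H : Core S z v kk g N D)
    (H3 : ∀ p ∈ D, 3 ≤ #(bin S g p))
    (hs1 : 2 / 11 < v z) (hs2 : v z ≤ 1 / 5) (I : Ist S z v kk N i xs be) : v m ≤ v be := by
  have := I.full
  have := I.hbe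
  have := B.m3
  refine I.small_top H H3 B.jN (mem_bin.2 ⟨B.mS, B.mkj⟩) ?_ (by linarith) (by linarith)
  intro u hu
  rw [B.hX] at hu; simp at hu
  rcases hu with rfl | rfl | rfl
  · exact le_rfl
  · linarith [B.m1, B.x3]
  · linarith [B.m1, B.x3, B.yx]

/-- later bins have top at most `x` -/
theorem Mb.after_x {jm : ℕ} {m x y : α} (B : Mb S z v kk N jm m x y) (H : Core S z v kk g N D)
    {j : ℕ} {t : α} (ht : t ∈ bin S kk j) (ht3 : v t ≤ 1 / 3) (h : jm < j) : v t ≤ v x := by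
  by_contra hc
  push Not at hc
  have h1 := H.ff t (mem_bin.1 ht).1 jm B.jN ((mem_bin.1 ht).2.symm ▸ h)
  have h2 : ∑ u ∈ (bin S kk jm).filter (fun u => v t ≤ v u), v u ≤ v m := by
    have : (bin S kk jm).filter (fun u => v t ≤ v u) ⊆ {m} := by
      intro a ha
      rw [mem_filter, B.hX] at ha
      simp at ha ⊢
      rcases ha.1 with h | h | h
      · exact h
      · subst h; linarith [ha.2]
      · subst h; linarith [ha.2, B.yx]
    refine le_trans (sum_le_sum_of_subset_of_nonneg this ?_) (by simp)
    intro a ha _; simp at ha; subst ha; exact (H.vpos B.mS).le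
  linarith [B.m3]

/-- later bins have top at most `y` -/
theorem Mb.after_y {jm : ℕ} {m x y : α} (B : Mb S z v kk N jm m x y) (H : Core S z v kk g N D)
    {j : ℕ} {t : α} (ht : t ∈ bin S kk j) (ht3 : v t ≤ 1 / 3) (h : jm < j) : v t ≤ v y := by
  by_contra hc
  push Not at hc
  have hx := B.after_x H ht ht3 h
  have h1 := H.ff t (mem_bin.1 ht).1 jm B.jN ((mem_bin.1 ht).2.symm ▸ h)
  have h2 : ∑ u ∈ (bin S kk jm).filter (fun u => v t ≤ v u), v u ≤ v m + v x := by
    have : (bin S kk jm).filter (fun u => v t ≤ v u) ⊆ (bin S kk jm).erase y := by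
      intro a ha
      rw [mem_filter] at ha
      rw [mem_erase]
      refine ⟨?_, ha.1⟩
      rintro rfl; linarith [ha.2]
    have h3 := sum_le_sum_of_subset_of_nonneg (f := v) this (fun a ha _ => (H.vpos (mem_bin.1 (mem_of_mem_erase ha)).1).le)
    have h4 := B.sum v
    have hy : y ∈ bin S kk jm := by rw [B.hX]; simp
    rw [← Finset.add_sum_erase _ _ hy] at h4
    linarith
  linarith [B.m3, B.x3, H.pos]

set_option maxHeartbeats 1000000 in
theorem Core.caseC3b (H : Core S z v kk g N D) (H3 : ∀ p ∈ D, 3 ≤ #(bin S g p))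
    (hs1 : 2 / 11 < v z) (hs2 : v z ≤ 1 / 5) (I : Ist S z v kk N i xs be)
    {jm : ℕ} {m x y : α} (B : Mb S z v kk N jm m x y) (hx4 : v x ≤ 1 / 4) : False := by
  classical
  have hfull := I.full
  have hb3 := I.hbe
  have hmb := B.le_be H H3 hs1 hs2 I
  have hm1 : 1 / 2 - v z < v m := by linarith [B.full, B.yx]
  have hm3 := B.m3
  obtain ⟨c, hc⟩ : ∃ c : α → ℕ, ∀ x, c x =
      if 1 / 2 < v x then (if Hv S z v kk x then 8 else 6)
      else if (1 - v z) / 2 < v x then (if Hv S z v kk x then 7 else 5) else if 2 * v z < v x then 4 else if v be ≤ v x then 3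
      else if 1 / 2 - v z < v x then 2 else if (1 - v z) / 4 < v x then 1 else 0 :=
    ⟨_, fun _ => rfl⟩
  obtain ⟨W, hW⟩ : ∃ W : ℕ → ℕ, W = fun i => [17, 18, 27, 29, 34, 36, 38, 43, 43].getD i 0 := ⟨_, rfl⟩
  obtain ⟨w, hw⟩ : ∃ w : α → ℚ, ∀ x, w x = (W (c x) : ℚ) / 2 := ⟨_, fun _ => rfl⟩
  have wb : ∀ y ∈ S, 17 / 2 ≤ w y := by
    intro y _; rw [hw, hc, hW]; split_ifs <;> norm_num
  have wT : ∀ y ∈ S, (1 - v z) / 4 < v y → 9 ≤ w y := by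
    intro y _ h; rw [hw, hc, hW]; split_ifs <;> norm_num
  have wM : ∀ y ∈ S, 1 / 2 - v z < v y → 27 / 2 ≤ w y := by
    intro y _ h; rw [hw, hc, hW]; split_ifs <;> norm_num
  have wP : ∀ y ∈ S, v be ≤ v y → 29 / 2 ≤ w y := by
    intro y _ h; rw [hw, hc, hW]; split_ifs <;> norm_num
  have wL : ∀ y ∈ S, 2 * v z < v y → 17 ≤ w y := by
    intro y _ h; rw [hw, hc, hW]; split_ifs <;> norm_num <;> linarith
  have wB : ∀ y ∈ S, (1 - v z) / 2 < v y → 18 ≤ w y := by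
    intro y _ h; rw [hw, hc, hW]; split_ifs <;> norm_num <;> linarith
  have wG : ∀ y ∈ S, 1 / 2 < v y → 19 ≤ w y := by
    intro y _ h; rw [hw, hc, hW, if_pos h]; split_ifs <;> norm_num <;> linarith
  have wH : ∀ j ∈ N, ∀ x y, Two S v kk j x y → v y ≤ 2 * v z → 36 ≤ w x + w y := by
    intro j hj x y hT hy
    obtain ⟨h1, h2, h3⟩ := I.two_small H H3 (by linarith) hj hT hy
    have h1 : 43 / 2 ≤ w x := by
      rw [hw, hc, hW]; simp only [if_pos (Hv.of hT hy)]
      split_ifs <;> norm_num <;> linarith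
    linarith [wP y (mem_bin.1 hT.memy).1 h2]
  refine H.count44' w 8 (fun j => pen (Bad S v kk ((1 - v z) / 2) 2) 1 j + pen (Bad S v kk (2 * v z) 2) 0 j +
    pen (fun j => j = jm) (11/2) j + pen (Bad S v kk ((1 - v z) / 4) 4) (3/2) j) ?_ ?_ ?_ (by linarith [wb z H.zS])
  · intro j hj
    obtain ⟨t, ht, htop⟩ := H.top hj
    have p1 := pen_nonneg (Q := Bad S v kk ((1 - v z) / 2) 2) (δ := 1) (by norm_num) j
    have p2 := pen_nonneg (Q := Bad S v kk (2 * v z) 2) (δ := 0) (by norm_num) j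
    have p4 := pen_nonneg (Q := fun j => j = jm) (δ := 11/2) (by norm_num) j
    have p3 := pen_nonneg (Q := Bad S v kk ((1 - v z) / 4) 4) (δ := 3/2) (by norm_num) j
    by_cases htL : 2 * v z < v t
    · have := H.FC3h H3 hs1 hs2 w (dL := 0) le_rfl
        (Or.inr ⟨jm, B.jN, m, mem_bin.2 ⟨B.mS, B.mkj⟩, fun u hu => by
          rw [B.hX] at hu; simp at hu
          rcases hu with rfl | rfl | rfl
          · linarith
          · linarith
          · linarith [B.yx], fun u hu h => by linarith [wM u hu (by linarith)]⟩)
        wb (fun y hy h => by linarith [wT y hy h]) wL wB wG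
        (fun j hj x y hT hy => by linarith [wH j hj x y hT hy]) (fun j hj x y hT hy _ => wH j hj x y hT hy) hj ht htop htL
      linarith
    have htb := I.small_top H H3 hj ht htop (by linarith) (by linarith)
    by_cases hS : 1 / 4 < v t
    · rcases lt_trichotomy j jm with hl | he | hl
      · have := B.before H hj htop (by linarith) hl (w := w) (fun y hy => by linarith [wb y hy])
          (fun y hy h => by linarith [wM y hy (by linarith)])
        linarith
      · rw [pen_of (Q := fun j => j = jm) he]
        have := B.sum w
        rw [he] at p1 p2 p3 ⊢
        rw [this]
        linarith [wM m B.mS hm1, wb x B.xS, wb y B.yS]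
      · linarith [B.after_x H ht (by linarith) hl]
    · have := H.FCt hs1 hs2 hj ht htop w (b := 17/2) (a := 9) (d := 3/2) (by norm_num)
        (by norm_num) (by norm_num) (by norm_num) (by norm_num) wb wT (by linarith)
      linarith
  · simp only [sum_add_distrib]
    have := H.sum_pen_bad ((1 - v z) / 2) 2 (δ := 1) (by norm_num)
    have := H.sum_pen_bad (2 * v z) 2 (δ := 0) (by norm_num)
    have := sum_pen N (Q := fun j => j = jm) (δ := 11/2) (by norm_num) (fun _ _ _ _ h h' => h.trans h'.symm)
    have := H.sum_pen_bad ((1 - v z) / 4) 4 (δ := 3/2) (by norm_num)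
    linarith
  · intro p hp
    have hcard := H.cardP hp 5 (by push_cast; linarith)
    have hk : ∀ x ∈ bin S g p, c x < 9 := by intro x hx; rw [hc]; split_ifs <;> norm_num
    have hvv : ∀ x ∈ bin S g p, v z < v x → Hv S z v kk x → ∀ y ∈ bin S g p, y ≠ x → c y < 3 := by
      intro x hx h3 hH y hy hyx
      have := I.opt_lt H H3 hp hx hy hyx (I.Hv_xs H H3 (by linarith) h3 hH)
      rw [hc]; split_ifs <;> first | linarith | norm_num
    have := optW (bin S g p) v c 9 (fun i => [24, 27, 42, 42, 48, 54, 66, 64, 66].getD i 0)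
      (fun i => [6, 6, 9, 9, 12, 12, 15, 14, 15].getD i 0) 131 29 (2/11) (1/5) (v z)
      W 88 (fun n => hvb 7 3 9 n && hvb 8 3 9 n) (by rw [hW]; decide +kernel) (by rw [hW]; decide +kernel)
      hk (H.opt p hp) (by omega) hs1 hs2
      (by intro x hx; rw [hc]; have := H.vmin x (mem_bin.1 hx).1
          split_ifs with h1 h2 h3 h4 <;> norm_num <;> first | linarith | linarith [I.Hv_xs H H3 (by linarith) (by linarith) h4])
      (by intro x hx; rw [hc]
          split_ifs with h1 h2 h3 h4 <;> norm_num <;> first | linarith | linarith [I.Hv_xs H H3 (by linarith) (by linarith) h4]) (by rw [hW]; simp; omega)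
      (by
        rw [Bool.and_eq_true]
        constructor
        · apply hvb_of _ (by norm_num)
          intro x hx hcx
          have hH : (1 - v z) / 2 < v x ∧ Hv S z v kk x := by
            rw [hc] at hcx
            split_ifs at hcx with h1 h2 h3 h4 <;> first | omega | exact ⟨h3, h4⟩
          exact hvv x hx (by linarith [hH.1]) hH.2
        · apply hvb_of _ (by norm_num)
          intro x hx hcx
          have hH : 1 / 2 < v x ∧ Hv S z v kk x := by
            rw [hc] at hcx
            split_ifs at hcx with h1 h2 h3 h4 <;> first | omega | exact ⟨h1, h2⟩
          exact hvv x hx (by linarith [hH.1]) hH.2)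
    simp only [hw]
    rw [← Finset.sum_div]
    push_cast at this
    linarith

end
end HF


namespace HF

theorem two_cls {P : Finset α} {c : α → ℕ} {i j : ℕ} (hij : i ≠ j) (h : 2 ≤ cnt P c i + cnt P c j) :
    ∃ x ∈ P, ∃ y ∈ P, x ≠ y ∧ (c x = i ∨ c x = j) ∧ (c y = i ∨ c y = j) := by
  unfold cnt at h
  rw [← card_union_of_disjoint] at h
  · obtain ⟨x, hx, y, hy, hxy⟩ := one_lt_card.1 (show 1 < _ from h)
    simp only [mem_union, mem_filter] at hx hy
    refine ⟨x, ?_, y, ?_, hxy, ?_, ?_⟩ <;> tauto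
  · rw [disjoint_filter]
    intro x _ h1 h2
    exact hij (h1.symm.trans h2)

theorem four_le {P : Finset α} {v : α → ℚ} (h0 : ∀ x ∈ P, 0 ≤ v x) {a b c d : α} (ha : a ∈ P) (hb : b ∈ P) (hc : c ∈ P)
    (hd : d ∈ P) (hab : a ≠ b) (hac : a ≠ c) (had : a ≠ d) (hbc : b ≠ c) (hbd : b ≠ d) (hcd : c ≠ d) :
    v a + v b + v c + v d ≤ ∑ x ∈ P, v x := by
  have h : ({a, b, c, d} : Finset α) ⊆ P := by
    intro x hx; simp at hx; rcases hx with rfl | rfl | rfl | rfl <;> assumption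
  have h1 := sum_le_sum_of_subset_of_nonneg (f := v) h (fun x hx _ => h0 x hx)
  rw [sum_insert (by simp [hab, hac, had]), sum_insert (by simp [hbc, hbd]), sum_pair hcd] at h1
  linarith

/-- exclusions for count vectors in case C3 -/
def exC3 (n : ℕ → ℕ) : Bool :=
  (hvb 12 7 13 n && hvb 11 7 13 n) && (decide (2 ≤ n 6 + n 7 → 1 ≤ n 5 → dotn (fun _ => 1) n 13 ≤ 3) &&
    decide (2 ≤ n 6 + n 7 → 1 ≤ n 4 → 1 ≤ n 2 → False))

/-- classification of a size into 13 classes -/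
theorem cls13 (x s b κ q θL θT : ℚ) (h : Prop) : ∃ n : ℕ,
    (n = 0 ∧ x ≤ 1 / 4 ∧ x ≤ (1 - s) / 4) ∨ (n = 1 ∧ x ≤ 1 / 4 ∧ (1 - s) / 4 < x ∧ x < θT) ∨
    (n = 2 ∧ x ≤ 1 / 4 ∧ (1 - s) / 4 < x ∧ θT ≤ x) ∨ (n = 3 ∧ 1 / 4 < x ∧ x < q ∧ x ≤ θL) ∨
    (n = 4 ∧ 1 / 4 < x ∧ x < q ∧ θL < x) ∨ (n = 5 ∧ q ≤ x ∧ x ≤ κ) ∨ (n = 6 ∧ κ < x ∧ x < b) ∨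
    (n = 7 ∧ b ≤ x ∧ x ≤ 2 * s) ∨ (n = 8 ∧ 2 * s < x ∧ x ≤ (1 - s) / 2) ∨
    (n = 9 ∧ (1 - s) / 2 < x ∧ x ≤ 1 / 2 ∧ ¬ h) ∨ (n = 10 ∧ 1 / 2 < x ∧ ¬ h) ∨
    (n = 11 ∧ (1 - s) / 2 < x ∧ x ≤ 1 / 2 ∧ h) ∨ (n = 12 ∧ 1 / 2 < x ∧ h) := by
  by_cases h1 : 1 / 2 < x
  · by_cases h2 : h
    · exact ⟨12, by iterate 12 right
                    exact ⟨rfl, h1, h2⟩⟩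
    · exact ⟨10, by iterate 10 right
                    exact Or.inl ⟨rfl, h1, h2⟩⟩
  rw [not_lt] at h1
  by_cases h3 : (1 - s) / 2 < x
  · by_cases h2 : h
    · exact ⟨11, by iterate 11 right
                    exact Or.inl ⟨rfl, h3, h1, h2⟩⟩
    · exact ⟨9, by iterate 9 right
                   exact Or.inl ⟨rfl, h3, h1, h2⟩⟩
  rw [not_lt] at h3
  by_cases h4 : 2 * s < x
  · exact ⟨8, by iterate 8 right
                 exact Or.inl ⟨rfl, h4, h3⟩⟩
  rw [not_lt] at h4
  by_cases h5 : b ≤ x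
  · exact ⟨7, by iterate 7 right
                 exact Or.inl ⟨rfl, h5, h4⟩⟩
  rw [not_le] at h5
  by_cases h6 : κ < x
  · exact ⟨6, by iterate 6 right
                 exact Or.inl ⟨rfl, h6, h5⟩⟩
  rw [not_lt] at h6
  by_cases h7 : q ≤ x
  · exact ⟨5, by iterate 5 right
                 exact Or.inl ⟨rfl, h7, h6⟩⟩
  rw [not_le] at h7
  by_cases h8 : 1 / 4 < x
  · by_cases h9 : θL < x
    · exact ⟨4, by iterate 4 right
                   exact Or.inl ⟨rfl, h8, h7, h9⟩⟩
    · exact ⟨3, by iterate 3 right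
                   exact Or.inl ⟨rfl, h8, h7, not_lt.1 h9⟩⟩
  rw [not_lt] at h8
  by_cases h9 : (1 - s) / 4 < x
  · by_cases h10 : θT ≤ x
    · exact ⟨2, by iterate 2 right
                   exact Or.inl ⟨rfl, h8, h9, h10⟩⟩
    · exact ⟨1, by right
                   exact Or.inl ⟨rfl, h8, h9, not_le.1 h10⟩⟩
  · exact ⟨0, Or.inl ⟨rfl, h8, not_lt.1 h9⟩⟩

section
variable {S : Finset α} {z : α} {v : α → ℚ} {kk g : α → ℕ} {N D : Finset ℕ}
variable {i : ℕ} {xs be : α}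

set_option maxHeartbeats 4000000 in
theorem Core.C3m (H : Core S z v kk g N D) (H3 : ∀ p ∈ D, 3 ≤ #(bin S g p))
    (hs1 : 2 / 11 < v z) (hs2 : v z ≤ 1 / 5) (I : Ist S z v kk N i xs be)
    (κ q θT θL dL dM dS : ℚ) (eM : ℕ → ℚ)
    (hκ : (1 - v z) / 3 ≤ κ) (hκb : κ < v be) (hq : 1 / 4 < q) (hq3 : q ≤ (1 - v z) / 3) (hκq : 1 ≤ 2 * κ + q + v z)
    (hθL : 1 / 4 ≤ θL) (hθT : (1 - v z) / 4 < θT) (hθ : 1 ≤ 3 * θL + θT)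
    (hT0 : ∀ j ∈ N, (∀ y ∈ bin S kk j, v y ≤ 1 / 4) → ∀ y ∈ bin S kk j, (1 - v z) / 4 < v y → θT ≤ v y)
    (hS0 : 1 / 4 < θL → ∃ j0 ∈ N, ∃ u ∈ bin S kk j0, v u = θT ∧ (∀ y ∈ bin S kk j0, v y ≤ 1 / 4) ∧ 3 * θL + θT ≤ 1)
    (hdL : 0 ≤ dL) (hdS : 0 ≤ dS) (heM : ∀ j, 0 ≤ eM j) (hdM : ∑ j ∈ N, eM j ≤ dM)
    (hL : 5 / 3 ≤ dL ∨ ∃ j0 ∈ N, ∃ u ∈ bin S kk j0, κ < v u ∧ ∀ y ∈ bin S kk j0, 3 * v y ≤ 1)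
    (hM : ∀ w : α → ℚ, (∀ y ∈ S, 17 / 2 ≤ w y) → (∀ y ∈ S, (1 - v z) / 4 < v y → 53 / 6 ≤ w y) →
      (∀ y ∈ S, q ≤ v y → 10 ≤ w y) → (∀ y ∈ S, κ < v y → 12 ≤ w y) → ∀ j ∈ N, ∀ t ∈ bin S kk j,
      (∀ y ∈ bin S kk j, v y ≤ v t) → (1 - v z) / 3 < v t → v t ≤ 1 / 3 → 36 - eM j ≤ ∑ y ∈ bin S kk j, w y)
    (hSd : 4 / 3 ≤ dS ∨ ∀ j ∈ N, ∀ t ∈ bin S kk j, (∀ y ∈ bin S kk j, v y ≤ v t) → 1 / 4 < v t → v t ≤ (1 - v z) / 3 → False)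
    (htot : 1 + dL + dM + dS + 3 / 2 < 17 / 2) : False := by
  classical
  have hfull := I.full
  have hb3 := I.hbe
  choose c hc0 using fun x => cls13 (v x) (v z) (v be) κ q θL θT (Hv S z v kk x)
  obtain ⟨W, hW⟩ : ∃ W : ℕ → ℕ, W = fun i => [51, 53, 54, 54, 55, 60, 72, 78, 102, 108, 114, 132, 138].getD i 0 := ⟨_, rfl⟩
  obtain ⟨w, hw⟩ : ∃ w : α → ℚ, ∀ x, w x = (W (c x) : ℚ) / 6 := ⟨_, fun _ => rfl⟩
  have hcs : ∀ x, (c x = 0 ∧ w x = 17/2 ∧ v x ≤ 1 / 4 ∧ v x ≤ (1 - v z) / 4) ∨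
      (c x = 1 ∧ w x = 53/6 ∧ v x ≤ 1 / 4 ∧ (1 - v z) / 4 < v x ∧ v x < θT) ∨
      (c x = 2 ∧ w x = 9 ∧ v x ≤ 1 / 4 ∧ (1 - v z) / 4 < v x ∧ θT ≤ v x) ∨
      (c x = 3 ∧ w x = 9 ∧ 1 / 4 < v x ∧ v x < q ∧ v x ≤ θL) ∨
      (c x = 4 ∧ w x = 55/6 ∧ 1 / 4 < v x ∧ v x < q ∧ θL < v x) ∨
      (c x = 5 ∧ w x = 10 ∧ q ≤ v x ∧ v x ≤ κ) ∨
      (c x = 6 ∧ w x = 12 ∧ κ < v x ∧ v x < v be) ∨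
      (c x = 7 ∧ w x = 13 ∧ v be ≤ v x ∧ v x ≤ 2 * v z) ∨
      (c x = 8 ∧ w x = 17 ∧ 2 * v z < v x ∧ v x ≤ (1 - v z) / 2) ∨
      (c x = 9 ∧ w x = 18 ∧ (1 - v z) / 2 < v x ∧ v x ≤ 1 / 2 ∧ ¬ Hv S z v kk x) ∨
      (c x = 10 ∧ w x = 19 ∧ 1 / 2 < v x ∧ ¬ Hv S z v kk x) ∨
      (c x = 11 ∧ w x = 22 ∧ (1 - v z) / 2 < v x ∧ v x ≤ 1 / 2 ∧ Hv S z v kk x) ∨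
      (c x = 12 ∧ w x = 23 ∧ 1 / 2 < v x ∧ Hv S z v kk x) := by
    intro x
    have hk : ∀ k, c x = k → w x = (W k : ℚ) / 6 := fun k h => by rw [hw, h]
    rcases hc0 x with h | h | h | h | h | h | h | h | h | h | h | h | h
    · exact Or.inl ⟨h.1, by rw [hk _ h.1, hW]; norm_num, h.2⟩
    · iterate 1 right
      exact Or.inl ⟨h.1, by rw [hk _ h.1, hW]; norm_num, h.2⟩
    · iterate 2 right
      exact Or.inl ⟨h.1, by rw [hk _ h.1, hW]; norm_num, h.2⟩
    · iterate 3 right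
      exact Or.inl ⟨h.1, by rw [hk _ h.1, hW]; norm_num, h.2⟩
    · iterate 4 right
      exact Or.inl ⟨h.1, by rw [hk _ h.1, hW]; norm_num, h.2⟩
    · iterate 5 right
      exact Or.inl ⟨h.1, by rw [hk _ h.1, hW]; norm_num, h.2⟩
    · iterate 6 right
      exact Or.inl ⟨h.1, by rw [hk _ h.1, hW]; norm_num, h.2⟩
    · iterate 7 right
      exact Or.inl ⟨h.1, by rw [hk _ h.1, hW]; norm_num, h.2⟩
    · iterate 8 right
      exact Or.inl ⟨h.1, by rw [hk _ h.1, hW]; norm_num, h.2⟩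
    · iterate 9 right
      exact Or.inl ⟨h.1, by rw [hk _ h.1, hW]; norm_num, h.2⟩
    · iterate 10 right
      exact Or.inl ⟨h.1, by rw [hk _ h.1, hW]; norm_num, h.2⟩
    · iterate 11 right
      exact Or.inl ⟨h.1, by rw [hk _ h.1, hW]; norm_num, h.2⟩
    · iterate 12 right
      exact ⟨h.1, by rw [hk _ h.1, hW]; norm_num, h.2⟩
  clear hc0
  have wb : ∀ y ∈ S, 17 / 2 ≤ w y := by
    intro y _
    rcases hcs y with ⟨hc, hw, h, h'⟩ | ⟨hc, hw, h, h', h''⟩ | ⟨hc, hw, h, h', h''⟩ | ⟨hc, hw, h, h', h''⟩ | ⟨hc, hw, h, h', h''⟩ | ⟨hc, hw, h, h'⟩ | ⟨hc, hw, h, h'⟩ | ⟨hc, hw, h, h'⟩ | ⟨hc, hw, h, h'⟩ | ⟨hc, hw, h, h', h''⟩ | ⟨hc, hw, h, h'⟩ | ⟨hc, hw, h, h', h''⟩ | ⟨hc, hw, h, h'⟩ <;> linarith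
  have wT : ∀ y ∈ S, (1 - v z) / 4 < v y → 53 / 6 ≤ w y := by
    intro y _ hh
    rcases hcs y with ⟨hc, hw, h, h'⟩ | ⟨hc, hw, h, h', h''⟩ | ⟨hc, hw, h, h', h''⟩ | ⟨hc, hw, h, h', h''⟩ | ⟨hc, hw, h, h', h''⟩ | ⟨hc, hw, h, h'⟩ | ⟨hc, hw, h, h'⟩ | ⟨hc, hw, h, h'⟩ | ⟨hc, hw, h, h'⟩ | ⟨hc, hw, h, h', h''⟩ | ⟨hc, hw, h, h'⟩ | ⟨hc, hw, h, h', h''⟩ | ⟨hc, hw, h, h'⟩ <;> linarith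
  have wT' : ∀ y ∈ S, (1 - v z) / 4 < v y → θT ≤ v y → 9 ≤ w y := by
    intro y _ hh hh'
    rcases hcs y with ⟨hc, hw, h, h'⟩ | ⟨hc, hw, h, h', h''⟩ | ⟨hc, hw, h, h', h''⟩ | ⟨hc, hw, h, h', h''⟩ | ⟨hc, hw, h, h', h''⟩ | ⟨hc, hw, h, h'⟩ | ⟨hc, hw, h, h'⟩ | ⟨hc, hw, h, h'⟩ | ⟨hc, hw, h, h'⟩ | ⟨hc, hw, h, h', h''⟩ | ⟨hc, hw, h, h'⟩ | ⟨hc, hw, h, h', h''⟩ | ⟨hc, hw, h, h'⟩ <;> linarith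
  have wS : ∀ y ∈ S, θL < v y → 55 / 6 ≤ w y := by
    intro y _ hh
    rcases hcs y with ⟨hc, hw, h, h'⟩ | ⟨hc, hw, h, h', h''⟩ | ⟨hc, hw, h, h', h''⟩ | ⟨hc, hw, h, h', h''⟩ | ⟨hc, hw, h, h', h''⟩ | ⟨hc, hw, h, h'⟩ | ⟨hc, hw, h, h'⟩ | ⟨hc, hw, h, h'⟩ | ⟨hc, hw, h, h'⟩ | ⟨hc, hw, h, h', h''⟩ | ⟨hc, hw, h, h'⟩ | ⟨hc, hw, h, h', h''⟩ | ⟨hc, hw, h, h'⟩ <;> linarith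
  have wq : ∀ y ∈ S, q ≤ v y → 10 ≤ w y := by
    intro y _ hh
    rcases hcs y with ⟨hc, hw, h, h'⟩ | ⟨hc, hw, h, h', h''⟩ | ⟨hc, hw, h, h', h''⟩ | ⟨hc, hw, h, h', h''⟩ | ⟨hc, hw, h, h', h''⟩ | ⟨hc, hw, h, h'⟩ | ⟨hc, hw, h, h'⟩ | ⟨hc, hw, h, h'⟩ | ⟨hc, hw, h, h'⟩ | ⟨hc, hw, h, h', h''⟩ | ⟨hc, hw, h, h'⟩ | ⟨hc, hw, h, h', h''⟩ | ⟨hc, hw, h, h'⟩ <;> linarith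
  have wM : ∀ y ∈ S, κ < v y → 12 ≤ w y := by
    intro y _ hh
    rcases hcs y with ⟨hc, hw, h, h'⟩ | ⟨hc, hw, h, h', h''⟩ | ⟨hc, hw, h, h', h''⟩ | ⟨hc, hw, h, h', h''⟩ | ⟨hc, hw, h, h', h''⟩ | ⟨hc, hw, h, h'⟩ | ⟨hc, hw, h, h'⟩ | ⟨hc, hw, h, h'⟩ | ⟨hc, hw, h, h'⟩ | ⟨hc, hw, h, h', h''⟩ | ⟨hc, hw, h, h'⟩ | ⟨hc, hw, h, h', h''⟩ | ⟨hc, hw, h, h'⟩ <;> linarith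
  have wP : ∀ y ∈ S, v be ≤ v y → 13 ≤ w y := by
    intro y _ hh
    rcases hcs y with ⟨hc, hw, h, h'⟩ | ⟨hc, hw, h, h', h''⟩ | ⟨hc, hw, h, h', h''⟩ | ⟨hc, hw, h, h', h''⟩ | ⟨hc, hw, h, h', h''⟩ | ⟨hc, hw, h, h'⟩ | ⟨hc, hw, h, h'⟩ | ⟨hc, hw, h, h'⟩ | ⟨hc, hw, h, h'⟩ | ⟨hc, hw, h, h', h''⟩ | ⟨hc, hw, h, h'⟩ | ⟨hc, hw, h, h', h''⟩ | ⟨hc, hw, h, h'⟩ <;> linarith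
  have wL : ∀ y ∈ S, 2 * v z < v y → 17 ≤ w y := by
    intro y _ hh
    rcases hcs y with ⟨hc, hw, h, h'⟩ | ⟨hc, hw, h, h', h''⟩ | ⟨hc, hw, h, h', h''⟩ | ⟨hc, hw, h, h', h''⟩ | ⟨hc, hw, h, h', h''⟩ | ⟨hc, hw, h, h'⟩ | ⟨hc, hw, h, h'⟩ | ⟨hc, hw, h, h'⟩ | ⟨hc, hw, h, h'⟩ | ⟨hc, hw, h, h', h''⟩ | ⟨hc, hw, h, h'⟩ | ⟨hc, hw, h, h', h''⟩ | ⟨hc, hw, h, h'⟩ <;> linarith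
  have wB : ∀ y ∈ S, (1 - v z) / 2 < v y → 18 ≤ w y := by
    intro y _ hh
    rcases hcs y with ⟨hc, hw, h, h'⟩ | ⟨hc, hw, h, h', h''⟩ | ⟨hc, hw, h, h', h''⟩ | ⟨hc, hw, h, h', h''⟩ | ⟨hc, hw, h, h', h''⟩ | ⟨hc, hw, h, h'⟩ | ⟨hc, hw, h, h'⟩ | ⟨hc, hw, h, h'⟩ | ⟨hc, hw, h, h'⟩ | ⟨hc, hw, h, h', h''⟩ | ⟨hc, hw, h, h'⟩ | ⟨hc, hw, h, h', h''⟩ | ⟨hc, hw, h, h'⟩ <;> linarith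
  have wG : ∀ y ∈ S, 1 / 2 < v y → 19 ≤ w y := by
    intro y _ hh
    rcases hcs y with ⟨hc, hw, h, h'⟩ | ⟨hc, hw, h, h', h''⟩ | ⟨hc, hw, h, h', h''⟩ | ⟨hc, hw, h, h', h''⟩ | ⟨hc, hw, h, h', h''⟩ | ⟨hc, hw, h, h'⟩ | ⟨hc, hw, h, h'⟩ | ⟨hc, hw, h, h'⟩ | ⟨hc, hw, h, h'⟩ | ⟨hc, hw, h, h', h''⟩ | ⟨hc, hw, h, h'⟩ | ⟨hc, hw, h, h', h''⟩ | ⟨hc, hw, h, h'⟩ <;> linarith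
  have wH1 : ∀ j ∈ N, ∀ x y, Two S v kk j x y → v y ≤ 2 * v z → 35 ≤ w x + w y := by
    intro j hj x y hT hy
    obtain ⟨h1, h2, h3⟩ := I.two_small H H3 (by linarith) hj hT hy
    have hx2 : (1 - v z) / 2 < v x := by linarith
    have h1 : 22 ≤ w x := by
      have hH := Hv.of (z := z) hT hy
      rcases hcs x with ⟨hc, hw, h, h'⟩ | ⟨hc, hw, h, h', h''⟩ | ⟨hc, hw, h, h', h''⟩ | ⟨hc, hw, h, h', h''⟩ | ⟨hc, hw, h, h', h''⟩ | ⟨hc, hw, h, h'⟩ | ⟨hc, hw, h, h'⟩ | ⟨hc, hw, h, h'⟩ | ⟨hc, hw, h, h'⟩ | ⟨hc, hw, h, h', h''⟩ | ⟨hc, hw, h, h'⟩ | ⟨hc, hw, h, h', h''⟩ | ⟨hc, hw, h, h'⟩ <;> first | linarith | tauto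
    linarith [wP y (mem_bin.1 hT.memy).1 h2]
  have wH2 : ∀ j ∈ N, ∀ x y, Two S v kk j x y → v y ≤ 2 * v z → 1 / 2 < v x → 36 ≤ w x + w y := by
    intro j hj x y hT hy hx
    obtain ⟨h1, h2, h3⟩ := I.two_small H H3 (by linarith) hj hT hy
    have h1 : 23 ≤ w x := by
      have hH := Hv.of (z := z) hT hy
      rcases hcs x with ⟨hc, hw, h, h'⟩ | ⟨hc, hw, h, h', h''⟩ | ⟨hc, hw, h, h', h''⟩ | ⟨hc, hw, h, h', h''⟩ | ⟨hc, hw, h, h', h''⟩ | ⟨hc, hw, h, h'⟩ | ⟨hc, hw, h, h'⟩ | ⟨hc, hw, h, h'⟩ | ⟨hc, hw, h, h'⟩ | ⟨hc, hw, h, h', h''⟩ | ⟨hc, hw, h, h'⟩ | ⟨hc, hw, h, h', h''⟩ | ⟨hc, hw, h, h'⟩ <;> first | linarith | tauto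
    linarith [wP y (mem_bin.1 hT.memy).1 h2]
  refine H.count44' w (1 + dL + dM + dS + 3 / 2) (fun j => pen (Bad S v kk ((1 - v z) / 2) 2) 1 j + pen (Bad S v kk (2 * v z) 2) dL j +
    eM j + pen (Bad S v kk θL 3) dS j + pen (Bad S v kk ((1 - v z) / 4) 4) (3/2) j) ?_ ?_ ?_ (by linarith [wb z H.zS])
  · intro j hj
    obtain ⟨t, ht, htop⟩ := H.top hj
    have p1 := pen_nonneg (Q := Bad S v kk ((1 - v z) / 2) 2) (δ := 1) (by norm_num) j
    have p2 := pen_nonneg (Q := Bad S v kk (2 * v z) 2) hdL j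
    have p4 := pen_nonneg (Q := Bad S v kk θL 3) hdS j
    have p3 := pen_nonneg (Q := Bad S v kk ((1 - v z) / 4) 4) (δ := 3/2) (by norm_num) j
    have p5 := heM j
    by_cases htL : 2 * v z < v t
    · have := H.FC3h H3 hs1 hs2 w hdL
        (hL.imp id (fun ⟨j0, hj0, u, hu, h1, h2⟩ => ⟨j0, hj0, u, hu, h2, fun y hy h => wM y hy (by linarith)⟩))
        wb wT wL wB wG wH1 wH2 hj ht htop htL
      linarith
    have htb := I.small_top H H3 hj ht htop (by linarith) (by linarith)
    by_cases hMt : (1 - v z) / 3 < v t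
    · have := hM w wb wT wq wM j hj t ht htop hMt (by linarith)
      linarith
    by_cases hS : 1 / 4 < v t
    · by_cases htθ : θL < v t
      · rcases hSd with hSd | hSd
        · rcases H.cls hj ht htop w θL (55 / 6) (17/2) 3 3 htθ (by push_cast; linarith) (by push_cast; linarith)
            wb wS (by norm_num) (by norm_num) (by norm_num) with h | ⟨hbad, h⟩
          · push_cast at h; linarith
          · rw [pen_of hbad]
            push_cast at h; linarith
        · exact (hSd j hj t ht htop hS (by linarith)).elim
      · obtain ⟨j0, hj0, u, hu, h1, h2, h3⟩ := hS0 (by linarith)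
        have hlt : j < j0 := H.lt_of_top hj0 ht (fun y hy => by linarith [h2 y hy])
        have h5 := H.U hj (mem_bin.1 hu).1 ((mem_bin.1 hu).2.symm ▸ hlt) (v t) htop 3 (by push_cast; linarith)
        have := wcle (r := 4) (k := 4) (a := 9) (b := 0) (fun y hy => by linarith [wb y (mem_bin.1 hy).1])
          (fun y hy h => wT' y (mem_bin.1 hy).1 (by linarith) (by linarith)) (by norm_num) (by norm_num) h5
          (le_trans h5 (card_le_card (filter_subset _ _))) le_rfl
        push_cast at this; linarith
    · have := H.FCt hs1 hs2 hj ht htop (fun y => if kk y = j then w y else 9) (b := 17/2) (a := 9) (d := 3/2) (by norm_num)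
        (by norm_num) (by norm_num) (by norm_num) (by norm_num)
        (fun y hy => by
          by_cases h : kk y = j
          · simp only [if_pos h]; exact wb y hy
          · simp only [if_neg h]; norm_num)
        (fun y hy hy4 => by
          by_cases h : kk y = j
          · simp only [if_pos h]
            exact wT' y hy hy4 (hT0 j hj (fun y hy => by linarith [htop y hy]) y (mem_bin.2 ⟨hy, h⟩) hy4)
          · simp only [if_neg h]; norm_num) (by linarith)
      rw [sum_congr rfl (g := w) (fun y hy => by rw [if_pos (mem_bin.1 hy).2])] at this
      linarith
  · simp only [sum_add_distrib]
    have := H.sum_pen_bad ((1 - v z) / 2) 2 (δ := 1) (by norm_num)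
    have := H.sum_pen_bad (2 * v z) 2 hdL
    have := H.sum_pen_bad θL 3 hdS
    have := H.sum_pen_bad ((1 - v z) / 4) 4 (δ := 3/2) (by norm_num)
    linarith
  · intro p hp
    have hcard := H.cardP hp 5 (by push_cast; linarith)
    have hk : ∀ x ∈ bin S g p, c x < 13 := by
      intro x hx
      rcases hcs x with h | h | h | h | h | h | h | h | h | h | h | h | h <;> omega
    have hvv : ∀ x ∈ bin S g p, v z < v x → Hv S z v kk x → ∀ y ∈ bin S g p, y ≠ x → c y < 7 := by
      intro x hx h3 hH y hy hyx
      have := I.opt_lt H H3 hp hx hy hyx (I.Hv_xs H H3 (by linarith) h3 hH)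
      rcases hcs y with ⟨hc, hw, h, h'⟩ | ⟨hc, hw, h, h', h''⟩ | ⟨hc, hw, h, h', h''⟩ | ⟨hc, hw, h, h', h''⟩ | ⟨hc, hw, h, h', h''⟩ | ⟨hc, hw, h, h'⟩ | ⟨hc, hw, h, h'⟩ | ⟨hc, hw, h, h'⟩ | ⟨hc, hw, h, h'⟩ | ⟨hc, hw, h, h', h''⟩ | ⟨hc, hw, h, h'⟩ | ⟨hc, hw, h, h', h''⟩ | ⟨hc, hw, h, h'⟩ <;> first | omega | linarith
    have c67 : ∀ x ∈ bin S g p, c x = 6 ∨ c x = 7 → κ < v x := by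
      intro x hx hcx
      rcases hcs x with ⟨hc, hw, h, h'⟩ | ⟨hc, hw, h, h', h''⟩ | ⟨hc, hw, h, h', h''⟩ | ⟨hc, hw, h, h', h''⟩ | ⟨hc, hw, h, h', h''⟩ | ⟨hc, hw, h, h'⟩ | ⟨hc, hw, h, h'⟩ | ⟨hc, hw, h, h'⟩ | ⟨hc, hw, h, h'⟩ | ⟨hc, hw, h, h', h''⟩ | ⟨hc, hw, h, h'⟩ | ⟨hc, hw, h, h', h''⟩ | ⟨hc, hw, h, h'⟩ <;> first | omega | linarith
    have c5 : ∀ x ∈ bin S g p, c x = 5 → q ≤ v x := by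
      intro x hx hcx
      rcases hcs x with ⟨hc, hw, h, h'⟩ | ⟨hc, hw, h, h', h''⟩ | ⟨hc, hw, h, h', h''⟩ | ⟨hc, hw, h, h', h''⟩ | ⟨hc, hw, h, h', h''⟩ | ⟨hc, hw, h, h'⟩ | ⟨hc, hw, h, h'⟩ | ⟨hc, hw, h, h'⟩ | ⟨hc, hw, h, h'⟩ | ⟨hc, hw, h, h', h''⟩ | ⟨hc, hw, h, h'⟩ | ⟨hc, hw, h, h', h''⟩ | ⟨hc, hw, h, h'⟩ <;> first | omega | linarith
    have c4 : ∀ x ∈ bin S g p, c x = 4 → θL < v x := by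
      intro x hx hcx
      rcases hcs x with ⟨hc, hw, h, h'⟩ | ⟨hc, hw, h, h', h''⟩ | ⟨hc, hw, h, h', h''⟩ | ⟨hc, hw, h, h', h''⟩ | ⟨hc, hw, h, h', h''⟩ | ⟨hc, hw, h, h'⟩ | ⟨hc, hw, h, h'⟩ | ⟨hc, hw, h, h'⟩ | ⟨hc, hw, h, h'⟩ | ⟨hc, hw, h, h', h''⟩ | ⟨hc, hw, h, h'⟩ | ⟨hc, hw, h, h', h''⟩ | ⟨hc, hw, h, h'⟩ <;> first | omega | linarith
    have c2 : ∀ x ∈ bin S g p, c x = 2 → θT ≤ v x := by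
      intro x hx hcx
      rcases hcs x with ⟨hc, hw, h, h'⟩ | ⟨hc, hw, h, h', h''⟩ | ⟨hc, hw, h, h', h''⟩ | ⟨hc, hw, h, h', h''⟩ | ⟨hc, hw, h, h', h''⟩ | ⟨hc, hw, h, h'⟩ | ⟨hc, hw, h, h'⟩ | ⟨hc, hw, h, h'⟩ | ⟨hc, hw, h, h'⟩ | ⟨hc, hw, h, h', h''⟩ | ⟨hc, hw, h, h'⟩ | ⟨hc, hw, h, h', h''⟩ | ⟨hc, hw, h, h'⟩ <;> first | omega | linarith
    have v0 : ∀ x ∈ bin S g p, 0 ≤ v x := fun x hx => (H.vpos (mem_bin.1 hx).1).le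
    have hex : exC3 (cnt (bin S g p) c) = true := by
      unfold exC3
      rw [Bool.and_eq_true, Bool.and_eq_true, Bool.and_eq_true, decide_eq_true_iff, decide_eq_true_iff]
      refine ⟨⟨?_, ?_⟩, ?_, ?_⟩
      · apply hvb_of _ (by norm_num)
        intro x hx hcx
        have hH : 1 / 2 < v x ∧ Hv S z v kk x := by
          rcases hcs x with h | h | h | h | h | h | h | h | h | h | h | h | h <;> first | omega | exact h.2.2 | exact ⟨h.2.2.1, h.2.2.2.2⟩
        exact hvv x hx (by linarith [hH.1]) hH.2
      · apply hvb_of _ (by norm_num)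
        intro x hx hcx
        have hH : (1 - v z) / 2 < v x ∧ Hv S z v kk x := by
          rcases hcs x with h | h | h | h | h | h | h | h | h | h | h | h | h <;> first | omega | exact h.2.2 | exact ⟨h.2.2.1, h.2.2.2.2⟩
        exact hvv x hx (by linarith [hH.1]) hH.2
      · intro h1 h2
        rw [← card_eq_dotn _ _ _ hk]
        by_contra hc3
        obtain ⟨a, ha, b, hb, hab, hca, hcb⟩ := two_cls (by norm_num) h1
        obtain ⟨d, hd, hcd⟩ := cnt_pos h2
        have hda : a ≠ d := by rintro rfl; omega
        have hdb : b ≠ d := by rintro rfl; omega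
        obtain ⟨e, he, hne⟩ := exists_mem_notMem_of_card_lt_card (s := ({a, b, d} : Finset α)) (t := bin S g p)
          (lt_of_le_of_lt card_le_three (by omega))
        simp only [mem_insert, mem_singleton, not_or] at hne
        have h5 := four_le v0 ha hb hd he hab hda (Ne.symm hne.1) hdb (Ne.symm hne.2.1) (Ne.symm hne.2.2)
        linarith [H.opt p hp, H.vmin e (mem_bin.1 he).1, c67 a ha hca, c67 b hb hcb, c5 d hd hcd]
      · intro h1 h2 h3
        obtain ⟨a, ha, b, hb, hab, hca, hcb⟩ := two_cls (by norm_num) h1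
        obtain ⟨d, hd, hcd⟩ := cnt_pos h2
        obtain ⟨e, he, hce⟩ := cnt_pos h3
        have h5 := four_le v0 ha hb hd he hab (by rintro rfl; omega) (by rintro rfl; omega) (by rintro rfl; omega)
          (by rintro rfl; omega) (by rintro rfl; omega)
        linarith [H.opt p hp, c67 a ha hca, c67 b hb hcb, c4 d hd hcd, c2 e he hce]
    have hlb : ∀ x ∈ bin S g p, (1/5 - v z) * ((([24,27,27,33,33,33,36,36,48,54,66,64,66].getD (c x) 0 : ℕ) : ℚ) / ((131 : ℕ) + 1)) +
        (v z - 2/11) * ((([12,12,12,15,15,15,16,16,24,24,30,28,30].getD (c x) 0 : ℕ) : ℚ) / ((59 : ℕ) + 1)) ≤ (1/5 - 2/11) * v x ∧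
        (c x ≠ 0 → (1/5 - v z) * ((([24,27,27,33,33,33,36,36,48,54,66,64,66].getD (c x) 0 : ℕ) : ℚ) / ((131 : ℕ) + 1)) +
        (v z - 2/11) * ((([12,12,12,15,15,15,16,16,24,24,30,28,30].getD (c x) 0 : ℕ) : ℚ) / ((59 : ℕ) + 1)) < (1/5 - 2/11) * v x) := by
      intro x hx
      have := H.vmin x (mem_bin.1 hx).1
      by_cases h0 : c x = 0
      · rw [h0]; norm_num; linarith
      · suffices hs : (1/5 - v z) * ((([24,27,27,33,33,33,36,36,48,54,66,64,66].getD (c x) 0 : ℕ) : ℚ) / ((131 : ℕ) + 1)) +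
            (v z - 2/11) * ((([12,12,12,15,15,15,16,16,24,24,30,28,30].getD (c x) 0 : ℕ) : ℚ) / ((59 : ℕ) + 1)) < (1/5 - 2/11) * v x from
          ⟨hs.le, fun _ => hs⟩
        rcases hcs x with ⟨hc, hw, h, h'⟩ | ⟨hc, hw, h, h', h''⟩ | ⟨hc, hw, h, h', h''⟩ | ⟨hc, hw, h, h', h''⟩ | ⟨hc, hw, h, h', h''⟩ | ⟨hc, hw, h, h'⟩ | ⟨hc, hw, h, h'⟩ | ⟨hc, hw, h, h'⟩ | ⟨hc, hw, h, h'⟩ | ⟨hc, hw, h, h', h''⟩ | ⟨hc, hw, h, h'⟩ | ⟨hc, hw, h, h', h''⟩ | ⟨hc, hw, h, h'⟩ <;> rw [hc]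
        · exact absurd hc h0
        · norm_num; linarith
        · norm_num; linarith
        · norm_num; linarith
        · norm_num; linarith
        · norm_num; linarith
        · norm_num; linarith
        · norm_num; linarith
        · norm_num; linarith
        · norm_num; linarith
        · norm_num; linarith
        · norm_num; linarith [I.Hv_xs H H3 (by linarith) (by linarith) h'']
        · norm_num; linarith
    have := optW (bin S g p) v c 13 (fun i => [24,27,27,33,33,33,36,36,48,54,66,64,66].getD i 0)
      (fun i => [12,12,12,15,15,15,16,16,24,24,30,28,30].getD i 0) 131 59 (2/11) (1/5) (v z)
      W 264 exC3 (by rw [hW]; decide +kernel) (by rw [hW]; decide +kernel)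
      hk (H.opt p hp) (by omega) hs1 hs2
      (fun x hx => (hlb x hx).1) (fun x hx => (hlb x hx).2) (by rw [hW]; simp; omega) hex
    simp only [hw]
    rw [← Finset.sum_div]
    push_cast at this
    linarith

end
end HF


namespace HF
section
variable {S : Finset α} {z : α} {v : α → ℚ} {kk g : α → ℕ} {N D : Finset ℕ}
variable {i : ℕ} {xs be : α}

theorem Core.C3w (H : Core S z v kk g N D) (H3 : ∀ p ∈ D, 3 ≤ #(bin S g p))
    (hs1 : 2 / 11 < v z) (hs2 : v z ≤ 1 / 5) (I : Ist S z v kk N i xs be)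
    (κ q dL dM dS : ℚ) (eM : ℕ → ℚ)
    (hκ : (1 - v z) / 3 ≤ κ) (hκb : κ < v be) (hq : 1 / 4 < q) (hq3 : q ≤ (1 - v z) / 3) (hκq : 1 ≤ 2 * κ + q + v z)
    (hdL : 0 ≤ dL) (hdS : 0 ≤ dS) (heM : ∀ j, 0 ≤ eM j) (hdM : ∑ j ∈ N, eM j ≤ dM)
    (hL : 5 / 3 ≤ dL ∨ ∃ j0 ∈ N, ∃ u ∈ bin S kk j0, κ < v u ∧ ∀ y ∈ bin S kk j0, 3 * v y ≤ 1)
    (hM : ∀ w : α → ℚ, (∀ y ∈ S, 17 / 2 ≤ w y) → (∀ y ∈ S, (1 - v z) / 4 < v y → 53 / 6 ≤ w y) →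
      (∀ y ∈ S, q ≤ v y → 10 ≤ w y) → (∀ y ∈ S, κ < v y → 12 ≤ w y) → ∀ j ∈ N, ∀ t ∈ bin S kk j,
      (∀ y ∈ bin S kk j, v y ≤ v t) → (1 - v z) / 3 < v t → v t ≤ 1 / 3 → 36 - eM j ≤ ∑ y ∈ bin S kk j, w y)
    (hSd : 4 / 3 ≤ dS ∨ ∀ j ∈ N, ∀ t ∈ bin S kk j, (∀ y ∈ bin S kk j, v y ≤ v t) → 1 / 4 < v t → v t ≤ (1 - v z) / 3 → False)
    (htot : 1 + dL + dM + dS + 3 / 2 < 17 / 2) : False := by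
  classical
  obtain ⟨T, hT⟩ : ∃ T : Finset α, T = S.filter (fun y => kk y ∈ N ∧ (∀ u ∈ bin S kk (kk y), v u ≤ 1 / 4) ∧ (1 - v z) / 4 < v y) :=
    ⟨_, rfl⟩
  have hmem : ∀ j ∈ N, (∀ y ∈ bin S kk j, v y ≤ 1 / 4) → ∀ y ∈ bin S kk j, (1 - v z) / 4 < v y → y ∈ T := by
    intro j hj h1 y hy hy4
    obtain ⟨hyS, rfl⟩ := mem_bin.1 hy
    rw [hT, mem_filter]
    exact ⟨hyS, hj, h1, hy4⟩
  rcases T.eq_empty_or_nonempty with he | hne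
  · refine H.C3m H3 hs1 hs2 I κ q 1 (1 / 4) dL dM dS eM hκ hκb hq hq3 hκq le_rfl (by linarith) (by norm_num) ?_ ?_
      hdL hdS heM hdM hL hM hSd htot
    · intro j hj h1 y hy hy4
      have := hmem j hj h1 y hy hy4
      rw [he] at this
      exact absurd this (notMem_empty _)
    · intro h; exact absurd h (lt_irrefl _)
  · obtain ⟨u, hu, hmin⟩ := exists_min_image T v hne
    have hu' := hu
    rw [hT, mem_filter] at hu'
    obtain ⟨huS, huN, hu4, hus⟩ := hu'
    have huu : u ∈ bin S kk (kk u) := mem_bin.2 ⟨huS, rfl⟩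
    have := hu4 u huu
    refine H.C3m H3 hs1 hs2 I κ q (v u) ((1 - v u) / 3) dL dM dS eM hκ hκb hq hq3 hκq (by linarith) hus (by linarith) ?_ ?_
      hdL hdS heM hdM hL hM hSd htot
    · intro j hj h1 y hy hy4
      exact hmin y (hmem j hj h1 y hy hy4)
    · intro _
      exact ⟨kk u, huN, u, huu, rfl, hu4, by linarith⟩

theorem Core.notbad36 (H : Core S z v kk g N D) {w : α → ℚ} (wb : ∀ y ∈ S, 17 / 2 ≤ w y)
    (wM : ∀ y ∈ S, (1 - v z) / 3 < v y → 12 ≤ w y) {j : ℕ} {t : α} (ht : t ∈ bin S kk j)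
    (htop : ∀ y ∈ bin S kk j, v y ≤ v t) (h1 : (1 - v z) / 3 < v t) (h3 : v t ≤ 1 / 3)
    (hb : ¬ Bad S v kk ((1 - v z) / 3) 3 j) : 36 ≤ ∑ y ∈ bin S kk j, w y := by
  have h2 := of_not_bad ht htop h1 (by push_cast; linarith) hb
  have := wc (r := 3) (k := 3) (b := 17 / 2) (fun y hy => wb y (mem_bin.1 hy).1) (fun y hy => wM y (mem_bin.1 hy).1)
    (by norm_num) (by norm_num) h2 (le_trans h2 (card_le_card (filter_subset _ _))) le_rfl
  push_cast at this; linarith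

/-- the bad `M` bin costs at most `7/2` -/
theorem Core.caseC3a' (H : Core S z v kk g N D) (H3 : ∀ p ∈ D, 3 ≤ #(bin S g p))
    (hs1 : 2 / 11 < v z) (hs2 : v z ≤ 1 / 5) (I : Ist S z v kk N i xs be) (hbe : (1 - v z) / 3 < v be)
    {jm : ℕ} (hjm : jm ∈ N) (hbad : Bad S v kk ((1 - v z) / 3) 3 jm) {m : α} (hm : m ∈ bin S kk jm)
    (hm1 : (1 - v z) / 3 < v m)
    (hw : ∀ w : α → ℚ, (∀ y ∈ S, 17 / 2 ≤ w y) → (∀ y ∈ S, (1 - v z) / 3 < v y → 12 ≤ w y) →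
      65 / 2 ≤ ∑ y ∈ bin S kk jm, w y) : False := by
  refine H.C3w H3 hs1 hs2 I ((1 - v z) / 3) ((1 - v z) / 3) 0 (7 / 2) (4 / 3) (pen (Bad S v kk ((1 - v z) / 3) 3) (7 / 2))
    le_rfl hbe (by linarith) le_rfl (by linarith) le_rfl (by norm_num) (fun j => pen_nonneg (by norm_num) j)
    (H.sum_pen_bad _ _ (by norm_num)) (Or.inr ⟨jm, hjm, m, hm, hm1, fun y hy => by simpa using hbad.1 y hy⟩) ?_ (Or.inl le_rfl) (by norm_num)
  intro w wb wT wq wM j hj t ht htop h1 h3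
  by_cases hb : Bad S v kk ((1 - v z) / 3) 3 j
  · rw [pen_of hb, H.bad_unique hj hjm hb hbad]
    linarith [hw w wb wM]
  · have := H.notbad36 wb wM ht htop h1 h3 hb
    linarith [pen_nonneg (Q := Bad S v kk ((1 - v z) / 3) 3) (δ := 7 / 2) (by norm_num) j]

theorem Core.caseC3c (H : Core S z v kk g N D) (H3 : ∀ p ∈ D, 3 ≤ #(bin S g p))
    (hs1 : 2 / 11 < v z) (hs2 : v z ≤ 1 / 5) (I : Ist S z v kk N i xs be) (hbe : (1 - v z) / 3 < v be)
    {jm : ℕ} {m x y : α} (B : Mb S z v kk N jm m x y) (hx4 : 1 / 4 < v x) : False := by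
  have hmb := B.le_be H H3 hs1 hs2 I
  have hm1 := B.m1
  have hm3 := B.m3
  have hf := B.full
  have hx3 := B.x3
  have hyx := B.yx
  have hB : ∀ u ∈ bin S kk jm, v u ≤ v m := by
    intro u hu
    rw [B.hX] at hu; simp at hu
    rcases hu with rfl | rfl | rfl <;> linarith
  obtain ⟨κ, hκ⟩ : ∃ κ, κ = max ((1 - v z) / 3) (1 - v z - v x - v y) := ⟨_, rfl⟩
  have k1 : (1 - v z) / 3 ≤ κ := hκ ▸ le_max_left _ _
  have k2 : 1 - v z - v x - v y ≤ κ := hκ ▸ le_max_right _ _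
  have k3 : κ < v m := by rw [hκ]; exact max_lt hm1 (by linarith)
  have hL : (5:ℚ) / 3 ≤ 0 ∨ ∃ j0 ∈ N, ∃ u ∈ bin S kk j0, κ < v u ∧ ∀ y ∈ bin S kk j0, 3 * v y ≤ 1 :=
    Or.inr ⟨jm, B.jN, m, mem_bin.2 ⟨B.mS, B.mkj⟩, k3, fun u hu => by linarith [hB u hu]⟩
  have hpen : ∀ d : ℚ, 0 ≤ d → ∑ j ∈ N, pen (fun j => j = jm) d j ≤ d := fun d hd =>
    sum_pen N hd (fun _ _ _ _ h h' => h.trans h'.symm)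
  have hMM : ∀ (d : ℚ), 0 ≤ d → ∀ w : α → ℚ, (∀ y ∈ S, 17 / 2 ≤ w y) → (∀ y ∈ S, κ < v y → 12 ≤ w y) →
      36 - d ≤ w m + w x + w y → ∀ j ∈ N, ∀ t ∈ bin S kk j,
      (∀ y ∈ bin S kk j, v y ≤ v t) → (1 - v z) / 3 < v t → v t ≤ 1 / 3 →
      36 - pen (fun j => j = jm) d j ≤ ∑ y ∈ bin S kk j, w y := by
    intro d hd w wb wM hw j hj t ht htop h1 h3
    have p := pen_nonneg (Q := fun j => j = jm) hd j
    rcases lt_trichotomy j jm with hl | he | hl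
    · have := B.before H hj htop h3 hl (w := w) (fun y hy => by linarith [wb y hy]) (fun y hy h => wM y hy (by linarith))
      linarith
    · rw [pen_of (Q := fun j => j = jm) he, he, B.sum w]
      exact hw
    · linarith [B.after_x H ht h3 hl]
  by_cases hy4 : 1 / 4 < v y
  · refine H.C3w H3 hs1 hs2 I κ (v y) 0 4 (4 / 3) (pen (fun j => j = jm) 4) k1 (by linarith) hy4 (by linarith)
      (by linarith) le_rfl (by norm_num) (fun j => pen_nonneg (by norm_num) j) (hpen _ (by norm_num)) hL ?_ (Or.inl le_rfl) (by norm_num)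
    intro w wb wT wq wM
    exact hMM 4 (by norm_num) w wb wM (by linarith [wM m B.mS k3, wq x B.xS hyx, wq y B.yS le_rfl])
  · refine H.C3w H3 hs1 hs2 I κ (v x) 0 (31 / 6) 0 (pen (fun j => j = jm) (31 / 6)) k1 (by linarith) hx4 (by linarith)
      (by linarith) le_rfl (by norm_num) (fun j => pen_nonneg (by norm_num) j) (hpen _ (by norm_num)) hL ?_ (Or.inr ?_) (by norm_num)
    · intro w wb wT wq wM
      exact hMM (31 / 6) (by norm_num) w wb wM
        (by linarith [wM m B.mS k3, wq x B.xS le_rfl, wT y B.yS (by linarith)])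
    · intro j hj t ht htop h1 h3
      rcases lt_trichotomy j jm with hl | he | hl
      · obtain ⟨u, hu, h⟩ := H.later hj B.mS (B.mkj.symm ▸ hl)
        linarith [htop u hu]
      · subst he
        linarith [htop m (mem_bin.2 ⟨B.mS, B.mkj⟩)]
      · linarith [B.after_y H ht (by linarith) hl]

theorem Core.caseC3 (H : Core S z v kk g N D) (H3 : ∀ p ∈ D, 3 ≤ #(bin S g p))
    (hs1 : 2 / 11 < v z) (hs2 : v z ≤ 1 / 5) (I : Ist S z v kk N i xs be) (hbe : (1 - v z) / 3 < v be) : False := by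
  by_cases hbad : ∃ jm ∈ N, Bad S v kk ((1 - v z) / 3) 3 jm
  · obtain ⟨jm, hjm, hbad⟩ := hbad
    obtain ⟨m, hm, htop⟩ := H.top hjm
    have hm3 : v m ≤ 1 / 3 := by have := hbad.1 m hm; push_cast at this; linarith
    have hm1 : (1 - v z) / 3 < v m := by
      obtain ⟨u, hu, h⟩ := hbad.2.1
      exact h.trans_le (htop u hu)
    have hmS := (mem_bin.1 hm).1
    have h3 := H.cardge hjm (v m) htop 2 (by push_cast; linarith)
    rcases H.split3 hjm hm htop h3 with h4 | ⟨x, y, hx, hy, hxS, hyS, hyx, hxm, hf, hX, hsum⟩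
    · refine H.caseC3a' H3 hs1 hs2 I hbe hjm hbad hm hm1 ?_
      intro w wb wM
      have := wcb (k := 3) (w := w) (b := 17 / 2) hm (fun y hy => wb y (mem_bin.1 hy).1) (by norm_num) h4
      push_cast at this
      linarith [wM m hmS hm1]
    · by_cases hx3 : (1 - v z) / 3 < v x
      · refine H.caseC3a' H3 hs1 hs2 I hbe hjm hbad hm hm1 ?_
        intro w wb wM
        rw [hsum]
        linarith [wM m hmS hm1, wM x hxS hx3, wb y hyS]
      · have B : Mb S z v kk N jm m x y :=
          ⟨hjm, hX, hsum, hmS, (mem_bin.1 hm).2, hxS, hyS, hm3, hm1, hyx, not_lt.1 hx3, hf⟩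
        by_cases hx4 : v x ≤ 1 / 4
        · exact H.caseC3b H3 hs1 hs2 I B hx4
        · exact H.caseC3c H3 hs1 hs2 I hbe B (not_le.1 hx4)
  · push Not at hbad
    refine H.C3w H3 hs1 hs2 I ((1 - v z) / 3) ((1 - v z) / 3) (5 / 3) 0 (4 / 3) (fun _ => 0)
      le_rfl hbe (by linarith) le_rfl (by linarith) (by norm_num) (by norm_num) (fun j => le_rfl)
      (by simp) (Or.inl le_rfl) ?_ (Or.inl le_rfl) (by norm_num)
    intro w wb wT wq wM j hj t ht htop h1 h3
    have := H.notbad36 wb wM ht htop h1 h3 (hbad j hj)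
    linarith

theorem Core.false (H : Core S z v kk g N D) : False := by
  obtain ⟨S, g, N, D, H, H3⟩ := Core.reduce _ rfl H
  by_cases h1 : v z ≤ 2 / 11
  · exact H.case1 h1
  rw [not_le] at h1
  by_cases h2 : 1 / 4 < v z
  · exact H.case2 H3 h2
  rw [not_lt] at h2
  by_cases hI : ∀ j ∈ N, ∀ x y, Two S v kk j x y → 1 / 3 < v y
  · by_cases h3 : 1 / 5 < v z
    · exact H.caseA0 H3 h3 h2 hI
    · exact H.caseC0 H3 h1 (not_lt.1 h3) hI
  obtain ⟨i, xs, be, I⟩ := H.exists_ist hI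
  by_cases h3 : 1 / 5 < v z
  · by_cases hbe : v be ≤ (1 - v z) / 3
    · exact H.caseA1 H3 h3 h2 I hbe
    rw [not_le] at hbe
    by_cases hx : 1 / 2 < v xs
    · exact H.caseA2 H3 h3 h2 I hbe hx
    · exact H.caseA3 H3 h3 h2 I hbe (not_lt.1 hx)
  rw [not_lt] at h3
  by_cases hb : v be ≤ 1 / 4
  · by_cases hb2 : (1 - 3 * v z) / 2 < v be
    · exact H.caseC1 H3 h1 h3 I hb hb2
    · exact H.caseC1' H3 h1 h3 I hb (not_lt.1 hb2)
  rw [not_le] at hb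
  by_cases hbe : v be ≤ (1 - v z) / 3
  · exact H.caseC2 H3 h1 h3 I hb hbe
  · exact H.caseC3 H3 h1 h3 I (not_le.1 hbe)

end
end HF

namespace HF

theorem hffdBundle_sub {n : ℕ} (v : Fin n → α → ℚ) (τ : Fin n → ℚ) (Ag : Finset (Fin n)) :
    ∀ (R : List α) (B : Finset α), B ⊆ hffdBundle v τ Ag R B
  | [], B => by simp [hffdBundle]
  | c :: R, B => by
    rw [hffdBundle]
    split_ifs
    · exact (subset_insert c B).trans (hffdBundle_sub v τ Ag R _)
    · exact hffdBundle_sub v τ Ag R B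

theorem hffdBundle_mem {n : ℕ} (v : Fin n → α → ℚ) (τ : Fin n → ℚ) (Ag : Finset (Fin n)) (x : α) :
    ∀ (R : List α) (B : Finset α), x ∈ hffdBundle v τ Ag R B → x ∈ B ∨ x ∈ R
  | [], B => by simp [hffdBundle]
  | c :: R, B => by
    rw [hffdBundle]
    split_ifs
    · intro h
      rcases hffdBundle_mem v τ Ag x R _ h with h | h
      · rcases mem_insert.1 h with h | h <;> simp [h]
      · simp [h]
    · intro h
      rcases hffdBundle_mem v τ Ag x R _ h with h | h <;> simp [h]

theorem hffdBundle_ff {n : ℕ} (v : Fin n → α → ℚ) (τ : Fin n → ℚ) (Ag : Finset (Fin n)) (i : Fin n)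
    (hi : i ∈ Ag) (x : α) :
    ∀ (R : List α) (B : Finset α), (∀ a ∈ R, 0 < v i a) → (∀ b ∈ B, 0 < v i b) →
      (∀ a ∈ R, ∀ b ∈ B, v i a ≤ v i b) → R.Pairwise (fun c c' => v i c' ≤ v i c) →
      x ∈ R → x ∉ hffdBundle v τ Ag R B →
      τ i < v i x + ∑ y ∈ (hffdBundle v τ Ag R B).filter (fun y => v i x ≤ v i y), v i y
  | [], B => by simp
  | c :: R, B => by
    intro h1 h2 h3 h4 hx hxB
    rw [List.pairwise_cons] at h4
    have h1' : ∀ a ∈ R, 0 < v i a := fun a ha => h1 a (by simp [ha])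
    rw [hffdBundle] at hxB ⊢
    split_ifs at hxB ⊢ with hc
    · have hxc : x ≠ c := by
        rintro rfl
        exact hxB (hffdBundle_sub v τ Ag R _ (mem_insert_self _ _))
      have hxR : x ∈ R := by simpa [hxc] using hx
      refine hffdBundle_ff v τ Ag i hi x R _ h1' ?_ ?_ h4.2 hxR hxB
      · intro b hb
        rcases mem_insert.1 hb with rfl | hb
        · exact h1 _ (by simp)
        · exact h2 b hb
      · intro a ha b hb
        rcases mem_insert.1 hb with rfl | hb
        · exact h4.1 a ha
        · exact h3 a (by simp [ha]) b hb
    · by_cases hxc : x = c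
      · subst hxc
        push Not at hc
        have := hc i hi
        have hsub : B ⊆ (hffdBundle v τ Ag R B).filter (fun y => v i x ≤ v i y) := by
          intro b hb
          exact mem_filter.2 ⟨hffdBundle_sub v τ Ag R B hb, h3 x (by simp) b hb⟩
        have h5 : ∑ y ∈ B, v i y ≤ ∑ y ∈ (hffdBundle v τ Ag R B).filter (fun y => v i x ≤ v i y), v i y := by
          apply Finset.sum_le_sum_of_subset_of_nonneg hsub
          intro y hy _
          exact (lt_of_lt_of_le (h1 x (by simp)) (mem_filter.1 hy).2).le
        have hxB' : x ∉ B := fun h => hxB (hffdBundle_sub v τ Ag R B h)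
        unfold bundleCost at this
        rw [sum_insert hxB'] at this
        linarith
      · have hxR : x ∈ R := by simpa [hxc] using hx
        exact hffdBundle_ff v τ Ag i hi x R B h1' h2 (fun a ha => h3 a (by simp [ha])) h4.2 hxR hxB

theorem state_sub {n : ℕ} (v : Fin n → α → ℚ) (τ : Fin n → ℚ) (L : List α) (σ : ℕ → Fin n) {a b : ℕ}
    (h : a ≤ b) : (hffdState v τ L σ b).1.Sublist (hffdState v τ L σ a).1 ∧
      (hffdState v τ L σ b).2 ⊆ (hffdState v τ L σ a).2 := by
  induction h with
  | refl => exact ⟨List.Sublist.refl _, Finset.Subset.refl _⟩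
  | step h ih =>
    rw [hffdState]
    exact ⟨List.filter_sublist.trans ih.1, (erase_subset _ _).trans ih.2⟩

theorem mem_state_succ {n : ℕ} (v : Fin n → α → ℚ) (τ : Fin n → ℚ) (L : List α) (σ : ℕ → Fin n) (k : ℕ)
    (x : α) : x ∈ (hffdState v τ L σ (k+1)).1 ↔
      x ∈ (hffdState v τ L σ k).1 ∧ x ∉ hffdBundleAt v τ L σ k := by
  rw [hffdState]
  simp [hffdBundleAt]

theorem mem_state_of_bundle {n : ℕ} (v : Fin n → α → ℚ) (τ : Fin n → ℚ) (L : List α) (σ : ℕ → Fin n) (k : ℕ)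
    (x : α) (h : x ∈ hffdBundleAt v τ L σ k) : x ∈ (hffdState v τ L σ k).1 := by
  rcases hffdBundle_mem _ _ _ _ _ _ h with h | h
  · simp at h
  · exact h

theorem main_of_core
    (core : ∀ (S : Finset α) (z : α) (v : α → ℚ) (kk g : α → ℕ) (N D : Finset ℕ),
      Core S z v kk g N D → False)
    (n : ℕ) (hn : 2 ≤ n) (M : Finset α)
    (v : Fin n → α → ℚ) (hv : ∀ i, ∀ c ∈ M, 0 < v i c)
    (L : List α) (hL : IsUniversalOrder v M L)
    (hmms : ∀ i, IsMMS (v i) M (9 * n / 11) 1)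
    (τ : Fin n → ℚ) (hτ : ∀ i, 1 ≤ τ i)
    (σ : ℕ → Fin n) (hσ : ValidHFFDRun v τ L σ) :
    (hffdState v τ L σ n).1 = [] := by
  by_contra hne
  obtain ⟨z, hz⟩ := List.exists_mem_of_ne_nil _ hne
  obtain ⟨hLM, hLn, hLp⟩ := hL
  have hmemL : ∀ {k x}, x ∈ (hffdState v τ L σ k).1 → x ∈ L := fun {k x} h =>
    (state_sub v τ L σ (Nat.zero_le k)).1.subset h
  have hLM' : ∀ {x}, x ∈ L → x ∈ M := fun {x} h => by rw [← hLM]; simpa using h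
  set i := σ (n-1) with hi
  have hag : ∀ k < n, i ∈ (hffdState v τ L σ k).2 := by
    intro k hk
    exact (state_sub v τ L σ (show k ≤ n-1 by omega)).2 (hσ (n-1) (by omega)).1
  have hτ0 : 0 < τ i := lt_of_lt_of_le one_pos (hτ i)
  have hex : ∀ x, ∃ k, x ∈ hffdBundleAt v τ L σ k ∨ n ≤ k := fun x => ⟨n, Or.inr le_rfl⟩
  let kk : α → ℕ := fun x => Nat.find (hex x)
  have hkk1 : ∀ x, kk x < n → x ∈ hffdBundleAt v τ L σ (kk x) := by
    intro x hx
    rcases Nat.find_spec (hex x) with h | h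
    · exact h
    · exact absurd hx (not_lt.2 h)
  have hkk2 : ∀ x j, j < kk x → x ∉ hffdBundleAt v τ L σ j := by
    intro x j hj h
    exact Nat.find_min (hex x) hj (Or.inl h)
  have hkkn : ∀ x, kk x ≤ n := fun x => Nat.find_min' _ (Or.inr le_rfl)
  have hstay : ∀ x ∈ L, ∀ j, j ≤ kk x → x ∈ (hffdState v τ L σ j).1 := by
    intro x hx j
    induction j with
    | zero => intro _; exact hx
    | succ j ih =>
      intro hj
      rw [mem_state_succ]
      exact ⟨ih (by omega), hkk2 x j (by omega)⟩
  have hkk3 : ∀ x j, j < n → x ∈ hffdBundleAt v τ L σ j → kk x = j := by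
    intro x j hj h
    refine le_antisymm (Nat.find_min' _ (Or.inl h)) ?_
    by_contra hlt
    push Not at hlt
    have h1 := hkk1 x (by omega)
    have h2 := (state_sub v τ L σ (show kk x + 1 ≤ j from hlt)).1.subset (mem_state_of_bundle _ _ _ _ _ _ h)
    rw [mem_state_succ] at h2
    exact h2.2 h1
  have hzL := hmemL hz
  have hkz : kk z = n := by
    refine le_antisymm (hkkn z) ?_
    by_contra hlt
    push Not at hlt
    have h2 := (state_sub v τ L σ (show kk z + 1 ≤ n from hlt)).1.subset hz
    rw [mem_state_succ] at h2
    exact h2.2 (hkk1 z hlt)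
  obtain ⟨⟨P, ⟨hP1, hP2, hP3⟩, hP4⟩, -⟩ := hmms i
  have hexg : ∀ x, ∃ q : ℕ, x ∈ M → ∃ h : q < 9 * n / 11, x ∈ P ⟨q, h⟩ := by
    intro x
    by_cases hx : x ∈ M
    · obtain ⟨j, hj⟩ := hP3 x hx
      exact ⟨j.1, fun _ => ⟨j.2, hj⟩⟩
    · exact ⟨0, fun h => absurd h hx⟩
  choose g hg using hexg
  let S := L.toFinset.filter (fun x => v i z ≤ v i x ∧ (kk x < n ∨ x = z))
  have hS : ∀ x, x ∈ S ↔ x ∈ L ∧ v i z ≤ v i x ∧ (kk x < n ∨ x = z) := by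
    intro x; simp [S]
  have hpos : ∀ x ∈ L, 0 < v i x := fun x hx => hv i x (hLM' hx)
  refine core S z (fun x => v i x / τ i) kk g (range n) (range (9 * n / 11)) ⟨?_, ?_, ?_, ?_, ?_, ?_, ?_, ?_, ?_⟩
  · rw [hS]; exact ⟨hzL, le_rfl, Or.inr rfl⟩
  · intro j hj; rw [hkz]; exact mem_range.1 hj
  · intro x hx hxz
    rw [hS] at hx
    exact mem_range.2 (hx.2.2.resolve_right hxz)
  · intro x hx j hj hjx
    rw [hS] at hx
    have hjn := mem_range.1 hj
    have key := hffdBundle_ff v τ (hffdState v τ L σ j).2 i (hag j hjn) x (hffdState v τ L σ j).1 ∅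
      (fun a ha => hpos a (hmemL ha)) (by simp) (by simp)
      (List.Pairwise.sublist (state_sub v τ L σ (Nat.zero_le j)).1 (hLp i))
      (hstay x hx.1 j hjx.le) (hkk2 x j hjx)
    have hsum : ∑ y ∈ (hffdBundle v τ (hffdState v τ L σ j).2 (hffdState v τ L σ j).1 ∅).filter (fun y => v i x ≤ v i y), v i y ≤
        ∑ y ∈ (bin S kk j).filter (fun y => v i x / τ i ≤ v i y / τ i), v i y := by
      apply Finset.sum_le_sum_of_subset_of_nonneg
      · intro y hy
        rw [mem_filter] at hy
        have hyj := hkk3 y j hjn hy.1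
        refine mem_filter.2 ⟨mem_bin.2 ⟨(hS y).2 ⟨hmemL (mem_state_of_bundle _ _ _ _ _ _ hy.1), hx.2.1.trans hy.2, Or.inl (hyj ▸ hjn)⟩, hyj⟩, ?_⟩
        exact (div_le_div_iff_of_pos_right hτ0).2 hy.2
      · intro y hy _
        exact (hpos y ((hS y).1 (mem_bin.1 (mem_filter.1 hy).1).1).1).le
    have h2 : τ i < v i x + ∑ y ∈ (bin S kk j).filter (fun y => v i x / τ i ≤ v i y / τ i), v i y := by linarith
    rw [← Finset.sum_div, ← add_div, lt_div_iff₀ hτ0]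
    linarith
  · exact div_pos (hpos z hzL) hτ0
  · intro x hx
    exact (div_le_div_iff_of_pos_right hτ0).2 ((hS x).1 hx).2.1
  · intro x hx
    obtain ⟨h, _⟩ := hg x (hLM' ((hS x).1 hx).1)
    exact mem_range.2 h
  · intro p hp
    rw [← Finset.sum_div, div_le_one hτ0]
    refine le_trans ?_ (hτ i)
    refine le_trans ?_ (hP4 ⟨p, mem_range.1 hp⟩)
    apply Finset.sum_le_sum_of_subset_of_nonneg
    · intro y hy
      rw [mem_bin, hS] at hy
      obtain ⟨h, h'⟩ := hg y (hLM' hy.1.1)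
      have : (⟨g y, h⟩ : Fin (9 * n / 11)) = ⟨p, mem_range.1 hp⟩ := by simp [hy.2]
      rwa [this] at h'
    · intro y hy _
      exact (hv i y (hP1 _ hy)).le
  · simp only [card_range]; omega

end HF

/-- on an IDO instance where every agent's `⌊9n/11⌋`-maximin share is `1`,
HFFD run with thresholds `τ i ≥ 1` allocates all chores. -/
theorem hffd_allocates_all_of_mms_one
    (n : ℕ) (hn : 2 ≤ n) (M : Finset α)
    (v : Fin n → α → ℚ) (hv : ∀ i, ∀ c ∈ M, 0 < v i c)
    (L : List α) (hL : IsUniversalOrder v M L)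
    (hmms : ∀ i, IsMMS (v i) M (9 * n / 11) 1)
    (τ : Fin n → ℚ) (hτ : ∀ i, 1 ≤ τ i)
    (σ : ℕ → Fin n) (hσ : ValidHFFDRun v τ L σ) :
    (hffdState v τ L σ n).1 = [] := by
  exact HF.main_of_core (fun _ _ _ _ _ _ _ H => H.false) n hn M v hv L hL hmms τ hτ σ hσ
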